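/- arXiv:1701.02625 — 2 statements merged into one kernel-verified Lean document; each statement's English description precedes it below -/
import Mathlib

section
/- Let (A,B) ∈ ℝ² satisfy (A-1)–(A-3) and (B-1)–(B-2), and suppose E[|B|^{α−ε} A^{ε}] < ∞ for some 0 < ε ≤ 1/2 with ε < α/2. Let R be the (in law unique) solution of the random affine equation R =_d AR + B with R independent of (A,B). Then, as x → ∞, x^α P(R > x) ∼ L̃(x)/ρ, where ρ = E[A^α log A]. -/
open MeasureTheory ProbabilityTheory Filter Set

noncomputable section

/-- A measurable function `L : (0,∞) → (0,∞)` is slowly varying: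
`L(λx)/L(x) → 1` as `x → ∞` for every `λ > 0`. -/
def SlowlyVarying (L : ℝ → ℝ) : Prop :=
  (∀ x > 0, 0 < L x) ∧ ∀ l : ℝ, 0 < l →
    Filter.Tendsto (fun x => L (l * x) / L x) Filter.atTop (nhds 1)

open scoped Topology

/-- A reverse Fatou lemma: pointwise asymptotic upper bounds of a dominated sequence pass to
the integrals. -/
theorem eventually_integral_le_of_dominated {X : Type*} [MeasurableSpace X] {ν : Measure X}
    {F : ℕ → X → ℝ} {D ψ : X → ℝ} (hF : ∀ n, AEStronglyMeasurable (F n) ν)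
    (hD : Integrable D ν) (hFD : ∀ n x, |F n x| ≤ D x) (hψ : Integrable ψ ν)
    (hle : ∀ x, ∀ η > 0, ∀ᶠ n in atTop, F n x ≤ ψ x + η) {η : ℝ} (hη : 0 < η) :
    ∀ᶠ n in atTop, ∫ x, F n x ∂ν ≤ ∫ x, ψ x ∂ν + η := by
  have hFi : ∀ n, Integrable (F n) ν := fun n =>
    hD.mono' (hF n) (Eventually.of_forall fun x => hFD n x)
  have hlim : Tendsto (fun n => ∫ x, max (F n x - ψ x) 0 ∂ν) atTop (𝓝 (∫ _, (0:ℝ) ∂ν)) := by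
    refine tendsto_integral_of_dominated_convergence (fun x => D x + |ψ x|) (fun n => ?_)
      (hD.add hψ.abs) (fun n => Eventually.of_forall fun x => ?_)
      (Eventually.of_forall fun x => ?_)
    · exact ((hFi n).sub hψ).pos_part.aestronglyMeasurable
    · have h1 := abs_le.1 (hFD n x)
      have h2 := neg_abs_le (ψ x)
      have h3 := abs_nonneg (ψ x)
      rw [Real.norm_eq_abs, abs_of_nonneg (le_max_right _ _)]
      exact max_le (by linarith) (by linarith [abs_nonneg (F n x), hFD n x])
    · rw [Metric.tendsto_atTop']
      intro r hr
      obtain ⟨N, hN⟩ := eventually_atTop.1 (hle x (r / 2) (by positivity))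
      refine ⟨N, fun n hn => ?_⟩
      rw [Real.dist_eq, sub_zero, abs_of_nonneg (le_max_right _ _)]
      exact max_lt (by linarith [hN n hn.le]) hr
  rw [integral_zero] at hlim
  filter_upwards [hlim.eventually (gt_mem_nhds hη)] with n hn
  have : ∫ x, F n x ∂ν ≤ ∫ x, (ψ x + max (F n x - ψ x) 0) ∂ν :=
    integral_mono (hFi n) (hψ.add ((hFi n).sub hψ).pos_part)
      (fun x => by have := le_max_left (F n x - ψ x) 0; dsimp only; linarith)
  have h2 := integral_add hψ ((hFi n).sub hψ).pos_part
  simp only [Pi.sub_apply] at h2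
  linarith

/-- A maximum principle for asymptotically harmonic sequences: if the extremal value `c` is
attained in the limit at `0`, it is attained in the limit everywhere. -/
theorem tendsto_of_asymptotically_harmonic {ν : Measure ℝ} [IsProbabilityMeasure ν]
    {v e : ℕ → ℝ → ℝ} {D : ℝ → ℝ} {c : ℝ} (hv : ∀ n, Measurable (v n))
    (hD : ∀ s, Integrable (fun z => D (s - z)) ν) (hvD : ∀ n s, |v n s| ≤ D s)
    (heq : ∀ n s, v n s = ∫ z, v n (s - z) ∂ν + e n s)
    (he : ∀ s, Tendsto (fun n => e n s) atTop (𝓝 0))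
    (hequi : ∀ s, ∀ η > 0, ∃ r > 0, ∀ n s', |s' - s| < r → |v n s' - v n s| ≤ η)
    (hle : ∀ s, ∀ η > 0, ∀ᶠ n in atTop, v n s ≤ c + η)
    (h0 : Tendsto (fun n => v n 0) atTop (𝓝 c))
    (hdense : ∀ S : Set ℝ, IsClosed S → 0 ∈ S → (∀ s ∈ S, ∀ z ∈ ν.support, s - z ∈ S) →
      S = univ) (s : ℝ) :
    Tendsto (fun n => v n s) atTop (𝓝 c) := by
  suffices h : {s | Tendsto (fun n => v n s) atTop (𝓝 c)} = univ by
    have : s ∈ {s | Tendsto (fun n => v n s) atTop (𝓝 c)} := h ▸ mem_univ s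
    exact this
  refine hdense _ ?_ h0 ?_
  · refine isClosed_of_closure_subset fun s hs => ?_
    rw [mem_ofPred_eq, Metric.tendsto_atTop']
    intro η hη
    obtain ⟨r, hr, hr'⟩ := hequi s (η / 2) (by positivity)
    obtain ⟨s', hs', hd⟩ := Metric.mem_closure_iff.1 hs r hr
    obtain ⟨N, hN⟩ := Metric.tendsto_atTop'.1 hs' (η / 2) (by positivity)
    refine ⟨N, fun n hn => ?_⟩
    have h1 := hN n hn
    rw [dist_comm, Real.dist_eq] at hd
    have h2 := hr' n s' hd
    rw [Real.dist_eq] at h1 ⊢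
    rw [abs_sub_comm] at h2
    calc |v n s - c| ≤ |v n s - v n s'| + |v n s' - c| := abs_sub_le _ _ _
      _ < η := by linarith
  · intro s hs z₀ hz₀
    by_contra hcon
    obtain ⟨η, hη, hfreq⟩ : ∃ η > 0, ∃ᶠ n in atTop, v n (s - z₀) < c - η := by
      by_contra! hno
      refine hcon ?_
      rw [mem_ofPred_eq, Metric.tendsto_nhds]
      intro η hη
      have h1 := hno (η / 2) (by positivity)
      filter_upwards [h1, hle (s - z₀) (η / 2) (by positivity)] with n h1 h2
      rw [Real.dist_eq, abs_lt]
      constructor <;> linarith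
    obtain ⟨φ, hφ, hφ'⟩ := extraction_of_frequently_atTop hfreq
    obtain ⟨r, hr, hr'⟩ := hequi (s - z₀) (η / 2) (by positivity)
    set N : Set ℝ := Metric.ball z₀ r with hN
    have hNpos : 0 < ν N := (Measure.mem_support_iff_forall z₀).1 hz₀ N (Metric.ball_mem_nhds z₀ hr)
    have hp : 0 < ν.real N := ENNReal.toReal_pos hNpos.ne' (measure_ne_top _ _)
    have hNm : MeasurableSet N := measurableSet_ball
    have hind : Integrable (N.indicator fun _ => η / 2) ν :=
      (integrable_const (η / 2)).indicator hNm
    have key := eventually_integral_le_of_dominated (ν := ν) (F := fun n z => v (φ n) (s - z))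
      (D := fun z => D (s - z)) (ψ := fun z => c - N.indicator (fun _ => η / 2) z)
      (fun n => ((hv _).comp (measurable_const.sub measurable_id)).aestronglyMeasurable) (hD s)
      (fun n z => hvD _ _) ((integrable_const c).sub hind) (fun z η' hη' => by
        by_cases hz : z ∈ N
        · rw [indicator_of_mem hz]
          refine Eventually.of_forall fun n => ?_
          have h1 := hφ' n
          have h2 := hr' (φ n) (s - z) (by
            rw [hN, Metric.mem_ball, Real.dist_eq] at hz
            rw [show s - z - (s - z₀) = -(z - z₀) by ring, abs_neg]; exact hz)
          have := (abs_le.1 h2).2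
          linarith
        · rw [indicator_of_notMem hz]
          simp only [sub_zero]
          exact hφ.tendsto_atTop.eventually (hle (s - z) η' hη'))
      (η := η * ν.real N / 8) (by positivity)
    rw [integral_sub (integrable_const c) hind, integral_indicator hNm] at key
    simp only [integral_const, probReal_univ, smul_eq_mul, MeasurableSet.univ,
      measureReal_restrict_apply, univ_inter] at key
    have hpos : 0 < η * ν.real N / 8 := by positivity
    have h1 := (hs.comp hφ.tendsto_atTop).eventually
      (lt_mem_nhds (show c - η * ν.real N / 8 < c by linarith))
    have h2 := ((he s).comp hφ.tendsto_atTop).eventually (gt_mem_nhds hpos)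
    obtain ⟨n, h1, h2, h3⟩ := (h1.and (h2.and key)).exists
    simp only [Function.comp_apply] at h1 h2
    have := heq (φ n) s
    linarith

/-- If a dominated sequence converges pointwise to the constant `c`, the expected integrals over
`[-z, 0]` converge to `c` times the mean of `z`. -/
theorem tendsto_integral_intervalIntegral {ν : Measure ℝ} [IsProbabilityMeasure ν]
    {v : ℕ → ℝ → ℝ} {c M α : ℝ} (hα : 0 < α) (hv : ∀ n, Continuous (v n))
    (hvD : ∀ n s, |v n s| ≤ M * (1 + Real.exp (α * s)))
    (hν : Integrable (fun z => z) ν) (hνα : Integrable (fun z => Real.exp (-(α * z))) ν)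
    (hlim : ∀ s, Tendsto (fun n => v n s) atTop (𝓝 c)) :
    Tendsto (fun n => ∫ z, (∫ s in (-z)..0, v n s) ∂ν) atTop (𝓝 (c * ∫ z, z ∂ν)) := by
  have hM : 0 ≤ M := by
    have h1 := (abs_nonneg _).trans (hvD 0 0)
    simp only [mul_zero, Real.exp_zero] at h1
    linarith
  have hDc : Continuous fun s => M * (1 + Real.exp (α * s)) := by fun_prop
  have hprim : ∀ a b, ∫ s in a..b, M * (1 + Real.exp (α * s)) =
      M * ((b - a) + (Real.exp (α * b) - Real.exp (α * a)) / α) := by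
    intro a b
    have hd : ∀ s, HasDerivAt (fun s => M * (s + Real.exp (α * s) / α))
        (M * (1 + Real.exp (α * s))) s := by
      intro s
      have h1 : HasDerivAt (fun s => Real.exp (α * s)) (Real.exp (α * s) * α) s := by
        simpa using ((hasDerivAt_id s).const_mul α).exp
      have h2 := ((hasDerivAt_id s).add (h1.div_const α)).const_mul M
      rwa [mul_div_cancel_right₀ _ hα.ne'] at h2
    rw [intervalIntegral.integral_eq_sub_of_hasDerivAt (fun s _ => hd s)
      (hDc.intervalIntegrable _ _)]
    ring
  rw [← integral_const_mul]
  refine tendsto_integral_of_dominated_convergence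
    (fun z => M * (|z| + (1 + Real.exp (-(α * z))) / α)) (fun n => ?_) ?_
    (fun n => Eventually.of_forall fun z => ?_) (Eventually.of_forall fun z => ?_)
  · have : Continuous fun z => ∫ s in (-z)..0, v n s := by
      have h1 : (fun z => ∫ s in (-z)..0, v n s) = fun z => -∫ s in (0:ℝ)..(-z), v n s := by
        ext z; rw [intervalIntegral.integral_symm]
      rw [h1]
      exact ((intervalIntegral.continuous_primitive
        (fun a b => (hv n).intervalIntegrable a b) 0).comp continuous_neg).neg
    exact this.aestronglyMeasurable
  · exact (hν.abs.add (((integrable_const 1).add hνα).div_const α)).const_mul M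
  · have h1 : ‖∫ s in (-z)..0, v n s‖ ≤ |∫ s in (-z)..0, M * (1 + Real.exp (α * s))| :=
      intervalIntegral.norm_integral_le_abs_of_norm_le
        (Eventually.of_forall fun s => hvD n s) (hDc.intervalIntegrable _ _)
    refine h1.trans ?_
    rw [hprim, abs_mul, abs_of_nonneg hM]
    refine mul_le_mul_of_nonneg_left ?_ hM
    refine (abs_add_le _ _).trans (add_le_add (by simp) ?_)
    rw [abs_div, abs_of_pos hα]
    refine div_le_div_of_nonneg_right ?_ hα.le
    rw [mul_zero, Real.exp_zero, mul_neg]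
    have := Real.exp_pos (-(α * z))
    rw [abs_le]; constructor <;> linarith
  · have h1 : Tendsto (fun n => ∫ s in (-z)..0, v n s) atTop (𝓝 (∫ _ in (-z)..0, c)) := by
      refine intervalIntegral.tendsto_integral_filter_of_dominated_convergence
        (fun s => M * (1 + Real.exp (α * s)))
        (Eventually.of_forall fun n => (hv n).aestronglyMeasurable)
        (Eventually.of_forall fun n => Eventually.of_forall fun s _ => hvD n s)
        (hDc.intervalIntegrable _ _) (Eventually.of_forall fun s _ => hlim s)
    simpa [mul_comm] using h1

theorem AddSubmonoid.neg_mem_of_isClosed_of_mul_neg {C : AddSubmonoid ℝ}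
    (hC : IsClosed (C : Set ℝ)) {x y : ℝ} (hx : x ∈ C) (hy : y ∈ C) (hxy : x * y < 0) :
    -x ∈ C := by
  have hy0 : y ≠ 0 := by rintro rfl; simp at hxy
  have hξ : 0 < x / (-y) := by
    have : x / (-y) = -(x * y) / y ^ 2 := by field_simp
    rw [this]
    have : 0 < y ^ 2 := by positivity
    exact div_pos (by linarith) this
  refine hC.closure_subset (Metric.mem_closure_iff.2 fun η hη => ?_)
  obtain ⟨n, hn⟩ := exists_nat_gt (|y| / η)
  have hn0 : 0 < n := by
    have h1 : 0 ≤ |y| / η := by positivity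
    exact_mod_cast h1.trans_lt hn
  obtain ⟨k, hk, -, hkn⟩ := Real.exists_nat_abs_mul_sub_round_le (x / (-y)) hn0
  have hround : 0 ≤ round (k * (x / (-y))) := by
    rw [round_eq]
    exact Int.floor_nonneg.2 (by positivity)
  obtain ⟨j, hj⟩ := Int.eq_ofNat_of_zero_le hround
  obtain ⟨m, rfl⟩ : ∃ m, k = m + 1 := ⟨k - 1, by omega⟩
  refine ⟨m • x + j • y, C.add_mem (C.nsmul_mem hx m) (C.nsmul_mem hy j), ?_⟩
  rw [hj] at hkn
  have h1 : -x - (m • x + j • y) = y * (((m + 1 : ℕ) : ℝ) * (x / (-y)) - ((j : ℤ) : ℝ)) := by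
    simp only [nsmul_eq_mul]
    push_cast
    field_simp
    ring
  rw [Real.dist_eq, h1, abs_mul]
  have hn' : (0:ℝ) < n := by exact_mod_cast hn0
  calc |y| * _ ≤ |y| * (1 / (n + 1)) := by gcongr
    _ = |y| / (n + 1) := by ring
    _ < η := by
      rw [div_lt_iff₀ hη] at hn
      rw [div_lt_iff₀ (by positivity)]
      nlinarith

/-- A closed set of reals containing `0` and stable under subtraction of the elements of a
non-arithmetic set meeting both half-lines is the whole line. -/
theorem eq_univ_of_isClosed_of_sub_mem {S T : Set ℝ} (hS : IsClosed S) (h0 : 0 ∈ S)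
    (hST : ∀ s ∈ S, ∀ z ∈ T, s - z ∈ S) (hpos : ∃ p ∈ T, 0 < p) (hneg : ∃ q ∈ T, q < 0)
    (hna : ¬ ∃ d : ℝ, ∀ z ∈ T, ∃ k : ℤ, z = d * k) : S = univ := by
  set C := (AddSubmonoid.closure T).topologicalClosure with hC
  have hCc : IsClosed (C : Set ℝ) := AddSubmonoid.isClosed_topologicalClosure _
  have hTC : ∀ z ∈ T, z ∈ C := fun z hz =>
    AddSubmonoid.le_topologicalClosure _ (AddSubmonoid.subset_closure hz)
  obtain ⟨p, hp, hp0⟩ := hpos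
  obtain ⟨q, hq, hq0⟩ := hneg
  let H : AddSubgroup ℝ :=
    { C with
      neg_mem' := by
        intro x hx
        rcases lt_trichotomy x 0 with h | h | h
        · exact AddSubmonoid.neg_mem_of_isClosed_of_mul_neg hCc hx (hTC p hp)
            (mul_neg_of_neg_of_pos h hp0)
        · subst h; rw [neg_zero]; exact C.zero_mem
        · exact AddSubmonoid.neg_mem_of_isClosed_of_mul_neg hCc hx (hTC q hq)
            (mul_neg_of_pos_of_neg h hq0) }
  have hsub : ∀ m ∈ C, -m ∈ S := by
    have h1 : ∀ m ∈ AddSubmonoid.closure T, ∀ s ∈ S, s - m ∈ S := by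
      intro m hm
      induction hm using AddSubmonoid.closure_induction with
      | mem z hz => exact fun s hs => hST s hs z hz
      | zero => intro s hs; simpa using hs
      | add a b _ _ ha hb =>
        intro s hs
        rw [← sub_sub]
        exact hb _ (ha s hs)
    have h2 : closure (AddSubmonoid.closure T : Set ℝ) ⊆ Neg.neg ⁻¹' S :=
      closure_minimal (fun m hm => by simpa using h1 m hm 0 h0) (hS.preimage continuous_neg)
    exact fun m hm => h2 hm
  rcases AddSubgroup.dense_or_cyclic H with h | ⟨a, ha⟩
  · have hH : (C : Set ℝ) = univ := by
      have h1 : closure (C : Set ℝ) = univ := h.closure_eq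
      rwa [hCc.closure_eq] at h1
    refine eq_univ_of_forall fun x => ?_
    have : -x ∈ C := by
      have : -x ∈ (C : Set ℝ) := hH ▸ mem_univ _
      exact this
    simpa using hsub _ this
  · refine (hna ⟨a, fun z hz => ?_⟩).elim
    have h1 : z ∈ H := hTC z hz
    rw [ha, AddSubgroup.mem_closure_singleton] at h1
    obtain ⟨k, hk⟩ := h1
    exact ⟨k, by rw [← hk, zsmul_eq_mul, mul_comm]⟩

/-- The analytic setting of the implicit renewal argument, in logarithmic coordinates: `J` is the
integrated version of the function `f` of interest, `G` the inhomogeneity of the integrated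
renewal equation driven by the step law `ν`, and `Λ` the slowly varying normalization. -/
structure RenewalSetting (ν : Measure ℝ) (α δ : ℝ) (f J G Λ : ℝ → ℝ) : Prop where
  prob : IsProbabilityMeasure ν
  α_pos : 0 < α
  δ_pos : 0 < δ
  mean_int : Integrable (fun z => z) ν
  mean_pos : 0 < ∫ z, z ∂ν
  exp_α_int : Integrable (fun z => Real.exp (-(α * z))) ν
  exp_δ_int : Integrable (fun z => Real.exp (-(δ * z))) ν
  exp_δ_lt : ∫ z, Real.exp (-(δ * z)) ∂ν < 1
  dense : ∀ S : Set ℝ, IsClosed S → 0 ∈ S → (∀ s ∈ S, ∀ z ∈ ν.support, s - z ∈ S) → S = univ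
  f_nonneg : ∀ t, 0 ≤ f t
  f_le : ∃ C, ∀ t, f t ≤ C * Real.exp (δ * max t 0)
  J_nonneg : ∀ t, 0 ≤ J t
  J_mono : Monotone J
  J_upper : ∀ t h, 0 ≤ h → J (t + h) - J t ≤ (Real.exp (α * h) - 1) / α * f t
  J_lower : ∀ t h, 0 ≤ h →
    (Real.exp (α * h) - 1) / α * Real.exp (-(α * h)) * f (t + h) ≤ J (t + h) - J t
  J_scale : ∀ t h s, 0 ≤ h → 0 ≤ s →
    J (t + s + h) - J (t + s) ≤ Real.exp (α * s) * (J (t + h) - J t)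
  J_int : ∀ t, Integrable (fun z => J (t - z)) ν
  J_eq : ∀ t, J t = ∫ z, J (t - z) ∂ν + G t
  Λ_one : ∀ t, 1 ≤ Λ t
  Λ_mono : Monotone Λ
  Λ_slow : ∀ s, Tendsto (fun t => Λ (t + s) / Λ t) atTop (𝓝 1)
  G_equiv : Tendsto (fun t => G t / Λ t) atTop (𝓝 1)

namespace RenewalSetting

variable {ν : Measure ℝ} {α δ : ℝ} {f J G Λ : ℝ → ℝ}

theorem tendsto_modulus (α : ℝ) :
    Tendsto (fun r : ℝ => (Real.exp (α * |r|) - 1) / α) (𝓝 0) (𝓝 0) := by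
  have h : Continuous fun r : ℝ => (Real.exp (α * |r|) - 1) / α := by fun_prop
  simpa using h.tendsto 0

theorem modulus_nonneg (hα : 0 < α) {r : ℝ} (hr : 0 ≤ r) : 0 ≤ (Real.exp (α * r) - 1) / α :=
  div_nonneg (by linarith [Real.one_le_exp (mul_nonneg hα.le hr)]) hα.le

theorem continuous_J (S : RenewalSetting ν α δ f J G Λ) : Continuous J := by
  obtain ⟨C, hC⟩ := S.f_le
  have hC0 : 0 ≤ C := by simpa using (S.f_nonneg 0).trans (hC 0)
  rw [continuous_iff_continuousAt]
  intro t
  have hbd : ∀ s, |J s - J t| ≤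
      (Real.exp (α * |s - t|) - 1) / α * (C * Real.exp (δ * max t 0)) := by
    intro s
    have hm := modulus_nonneg S.α_pos (abs_nonneg (s - t))
    rcases le_total t s with h | h
    · have h1 := S.J_upper t (s - t) (by linarith)
      rw [add_sub_cancel] at h1
      rw [abs_of_nonneg (sub_nonneg.2 (S.J_mono h))]
      rw [abs_of_nonneg (sub_nonneg.2 h)] at hm ⊢
      exact h1.trans (mul_le_mul_of_nonneg_left (hC t) hm)
    · have h1 := S.J_upper s (t - s) (by linarith)
      rw [add_sub_cancel] at h1
      rw [abs_sub_comm, abs_of_nonneg (sub_nonneg.2 (S.J_mono h))]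
      rw [abs_sub_comm, abs_of_nonneg (sub_nonneg.2 h)] at hm ⊢
      refine h1.trans (mul_le_mul_of_nonneg_left ((hC s).trans ?_) hm)
      have := S.δ_pos
      gcongr
  rw [ContinuousAt, tendsto_iff_dist_tendsto_zero]
  refine squeeze_zero (fun _ => dist_nonneg) hbd ?_
  have h1 : Tendsto (fun s => s - t) (𝓝 t) (𝓝 0) := by
    have h2 : Continuous fun s : ℝ => s - t := by fun_prop
    simpa using h2.tendsto t
  simpa using ((tendsto_modulus α).comp h1).mul_const (C * Real.exp (δ * max t 0))

theorem continuous_G (S : RenewalSetting ν α δ f J G Λ) : Continuous G := by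
  have hG : G = fun t => J t - ∫ z, J (t - z) ∂ν := by
    ext t; linarith [S.J_eq t]
  rw [hG]
  refine S.continuous_J.sub ?_
  rw [continuous_iff_continuousAt]
  intro t
  refine continuousAt_of_dominated (bound := fun z => J (t + 1 - z))
    (Eventually.of_forall fun s => (S.J_int s).aestronglyMeasurable) ?_ (S.J_int (t + 1))
    (Eventually.of_forall fun z => ?_)
  · filter_upwards [gt_mem_nhds (show t < t + 1 by linarith)] with s hs
    refine Eventually.of_forall fun z => ?_
    rw [Real.norm_eq_abs, abs_of_nonneg (S.J_nonneg _)]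
    exact S.J_mono (by linarith)
  · exact (S.continuous_J.comp (continuous_id.sub continuous_const)).continuousAt

/-- Integrating the renewal equation over a window of length `h`. -/
theorem integral_window (S : RenewalSetting ν α δ f J G Λ) (t h : ℝ) (hh : 0 ≤ h) :
    ∫ z, (∫ s in (-z)..0, (J (t + s + h) - J (t + s))) ∂ν = ∫ s in t..(t + h), G s := by
  have := S.prob
  have hJ := S.continuous_J
  have hshift : ∀ z, ∫ s in (-z)..0, (J (t + s + h) - J (t + s)) =
      ∫ s in t..(t + h), (J s - J (s - z)) := by
    intro z
    have hi : ∀ a b, IntervalIntegrable J volume a b := fun a b => hJ.intervalIntegrable a b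
    have c1 : Continuous fun s => J (t + s + h) := hJ.comp (by fun_prop)
    have c2 : Continuous fun s => J (t + s) := hJ.comp (by fun_prop)
    have c3 : Continuous fun s => J (s - z) := hJ.comp (by fun_prop)
    rw [intervalIntegral.integral_sub (c1.intervalIntegrable _ _) (c2.intervalIntegrable _ _),
      intervalIntegral.integral_sub (hi _ _) (c3.intervalIntegrable _ _),
      intervalIntegral.integral_comp_sub_right,
      intervalIntegral.integral_comp_add_left]
    have h1 : ∫ s in (-z)..0, J (t + s + h) = ∫ s in (t - z + h)..(t + h), J s := by
      have := intervalIntegral.integral_comp_add_left (a := -z) (b := 0) J (t + h)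
      rw [show t + h + -z = t - z + h by ring, add_zero] at this
      rw [← this]
      congr 1; ext s; congr 1; ring
    rw [h1, ← sub_eq_add_neg, add_zero,
      show t + h - z = t - z + h by ring]
    have e1 := intervalIntegral.integral_add_adjacent_intervals (hi t (t - z))
      (hi (t - z) (t - z + h))
    have e2 := intervalIntegral.integral_add_adjacent_intervals (hi t (t + h))
      (hi (t + h) (t - z + h))
    rw [intervalIntegral.integral_symm (t - z) t] at e1
    rw [intervalIntegral.integral_symm (t - z + h) (t + h)] at e2
    linarith
  simp_rw [hshift]
  have hG : ∀ s, G s = ∫ z, (J s - J (s - z)) ∂ν := by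
    intro s
    rw [integral_sub (integrable_const _) (S.J_int s)]
    simp only [integral_const, probReal_univ, one_smul]
    linarith [S.J_eq s]
  simp_rw [hG, intervalIntegral.integral_of_le (show t ≤ t + h by linarith)]
  refine integral_integral_swap ?_
  have hbound : Integrable (fun p : ℝ × ℝ => J (t + h) + J (t + h - p.1))
      (ν.prod (volume.restrict (Ioc t (t + h)))) :=
    ((integrable_const (J (t + h))).add (S.J_int (t + h))).comp_fst _
  refine hbound.mono' ?_ ?_
  · have : Continuous (Function.uncurry fun z s => J s - J (s - z)) :=
      (hJ.comp continuous_snd).sub (hJ.comp (continuous_snd.sub continuous_fst))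
    exact this.aestronglyMeasurable
  · have h1 : ∀ᵐ p ∂(ν.prod (volume.restrict (Ioc t (t + h)))), p.2 ∈ Ioc t (t + h) := by
      have h2 := (ae_restrict_mem (μ := (volume : Measure ℝ))
        (measurableSet_Ioc (a := t) (b := t + h)))
      exact Measure.quasiMeasurePreserving_snd.ae h2
    filter_upwards [h1] with p hp
    have e1 := S.J_mono hp.2
    have e2 := S.J_mono (show p.2 - p.1 ≤ t + h - p.1 by linarith [hp.2])
    have e3 := S.J_nonneg p.2
    have e4 := S.J_nonneg (p.2 - p.1)
    simp only [Function.uncurry]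
    rw [Real.norm_eq_abs, abs_le]
    constructor <;> linarith

theorem window_le (S : RenewalSetting ν α δ f J G Λ) {h s₁ s₂ : ℝ} (hs : s₁ ≤ s₂) :
    |(J (s₂ + h) - J s₂) - (J (s₁ + h) - J s₁)| ≤
      (Real.exp (α * |s₂ - s₁|) - 1) / α * (f s₁ + f (s₁ + h)) := by
  have h1 := S.J_upper s₁ (s₂ - s₁) (by linarith)
  have h2 := S.J_upper (s₁ + h) (s₂ - s₁) (by linarith)
  rw [show s₁ + h + (s₂ - s₁) = s₂ + h by ring] at h2
  rw [add_sub_cancel] at h1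
  rw [abs_of_nonneg (sub_nonneg.2 hs)]
  have h3 := S.J_mono hs
  have h4 := S.J_mono (show s₁ + h ≤ s₂ + h by linarith)
  have hm := modulus_nonneg S.α_pos (sub_nonneg.2 hs)
  have h5 := mul_nonneg hm (S.f_nonneg s₁)
  have h6 := mul_nonneg hm (S.f_nonneg (s₁ + h))
  rw [mul_add, abs_le]
  constructor <;> linarith

theorem f_le_window (S : RenewalSetting ν α δ f J G Λ) {h : ℝ} (hh : 0 < h) (t : ℝ) :
    f (t + h) ≤ α * Real.exp (α * h) / (Real.exp (α * h) - 1) * (J (t + h) - J t) := by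
  have h1 := S.J_lower t h hh.le
  have hα := S.α_pos
  have h2 : 0 < Real.exp (α * h) - 1 := by
    linarith [Real.one_lt_exp_iff.2 (mul_pos hα hh)]
  have h3 : α * Real.exp (α * h) / (Real.exp (α * h) - 1) *
      ((Real.exp (α * h) - 1) / α * Real.exp (-(α * h)) * f (t + h)) = f (t + h) := by
    rw [Real.exp_neg]
    field_simp
  rw [← h3]
  have := Real.exp_pos (α * h)
  exact mul_le_mul_of_nonneg_left h1 (by positivity)

theorem tendsto_G_div (S : RenewalSetting ν α δ f J G Λ) {t a : ℕ → ℝ}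
    (ht : Tendsto t atTop atTop) (ha : ∀ n, 0 < a n) {q : ℝ}
    (hq : Tendsto (fun n => Λ (t n) / a n) atTop (𝓝 q)) (s : ℝ) :
    Tendsto (fun n => G (t n + s) / a n) atTop (𝓝 q) := by
  have hts : Tendsto (fun n => t n + s) atTop atTop := tendsto_atTop_add_const_right _ _ ht
  have h1 := ((S.G_equiv.comp hts).mul ((S.Λ_slow s).comp ht)).mul hq
  simp only [one_mul] at h1
  refine h1.congr fun n => ?_
  have e1 := (zero_lt_one.trans_le (S.Λ_one (t n))).ne'
  have e2 := (zero_lt_one.trans_le (S.Λ_one (t n + s))).ne'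
  have e3 := (ha n).ne'
  simp only [Function.comp_apply]
  field_simp

theorem integrable_dominating (S : RenewalSetting ν α δ f J G Λ) (M s : ℝ) :
    Integrable (fun z => M * (1 + Real.exp (α * (s - z)))) ν := by
  have := S.prob
  have h1 : (fun z => M * (1 + Real.exp (α * (s - z)))) =
      fun z => M * (1 + Real.exp (α * s) * Real.exp (-(α * z))) := by
    ext z; rw [← Real.exp_add]; ring_nf
  rw [h1]
  exact ((integrable_const 1).add (S.exp_α_int.const_mul _)).const_mul _

/-- The renewal equation for the window increments of `J`, translated and normalized. -/
theorem window_eq (S : RenewalSetting ν α δ f J G Λ) (t s h a : ℝ) :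
    (J (t + s + h) - J (t + s)) / a =
      ∫ z, (J (t + (s - z) + h) - J (t + (s - z))) / a ∂ν + (G (t + s + h) - G (t + s)) / a := by
  have h1 : ∀ z, (J (t + (s - z) + h) - J (t + (s - z))) / a =
      (J (t + s + h - z) - J (t + s - z)) / a := by
    intro z
    rw [show t + (s - z) + h = t + s + h - z by ring, show t + (s - z) = t + s - z by ring]
  simp_rw [h1]
  rw [integral_div, integral_sub (S.J_int _) (S.J_int _), ← add_div, S.J_eq (t + s + h),
    S.J_eq (t + s)]
  congr 1
  ring

/-- Along a sequence at which the windowed function is asymptotically extremal, the renewal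
equation identifies its limit. -/
theorem extremal_limit (S : RenewalSetting ν α δ f J G Λ) {h : ℝ} (hh : 0 < h)
    {t a : ℕ → ℝ} (ht : Tendsto t atTop atTop) (ha : ∀ n, 0 < a n) {q c M σ : ℝ}
    (hq : Tendsto (fun n => Λ (t n) / a n) atTop (𝓝 q)) (hσ : σ = 1 ∨ σ = -1)
    (hM : ∀ n s, (J (t n + s + h) - J (t n + s)) / a n ≤ M * (1 + Real.exp (α * s)))
    (hle : ∀ s, ∀ η > 0, ∀ᶠ n in atTop,
      σ * ((J (t n + s + h) - J (t n + s)) / a n) ≤ σ * c + η)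
    (hc : Tendsto (fun n => (J (t n + h) - J (t n)) / a n) atTop (𝓝 c)) :
    c * ∫ z, z ∂ν = h * q := by
  have := S.prob
  have hα := S.α_pos
  have hJ := S.continuous_J
  set v : ℕ → ℝ → ℝ := fun n s => (J (t n + s + h) - J (t n + s)) / a n with hv
  have hv0 : ∀ n s, 0 ≤ v n s := fun n s =>
    div_nonneg (sub_nonneg.2 (S.J_mono (by linarith))) (ha n).le
  have hvc : ∀ n, Continuous (v n) := fun n =>
    ((hJ.comp (by fun_prop)).sub (hJ.comp (by fun_prop))).div_const _
  have hvM : ∀ n s, |v n s| ≤ M * (1 + Real.exp (α * s)) := fun n s => by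
    rw [abs_of_nonneg (hv0 n s)]; exact hM n s
  have hσabs : |σ| = 1 := by rcases hσ with rfl | rfl <;> simp
  have hσsq : σ * σ = 1 := by rcases hσ with rfl | rfl <;> simp
  have hM0 : 0 ≤ M := by
    have h1 := (hv0 0 0).trans (hM 0 0)
    simp only [mul_zero, Real.exp_zero] at h1
    linarith
  have hGlim := S.tendsto_G_div ht ha hq
  have hwin : Tendsto (fun n => (∫ s in (t n)..(t n + h), G s) / a n) atTop (𝓝 (h * q)) := by
    have h1 : ∀ n, (∫ s in (t n)..(t n + h), G s) / a n = ∫ s in (0:ℝ)..h, G (t n + s) / a n := by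
      intro n
      rw [intervalIntegral.integral_div, intervalIntegral.integral_comp_add_left, add_zero]
    simp_rw [h1]
    have h2 : h * q = ∫ _ in (0:ℝ)..h, q := by simp
    rw [h2]
    obtain ⟨N, hN⟩ := eventually_atTop.1 (S.G_equiv.eventually (Metric.ball_mem_nhds _ zero_lt_one))
    obtain ⟨b, hb⟩ : ∃ b, ∀ᶠ n in atTop, Λ (t n + h) / a n ≤ b := by
      have h1 := ((S.Λ_slow h).comp ht).mul hq
      refine ⟨1 * q + 1, (h1.eventually (gt_mem_nhds (lt_add_one _))).mono fun n hn => ?_⟩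
      have e1 := (zero_lt_one.trans_le (S.Λ_one (t n))).ne'
      have e3 := (ha n).ne'
      refine le_trans (le_of_eq ?_) hn.le
      simp only [Function.comp_apply]
      field_simp
    refine intervalIntegral.tendsto_integral_filter_of_dominated_convergence (fun _ => 2 * b)
      (Eventually.of_forall fun n =>
        ((S.continuous_G.comp (by fun_prop : Continuous fun s => t n + s)).div_const
          (a n)).aestronglyMeasurable) ?_
      intervalIntegrable_const (Eventually.of_forall fun s _ => hGlim s)
    filter_upwards [hb, ht.eventually_ge_atTop N] with n hn htn
    refine Eventually.of_forall fun s hs => ?_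
    rw [uIoc_of_le hh.le] at hs
    have h3 := hN (t n + s) (by linarith [hs.1])
    have hL := zero_lt_one.trans_le (S.Λ_one (t n + s))
    rw [Real.dist_eq] at h3
    have h4 : |G (t n + s) / Λ (t n + s)| ≤ 2 := by
      rw [abs_lt] at h3; rw [abs_le]; constructor <;> linarith
    rw [abs_div, abs_of_pos hL, div_le_iff₀ hL] at h4
    rw [Real.norm_eq_abs, abs_div, abs_of_pos (ha n)]
    rw [div_le_iff₀ (ha n)] at hn ⊢
    have h5 := S.Λ_mono (show t n + s ≤ t n + h by linarith [hs.2])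
    linarith
  have hlim : ∀ s, Tendsto (fun n => σ * v n s) atTop (𝓝 (σ * c)) := by
    refine tendsto_of_asymptotically_harmonic (ν := ν) (v := fun n s => σ * v n s)
      (e := fun n s => σ * ((G (t n + s + h) - G (t n + s)) / a n))
      (D := fun s => M * (1 + Real.exp (α * s)))
      (fun n => (continuous_const.mul (hvc n)).measurable) ?_ ?_ ?_ ?_ ?_ hle ?_ S.dense
    · exact S.integrable_dominating M
    · intro n s
      rw [abs_mul, hσabs, one_mul]
      exact hvM n s
    · intro n s
      rw [integral_const_mul, ← mul_add]
      exact congrArg (σ * ·) (S.window_eq (t n) s h (a n))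
    · intro s
      have h1 := ((hGlim (s + h)).sub (hGlim s)).const_mul σ
      simp only [sub_self, mul_zero] at h1
      refine h1.congr fun n => ?_
      rw [← sub_div, add_assoc]
    · intro s η hη
      set K := α * Real.exp (α * h) / (Real.exp (α * h) - 1) with hK
      have hK0 : 0 ≤ K := by
        have h2 : 0 ≤ Real.exp (α * h) - 1 := by
          linarith [Real.one_le_exp (mul_pos hα hh).le]
        have := Real.exp_pos (α * h)
        positivity
      set E := 2 * K * (M * (1 + Real.exp (α * s))) with hE
      have hbound : ∀ n s₁ s₂, s₁ ≤ s₂ → s₁ ≤ s →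
          |v n s₂ - v n s₁| ≤ (Real.exp (α * |s₂ - s₁|) - 1) / α * E := by
        intro n s₁ s₂ h12 h1s
        have h1 := S.window_le (h := h) (show t n + s₁ ≤ t n + s₂ by linarith)
        have h2 := S.f_le_window hh (t n + s₁)
        have h3 := S.f_le_window hh (t n + s₁ - h)
        rw [sub_add_cancel] at h3
        have h4 : ∀ r ≤ s, J (t n + r + h) - J (t n + r) ≤
            M * (1 + Real.exp (α * s)) * a n := by
          intro r hr
          have := (div_le_iff₀ (ha n)).1 (hM n r)
          refine this.trans ?_
          have := (ha n).le
          gcongr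
        have h5 := h4 s₁ h1s
        have h6 := h4 (s₁ - h) (by linarith)
        rw [show t n + (s₁ - h) + h = t n + s₁ by ring,
          show t n + (s₁ - h) = t n + s₁ - h by ring] at h6
        have h7 : f (t n + s₁) + f (t n + s₁ + h) ≤ E * a n := by
          have e1 := h2.trans (mul_le_mul_of_nonneg_left h5 hK0)
          have e2 := h3.trans (mul_le_mul_of_nonneg_left h6 hK0)
          rw [hE]
          linarith
        have hm := modulus_nonneg hα (abs_nonneg (s₂ - s₁))
        simp only [hv]
        rw [← sub_div, abs_div, abs_of_pos (ha n), div_le_iff₀ (ha n), mul_assoc]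
        rw [add_sub_add_left_eq_sub] at h1
        exact h1.trans (mul_le_mul_of_nonneg_left h7 hm)
      have h1 := (tendsto_modulus α).mul_const E
      rw [zero_mul] at h1
      obtain ⟨r, hr, hr'⟩ := Metric.eventually_nhds_iff.1 (h1.eventually (gt_mem_nhds hη))
      refine ⟨r, hr, fun n s' hs' => ?_⟩
      rw [← mul_sub, abs_mul, hσabs, one_mul]
      have h2 := hr' (y := s' - s) (by simpa using hs')
      rcases le_total s s' with h3 | h3
      · exact (hbound n s s' h3 le_rfl).trans h2.le
      · have h4 := hbound n s' s h3 h3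
        rw [abs_sub_comm, abs_sub_comm s] at h4
        exact h4.trans h2.le
    · simp only [hv, add_zero]
      exact hc.const_mul σ
  have hlim' : ∀ s, Tendsto (fun n => v n s) atTop (𝓝 c) := by
    intro s
    have h1 := (hlim s).const_mul σ
    simpa only [← mul_assoc, hσsq, one_mul] using h1
  have h1 := tendsto_integral_intervalIntegral hα hvc hvM S.mean_int S.exp_α_int hlim'
  refine tendsto_nhds_unique h1 (hwin.congr fun n => ?_)
  rw [← S.integral_window (t n) h hh.le, ← integral_div]
  simp only [hv, intervalIntegral.integral_div]

/-- Points at which the ratio of the windowed function to `Λ` is nearly a weighted record. -/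
theorem exists_records (S : RenewalSetting ν α δ f J G Λ) {h : ℝ} (hh : 0 < h)
    (hunb : ∀ M, ∃ t, M * Λ t < J (t + h) - J t) :
    ∃ t : ℕ → ℝ, Tendsto t atTop atTop ∧ (∀ n, 0 < J (t n + h) - J (t n)) ∧
      Tendsto (fun n => Λ (t n) / (J (t n + h) - J (t n))) atTop (𝓝 0) ∧
      ∀ (n : ℕ) s, (J (t n + s + h) - J (t n + s)) / (J (t n + h) - J (t n)) ≤
        (1 + 1 / ((n : ℝ) + 1)) * (Λ (t n + s) / Λ (t n)) * Real.exp (δ * max s 0) := by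
  have hα := S.α_pos
  have hδ := S.δ_pos
  have hΛ : ∀ t, 0 < Λ t := fun t => zero_lt_one.trans_le (S.Λ_one t)
  set u : ℝ → ℝ := fun t => J (t + h) - J t with hu
  set r : ℝ → ℝ := fun t => u t / Λ t with hr
  have hu0 : ∀ t, 0 ≤ u t := fun t => sub_nonneg.2 (S.J_mono (by linarith))
  have hr0 : ∀ t, 0 ≤ r t := fun t => div_nonneg (hu0 t) (hΛ t).le
  have hru : ∀ M, ∃ t, M < r t := fun M => by
    obtain ⟨t, ht⟩ := hunb M
    exact ⟨t, (lt_div_iff₀ (hΛ t)).2 ht⟩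
  obtain ⟨C, hC0, hC⟩ : ∃ C, 0 ≤ C ∧ ∀ t, r t ≤ C * Real.exp (δ * max t 0) := by
    obtain ⟨C, hC⟩ := S.f_le
    have hC0 : 0 ≤ C := by simpa using (S.f_nonneg 0).trans (hC 0)
    have hm := modulus_nonneg hα hh.le
    refine ⟨(Real.exp (α * h) - 1) / α * C, mul_nonneg hm hC0, fun t => ?_⟩
    have h1 : r t ≤ u t := div_le_self (hu0 t) (S.Λ_one t)
    have h2 := S.J_upper t h hh.le
    have h3 := mul_le_mul_of_nonneg_left (hC t) hm
    rw [mul_assoc]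
    exact h1.trans (h2.trans h3)
  set m : ℕ → ℝ → ℝ := fun n t => Real.exp (-(δ * max (t - n) 0)) with hm
  have hm0 : ∀ n t, 0 < m n t := fun n t => Real.exp_pos _
  have hm1 : ∀ n t, m n t ≤ 1 := fun n t => by
    have : 0 ≤ δ * max (t - n) 0 := mul_nonneg hδ.le (le_max_right _ _)
    exact Real.exp_le_one_iff.2 (by linarith)
  have hms : ∀ n t s, m n t ≤ Real.exp (δ * max s 0) * m n (t + s) := by
    intro n t s
    simp only [hm]
    rw [← Real.exp_add]
    refine Real.exp_le_exp.2 ?_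
    have h1 : max (t + s - n) 0 ≤ max (t - n) 0 + max s 0 :=
      max_le (by linarith [le_max_left (t - n) 0, le_max_left s 0])
        (by linarith [le_max_right (t - n) 0, le_max_right s 0])
    nlinarith
  have hbdd : ∀ n, BddAbove (range fun t => r t * m n t) := by
    intro n
    refine ⟨C * Real.exp (δ * n), ?_⟩
    rintro _ ⟨t, rfl⟩
    have h1 : r t * m n t ≤ C * Real.exp (δ * max t 0) * m n t :=
      mul_le_mul_of_nonneg_right (hC t) (hm0 n t).le
    refine h1.trans ?_
    rw [mul_assoc]
    refine mul_le_mul_of_nonneg_left ?_ hC0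
    simp only [hm]
    rw [← Real.exp_add]
    refine Real.exp_le_exp.2 ?_
    have h2 : max t 0 ≤ n + max (t - n) 0 :=
      max_le (by linarith [le_max_left (t - n) 0])
        (by have : (0:ℝ) ≤ n := n.cast_nonneg
            linarith [le_max_right (t - n) 0])
    nlinarith
  set q : ℕ → ℝ := fun n => ⨆ t, r t * m n t with hq
  have hqpos : ∀ n, 0 < q n := by
    intro n
    obtain ⟨t, ht⟩ := hru 0
    exact (mul_pos ht (hm0 n t)).trans_le (le_ciSup (hbdd n) t)
  have hqlim : ∀ M, ∀ᶠ n in atTop, M < q n := by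
    intro M
    obtain ⟨t, ht⟩ := hru M
    obtain ⟨N, hN⟩ := exists_nat_ge t
    filter_upwards [eventually_ge_atTop N] with n hn
    refine ht.trans_le ?_
    have h1 : m n t = 1 := by
      have : t ≤ n := hN.trans (by exact_mod_cast hn)
      simp only [hm]
      rw [max_eq_right (by linarith)]; simp
    have h2 := le_ciSup (hbdd n) t
    simp only [h1, mul_one] at h2
    exact h2
  have hex : ∀ n : ℕ, ∃ t, q n * (((n:ℝ) + 1) / (n + 2)) < r t * m n t := by
    intro n
    refine exists_lt_of_lt_ciSup ?_
    have hn : (0:ℝ) ≤ n := n.cast_nonneg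
    have h1 : ((n:ℝ) + 1) / (n + 2) < 1 := by rw [div_lt_one (by linarith)]; linarith
    exact mul_lt_of_lt_one_right (hqpos n) h1
  choose t ht using hex
  have hrt : ∀ n, q n / 2 < r (t n) := by
    intro n
    have hn : (0:ℝ) ≤ n := n.cast_nonneg
    have h1 : (1:ℝ) / 2 ≤ ((n:ℝ) + 1) / (n + 2) := by
      rw [div_le_div_iff₀ (by norm_num) (by linarith)]; linarith
    calc q n / 2 = q n * (1 / 2) := by ring
      _ ≤ q n * (((n:ℝ) + 1) / (n + 2)) := mul_le_mul_of_nonneg_left h1 (hqpos n).le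
      _ < r (t n) * m n (t n) := ht n
      _ ≤ r (t n) := mul_le_of_le_one_right (hr0 _) (hm1 _ _)
  have hrlim : Tendsto (fun n => r (t n)) atTop atTop := by
    rw [tendsto_atTop]
    intro M
    filter_upwards [hqlim (2 * M)] with n hn
    linarith [hrt n]
  have hut : ∀ n, 0 < u (t n) := by
    intro n
    have h1 : 0 < r (t n) := (half_pos (hqpos n)).trans (hrt n)
    exact (div_pos_iff_of_pos_right (hΛ _)).1 h1
  refine ⟨t, ?_, hut, ?_, ?_⟩
  · rw [tendsto_atTop]
    intro T
    filter_upwards [hrlim.eventually_gt_atTop (C * Real.exp (δ * max T 0))] with n hn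
    by_contra! hlt
    have h1 := (hC (t n)).trans (mul_le_mul_of_nonneg_left (Real.exp_le_exp.2
      (mul_le_mul_of_nonneg_left (max_le_max_right 0 hlt.le) hδ.le)) hC0)
    linarith
  · refine (tendsto_inv_atTop_zero.comp hrlim).congr fun n => ?_
    simp [hr, hu]
  · intro n s
    have hn : (0:ℝ) ≤ n := n.cast_nonneg
    have h1 : r (t n + s) * m n (t n + s) ≤ q n := le_ciSup (hbdd n) (t n + s)
    have h2 : q n ≤ (1 + 1 / ((n:ℝ) + 1)) * (r (t n) * m n (t n)) := by
      have h3 := mul_le_mul_of_nonneg_left (ht n).le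
        (show (0:ℝ) ≤ 1 + 1 / ((n:ℝ) + 1) by positivity)
      refine le_trans (le_of_eq ?_) h3
      field_simp
      ring
    have h4 : r (t n) * m n (t n) ≤ r (t n) * (Real.exp (δ * max s 0) * m n (t n + s)) :=
      mul_le_mul_of_nonneg_left (hms n (t n) s) (hr0 _)
    have h5 : r (t n + s) ≤ (1 + 1 / ((n:ℝ) + 1)) * r (t n) * Real.exp (δ * max s 0) := by
      refine le_of_mul_le_mul_right ?_ (hm0 n (t n + s))
      refine h1.trans (h2.trans ?_)
      refine (mul_le_mul_of_nonneg_left h4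
        (show (0:ℝ) ≤ 1 + 1 / ((n:ℝ) + 1) by positivity)).trans (le_of_eq (by ring))
    change u (t n + s) / u (t n) ≤ _
    rw [div_le_iff₀ (hut n)]
    have h6 : u (t n + s) = r (t n + s) * Λ (t n + s) := (div_mul_cancel₀ _ (hΛ _).ne').symm
    rw [h6]
    refine (mul_le_mul_of_nonneg_right h5 (hΛ _).le).trans (le_of_eq ?_)
    simp only [hr]
    ring

/-- The a priori bound: the windowed function is at most of the order of `Λ`. -/
theorem window_bounded (S : RenewalSetting ν α δ f J G Λ) {h : ℝ} (hh : 0 < h) :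
    ∃ M, ∀ t, J (t + h) - J t ≤ M * Λ t := by
  by_contra! hunb
  have := S.prob
  have hα := S.α_pos
  have hδ := S.δ_pos
  have hΛ : ∀ t, 0 < Λ t := fun t => zero_lt_one.trans_le (S.Λ_one t)
  obtain ⟨t, ht, hut, hq, hrec⟩ := S.exists_records hh hunb
  set v : ℕ → ℝ → ℝ := fun n s =>
    (J (t n + s + h) - J (t n + s)) / (J (t n + h) - J (t n)) with hv
  have hv0 : ∀ n s, 0 ≤ v n s := fun n s =>
    div_nonneg (sub_nonneg.2 (S.J_mono (by linarith))) (hut n).le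
  have hJ := S.continuous_J
  have hvc : ∀ n, Continuous (v n) := fun n =>
    ((hJ.comp (by fun_prop)).sub (hJ.comp (by fun_prop))).div_const _
  have hvM : ∀ n s, v n s ≤ 2 * (1 + Real.exp (α * s)) := by
    intro n s
    rcases le_total s 0 with hs | hs
    · have h1 := hrec n s
      rw [max_eq_right hs, mul_zero, Real.exp_zero, mul_one] at h1
      have hn : (0:ℝ) ≤ n := n.cast_nonneg
      have h2 : 1 + 1 / ((n:ℝ) + 1) ≤ 2 := by
        have : 1 / ((n:ℝ) + 1) ≤ 1 := by rw [div_le_one (by linarith)]; linarith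
        linarith
      have h3 : Λ (t n + s) / Λ (t n) ≤ 1 :=
        (div_le_one (hΛ _)).2 (S.Λ_mono (by linarith))
      have h4 : (0:ℝ) ≤ Λ (t n + s) / Λ (t n) := (div_pos (hΛ _) (hΛ _)).le
      have := Real.exp_pos (α * s)
      have h5 : (1 + 1 / ((n:ℝ) + 1)) * (Λ (t n + s) / Λ (t n)) ≤ 2 * 1 :=
        mul_le_mul h2 h3 h4 (by norm_num)
      linarith
    · have h1 := S.J_scale (t n) h s hh.le hs
      have h2 : v n s ≤ Real.exp (α * s) := (div_le_iff₀ (hut n)).2 h1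
      have := Real.exp_pos (α * s)
      linarith
  set κ := ∫ z, Real.exp (-(δ * z)) ∂ν with hκ
  have hκ0 : 0 ≤ κ := integral_nonneg fun z => (Real.exp_pos _).le
  have hiter : ∀ (k : ℕ) (s : ℝ), ∀ η > 0, ∀ᶠ n in atTop,
      v n s ≤ (1 + κ ^ k * Real.exp (δ * s)) + η := by
    intro k
    induction k with
    | zero =>
      intro s η hη
      have hlim : Tendsto (fun n : ℕ => (1 + 1 / ((n:ℝ) + 1)) * (Λ (t n + s) / Λ (t n)) *
          Real.exp (δ * max s 0)) atTop (𝓝 ((1 + 0) * 1 * Real.exp (δ * max s 0))) :=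
        ((tendsto_one_div_add_atTop_nhds_zero_nat.const_add 1).mul
          ((S.Λ_slow s).comp ht)).mul_const _
      have hle : (1 + 0) * 1 * Real.exp (δ * max s 0) < 1 + κ ^ 0 * Real.exp (δ * s) + η := by
        have := Real.exp_pos (δ * s)
        rcases le_total s 0 with hs | hs
        · rw [max_eq_right hs, mul_zero, Real.exp_zero, pow_zero]; linarith
        · rw [max_eq_left hs, pow_zero]; linarith
      filter_upwards [hlim.eventually (gt_mem_nhds hle)] with n hn
      exact (hrec n s).trans hn.le
    | succ k ih =>
      intro s η hη
      have hψ : Integrable (fun z => κ ^ k * Real.exp (δ * s) * Real.exp (-(δ * z))) ν :=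
        S.exp_δ_int.const_mul _
      have hexp : ∀ z, κ ^ k * Real.exp (δ * (s - z)) =
          κ ^ k * Real.exp (δ * s) * Real.exp (-(δ * z)) := by
        intro z; rw [mul_assoc, ← Real.exp_add]; ring_nf
      have key := eventually_integral_le_of_dominated (ν := ν) (F := fun n z => v n (s - z))
        (D := fun z => 2 * (1 + Real.exp (α * (s - z))))
        (ψ := fun z => 1 + κ ^ k * Real.exp (δ * s) * Real.exp (-(δ * z)))
        (fun n => ((hvc n).comp (continuous_const.sub continuous_id)).aestronglyMeasurable)
        (S.integrable_dominating 2 s)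
        (fun n z => by rw [abs_of_nonneg (hv0 _ _)]; exact hvM _ _)
        ((integrable_const 1).add hψ)
        (fun z η' hη' => by
          filter_upwards [ih (s - z) η' hη'] with n hn
          rwa [hexp] at hn)
        (half_pos hη)
      have herr := (S.tendsto_G_div ht hut hq (s + h)).sub (S.tendsto_G_div ht hut hq s)
      rw [sub_zero] at herr
      filter_upwards [key, herr.eventually (gt_mem_nhds (half_pos hη))] with n h1 h2
      rw [integral_add (integrable_const 1) hψ, integral_const_mul] at h1
      simp only [integral_const, probReal_univ, one_smul] at h1
      have h3 := S.window_eq (t n) s h (J (t n + h) - J (t n))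
      rw [← sub_div, ← add_assoc] at h2
      rw [pow_succ]
      have h4 : v n s = ∫ z, v n (s - z) ∂ν +
        (G (t n + s + h) - G (t n + s)) / (J (t n + h) - J (t n)) := h3
      rw [h4]
      calc _ ≤ (1 + κ ^ k * Real.exp (δ * s) * κ + η / 2) + η / 2 := add_le_add h1 h2.le
        _ = _ := by ring
  have hle : ∀ s, ∀ η > 0, ∀ᶠ n in atTop, (1:ℝ) * v n s ≤ 1 * 1 + η := by
    intro s η hη
    have hlim : Tendsto (fun k : ℕ => κ ^ k * Real.exp (δ * s)) atTop (𝓝 0) := by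
      simpa using (tendsto_pow_atTop_nhds_zero_of_lt_one hκ0 S.exp_δ_lt).mul_const
        (Real.exp (δ * s))
    obtain ⟨k, hk⟩ := (hlim.eventually (gt_mem_nhds (half_pos hη))).exists
    filter_upwards [hiter k s (η / 2) (half_pos hη)] with n hn
    linarith
  have h1 := S.extremal_limit hh ht hut hq (Or.inl rfl) hvM hle (by
    refine tendsto_const_nhds.congr fun n => ?_
    rw [div_self (hut n).ne'])
  have := S.mean_pos
  linarith

theorem exists_seq_tendsto_sup {g : ℝ → ℝ} {M : ℝ} (hg : ∀ t, |g t| ≤ M) :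
    ∃ (c : ℝ) (t : ℕ → ℝ), Tendsto t atTop atTop ∧ Tendsto (fun n => g (t n)) atTop (𝓝 c) ∧
      ∀ η > 0, ∀ᶠ x in atTop, g x ≤ c + η := by
  have hub : IsBoundedUnder (· ≤ ·) atTop g :=
    isBoundedUnder_of ⟨M, fun t => (abs_le.1 (hg t)).2⟩
  have hlb : IsBoundedUnder (· ≥ ·) atTop g :=
    isBoundedUnder_of ⟨-M, fun t => (abs_le.1 (hg t)).1⟩
  set c := limsup g atTop with hc
  have hup : ∀ η > 0, ∀ᶠ x in atTop, g x < c + η := fun η hη =>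
    eventually_lt_of_limsup_lt (by linarith) hub
  have hfreq : ∀ n : ℕ, ∃ x : ℝ, (n:ℝ) ≤ x ∧ c - 1 / ((n:ℝ) + 1) < g x ∧
      g x < c + 1 / ((n:ℝ) + 1) := by
    intro n
    have hn : 0 < 1 / ((n:ℝ) + 1) := by positivity
    have h1 : ∃ᶠ x in atTop, c - 1 / ((n:ℝ) + 1) < g x :=
      frequently_lt_of_lt_limsup hlb.isCoboundedUnder_le (by linarith)
    obtain ⟨x, hx, hx1, hx2⟩ := (h1.and_eventually
      ((hup _ hn).and (eventually_ge_atTop (n:ℝ)))).exists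
    exact ⟨x, hx2, hx, hx1⟩
  choose t h1 h2 h3 using hfreq
  refine ⟨c, t, tendsto_atTop_mono h1 tendsto_natCast_atTop_atTop, ?_,
    fun η hη => (hup η hη).mono fun x hx => hx.le⟩
  have h0 : Tendsto (fun n : ℕ => 1 / ((n:ℝ) + 1)) atTop (𝓝 0) :=
    tendsto_one_div_add_atTop_nhds_zero_nat
  have hl : Tendsto (fun n : ℕ => c - 1 / ((n:ℝ) + 1)) atTop (𝓝 c) := by
    simpa using h0.const_sub c
  have hr : Tendsto (fun n : ℕ => c + 1 / ((n:ℝ) + 1)) atTop (𝓝 c) := by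
    simpa using h0.const_add c
  exact tendsto_of_tendsto_of_tendsto_of_le_of_le hl hr (fun n => (h2 n).le) (fun n => (h3 n).le)

theorem eventually_window_le (S : RenewalSetting ν α δ f J G Λ) {h : ℝ} (hh : 0 < h) {σ : ℝ}
    (hσ : σ = 1 ∨ σ = -1) {η : ℝ} (hη : 0 < η) :
    ∀ᶠ t in atTop, σ * ((J (t + h) - J t) / Λ t) ≤ σ * (h / ∫ z, z ∂ν) + η := by
  have hα := S.α_pos
  have hΛ : ∀ t, 0 < Λ t := fun t => zero_lt_one.trans_le (S.Λ_one t)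
  obtain ⟨M, hM⟩ := S.window_bounded hh
  have hσabs : |σ| = 1 := by rcases hσ with rfl | rfl <;> simp
  have hσsq : σ * σ = 1 := by rcases hσ with rfl | rfl <;> simp
  have hu0 : ∀ t, 0 ≤ J (t + h) - J t := fun t => sub_nonneg.2 (S.J_mono (by linarith))
  have hrM : ∀ t, (J (t + h) - J t) / Λ t ≤ M := fun t => (div_le_iff₀ (hΛ t)).2 (hM t)
  have hM0 : 0 ≤ M := (div_nonneg (hu0 0) (hΛ 0).le).trans (hrM 0)
  obtain ⟨c, t, ht, hc, hsup⟩ := exists_seq_tendsto_sup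
    (g := fun t => σ * ((J (t + h) - J t) / Λ t)) (M := M) (fun t => by
      rw [abs_mul, hσabs, one_mul, abs_of_nonneg (div_nonneg (hu0 t) (hΛ t).le)]
      exact hrM t)
  have hc' : Tendsto (fun n => (J (t n + h) - J (t n)) / Λ (t n)) atTop (𝓝 (σ * c)) := by
    simpa only [← mul_assoc, hσsq, one_mul] using hc.const_mul σ
  have hlim := S.extremal_limit hh ht (a := fun n => Λ (t n)) (q := 1) (c := σ * c) (M := M)
    (fun n => hΛ _) (by
      refine tendsto_const_nhds.congr fun n => ?_
      rw [div_self (hΛ _).ne']) hσ ?_ ?_ hc'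
  · have h1 : σ * c = h / ∫ z, z ∂ν := by
      rw [eq_div_iff S.mean_pos.ne', hlim, mul_one]
    rw [← h1, ← mul_assoc, hσsq, one_mul]
    exact hsup η hη
  · intro n s
    rw [div_le_iff₀ (hΛ _)]
    have hexp := Real.exp_pos (α * s)
    rcases le_total s 0 with hs | hs
    · have h1 := (hM (t n + s)).trans (mul_le_mul_of_nonneg_left
        (S.Λ_mono (show t n + s ≤ t n by linarith)) hM0)
      have h2 : 0 ≤ M * Real.exp (α * s) * Λ (t n) := by have := hΛ (t n); positivity
      linarith
    · have h1 := S.J_scale (t n) h s hh.le hs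
      have h2 := mul_le_mul_of_nonneg_left (hM (t n)) hexp.le
      have h3 : 0 ≤ M * Λ (t n) := mul_nonneg hM0 (hΛ _).le
      linarith
  · intro s η hη
    rw [← mul_assoc, hσsq, one_mul]
    have hts : Tendsto (fun n => t n + s) atTop atTop := tendsto_atTop_add_const_right _ _ ht
    have hl : Tendsto (fun n => (c + η / 2) * (Λ (t n + s) / Λ (t n))) atTop
        (𝓝 ((c + η / 2) * 1)) := ((S.Λ_slow s).comp ht).const_mul _
    filter_upwards [hts.eventually (hsup (η / 2) (half_pos hη)),
      hl.eventually (gt_mem_nhds (show (c + η / 2) * 1 < c + η by linarith))] with n h1 h2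
    have h3 := mul_le_mul_of_nonneg_right h1 (div_pos (hΛ (t n + s)) (hΛ (t n))).le
    refine le_trans (le_of_eq ?_) (h3.trans h2.le)
    have e1 := (hΛ (t n)).ne'
    have e2 := (hΛ (t n + s)).ne'
    field_simp

theorem tendsto_window (S : RenewalSetting ν α δ f J G Λ) {h : ℝ} (hh : 0 < h) :
    Tendsto (fun t => (J (t + h) - J t) / Λ t) atTop (𝓝 (h / ∫ z, z ∂ν)) := by
  rw [Metric.tendsto_nhds]
  intro η hη
  filter_upwards [S.eventually_window_le hh (Or.inl rfl) (half_pos hη),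
    S.eventually_window_le hh (Or.inr rfl) (half_pos hη)] with t h1 h2
  rw [Real.dist_eq, abs_lt]
  constructor <;> linarith

theorem tendsto_div_exp_sub_one (hα : 0 < α) :
    Tendsto (fun h : ℝ => α * h / (Real.exp (α * h) - 1)) (𝓝[>] 0) (𝓝 1) := by
  have h1 : HasDerivAt (fun h : ℝ => Real.exp (α * h)) α 0 := by
    simpa using ((hasDerivAt_id (0:ℝ)).const_mul α).exp
  have h2 := h1.tendsto_slope.mono_left (nhdsWithin_mono 0 (fun x (hx : 0 < x) => hx.ne'))
  have h3 := (h2.inv₀ hα.ne').const_mul α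
  rw [mul_inv_cancel₀ hα.ne'] at h3
  refine h3.congr' ?_
  filter_upwards [self_mem_nhdsWithin] with h hh
  simp [slope_def_field, mul_div_assoc]

/-- The conclusion of the implicit renewal argument. -/
theorem tendsto_f_div (S : RenewalSetting ν α δ f J G Λ) :
    Tendsto (fun t => f t / Λ t) atTop (𝓝 (1 / ∫ z, z ∂ν)) := by
  have hα := S.α_pos
  have hΛ : ∀ t, 0 < Λ t := fun t => zero_lt_one.trans_le (S.Λ_one t)
  have hmod := tendsto_div_exp_sub_one hα
  have hexp : Tendsto (fun h : ℝ => Real.exp (α * h)) (𝓝[>] 0) (𝓝 1) := by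
    have h1 : Continuous fun h : ℝ => Real.exp (α * h) := by fun_prop
    simpa using (h1.tendsto 0).mono_left nhdsWithin_le_nhds
  rw [Metric.tendsto_nhds]
  intro η hη
  set ρ := ∫ z, z ∂ν with hρ
  have e1 : ∀ᶠ h in 𝓝[>] (0:ℝ), 1 / ρ - η < α * h / (Real.exp (α * h) - 1) * (1 / ρ) := by
    have := hmod.mul_const (1 / ρ)
    rw [one_mul] at this
    exact this.eventually (lt_mem_nhds (by linarith))
  have e2 : ∀ᶠ h in 𝓝[>] (0:ℝ),
      Real.exp (α * h) * (α * h / (Real.exp (α * h) - 1)) * (1 / ρ) < 1 / ρ + η := by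
    have := (hexp.mul hmod).mul_const (1 / ρ)
    rw [one_mul, one_mul] at this
    exact this.eventually (gt_mem_nhds (by linarith))
  obtain ⟨h, h1, h2, hh⟩ := (e1.and (e2.and self_mem_nhdsWithin)).exists
  have hh : 0 < h := hh
  have hk : 0 < Real.exp (α * h) - 1 := by
    linarith [Real.one_lt_exp_iff.2 (mul_pos hα hh)]
  have hw := S.tendsto_window hh
  have hlow := hw.const_mul (α / (Real.exp (α * h) - 1))
  have hsh : Tendsto (fun t : ℝ => t - h) atTop atTop :=
    tendsto_atTop_add_const_right _ (-h) tendsto_id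
  have hup := ((hw.comp hsh).mul ((S.Λ_slow (-h)).comp tendsto_id)).const_mul
    (α * Real.exp (α * h) / (Real.exp (α * h) - 1))
  have l1 : 1 / ρ - η < α / (Real.exp (α * h) - 1) * (h / ρ) :=
    h1.trans_le (le_of_eq (by ring))
  have l2 : α * Real.exp (α * h) / (Real.exp (α * h) - 1) * (h / ρ * 1) < 1 / ρ + η :=
    lt_of_le_of_lt (le_of_eq (by ring)) h2
  filter_upwards [hlow.eventually (lt_mem_nhds l1), hup.eventually (gt_mem_nhds l2)] with t f1 f2
  have g1 : α / (Real.exp (α * h) - 1) * ((J (t + h) - J t) / Λ t) ≤ f t / Λ t := by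
    rw [← mul_div_assoc]
    refine div_le_div_of_nonneg_right ?_ (hΛ t).le
    have := mul_le_mul_of_nonneg_left (S.J_upper t h hh.le) (div_pos hα hk).le
    refine this.trans (le_of_eq ?_)
    field_simp
  have g2 : f t / Λ t ≤ α * Real.exp (α * h) / (Real.exp (α * h) - 1) *
      ((J (t - h + h) - J (t - h)) / Λ (t - h) * (Λ (t + -h) / Λ t)) := by
    have := S.f_le_window hh (t - h)
    rw [← sub_eq_add_neg, div_mul_div_cancel₀ (hΛ _).ne', ← mul_div_assoc]
    rw [sub_add_cancel] at this ⊢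
    exact div_le_div_of_nonneg_right this (hΛ t).le
  simp only [Function.comp_apply, id] at f2
  rw [Real.dist_eq, abs_lt]
  constructor <;> linarith

end RenewalSetting

section Tilt

variable {Ω : Type*} [MeasurableSpace Ω] {μ : Measure Ω} {A : Ω → ℝ} {α β : ℝ}

theorem integral_lt_integral_of_lt_of_ne_one {f g : Ω → ℝ} (hf : Integrable f μ)
    (hg : Integrable g μ) (hle : ∀ ω, f ω ≤ g ω) (hlt : ∀ ω, A ω ≠ 1 → f ω < g ω)
    (hA1 : ¬ ∀ᵐ ω ∂μ, A ω = 1) : ∫ ω, f ω ∂μ < ∫ ω, g ω ∂μ := by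
  refine lt_of_le_of_ne (integral_mono hf hg hle) fun h => hA1 ?_
  have h0 : ∫ ω, (g ω - f ω) ∂μ = 0 := by rw [integral_sub hg hf, h, sub_self]
  rw [integral_eq_zero_iff_of_nonneg (fun ω => sub_nonneg.2 (hle ω)) (hg.sub hf)] at h0
  filter_upwards [h0] with ω hω
  by_contra hne
  have := hlt ω hne
  simp only [Pi.zero_apply] at hω
  linarith

theorem integrable_rpow_of_le [IsProbabilityMeasure μ] (hA : Measurable A) (hA0 : ∀ ω, 0 ≤ A ω)
    (hint : Integrable (fun ω => A ω ^ α) μ) (hβ : 0 ≤ β) (hβα : β ≤ α) :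
    Integrable (fun ω => A ω ^ β) μ := by
  refine Integrable.mono' (hint.add (integrable_const 1)) (by fun_prop) (ae_of_all _ fun ω => ?_)
  rw [Real.norm_of_nonneg (Real.rpow_nonneg (hA0 ω) _)]
  simp only [Pi.add_apply]
  rcases le_total (A ω) 1 with h | h
  · linarith [Real.rpow_le_one (hA0 ω) h hβ, Real.rpow_nonneg (hA0 ω) α]
  · linarith [Real.rpow_le_rpow_of_exponent_le h hβα]

theorem eq_one_of_rpow_eq_one {a c : ℝ} (ha : 0 ≤ a) (hc : c ≠ 0) (h : a ^ c = 1) : a = 1 :=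
  (Real.rpow_left_inj ha zero_le_one hc).1 (by rw [h, Real.one_rpow])

theorem rpow_lt_one_add_mul_rpow_sub_one {a : ℝ} (ha : 0 ≤ a) (ha1 : a ≠ 1) (hβ : 0 < β)
    (hβα : β < α) : a ^ β < 1 + β / α * (a ^ α - 1) := by
  have hα := hβ.trans hβα
  have h1 : a ^ α ≠ 1 := fun h => ha1 (eq_one_of_rpow_eq_one ha hα.ne' h)
  have := rpow_one_add_lt_one_add_mul_self (s := a ^ α - 1) (p := β / α)
    (by linarith [Real.rpow_nonneg ha α]) (sub_ne_zero.2 h1) (by positivity)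
    ((div_lt_one hα).2 hβα)
  rw [add_sub_cancel, ← Real.rpow_mul ha, mul_div_cancel₀ _ hα.ne'] at this
  exact this

theorem integral_rpow_lt_one [IsProbabilityMeasure μ] (hA : Measurable A) (hA0 : ∀ ω, 0 ≤ A ω)
    (hint : Integrable (fun ω => A ω ^ α) μ) (hone : ∫ ω, A ω ^ α ∂μ = 1)
    (hA1 : ¬ ∀ᵐ ω ∂μ, A ω = 1) (hβ : 0 < β) (hβα : β < α) : ∫ ω, A ω ^ β ∂μ < 1 := by
  have hα := hβ.trans hβα
  have hg : Integrable (fun ω => 1 + β / α * (A ω ^ α - 1)) μ :=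
    (integrable_const 1).add ((hint.sub (integrable_const 1)).const_mul _)
  have hlt : ∀ ω, A ω ≠ 1 → A ω ^ β < 1 + β / α * (A ω ^ α - 1) := fun ω h =>
    rpow_lt_one_add_mul_rpow_sub_one (hA0 ω) h hβ hβα
  have := integral_lt_integral_of_lt_of_ne_one (A := A)
    (integrable_rpow_of_le hA hA0 hint hβ.le hβα.le) hg
    (fun ω => by
      by_cases h : A ω = 1
      · simp [h]
      · exact (hlt ω h).le) hlt hA1
  refine this.trans_eq ?_
  have hsub : Integrable (fun ω => A ω ^ α - 1) μ := hint.sub (integrable_const 1)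
  rw [integral_add (integrable_const 1) (hsub.const_mul _),
    integral_const_mul, integral_sub hint (integrable_const 1), hone]
  simp

theorem rpow_sub_one_div_lt_rpow_mul_log {a : ℝ} (ha : 0 ≤ a) (ha1 : a ≠ 1) (hα : 0 < α) :
    (a ^ α - 1) / α < a ^ α * Real.log a := by
  rcases ha.eq_or_lt with rfl | hpos
  · simp [Real.zero_rpow hα.ne', div_neg_iff, hα]
  have h1 : a ^ (-α) ≠ 1 := fun h => ha1 (eq_one_of_rpow_eq_one ha (neg_ne_zero.2 hα.ne') h)
  have hu := Real.rpow_pos_of_pos hpos α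
  have := Real.log_lt_sub_one_of_pos (Real.rpow_pos_of_pos hpos (-α)) h1
  rw [Real.log_rpow hpos, Real.rpow_neg ha] at this
  rw [div_lt_iff₀ hα]
  have h3 := mul_lt_mul_of_pos_left this hu
  have h4 : a ^ α * ((a ^ α)⁻¹ - 1) = 1 - a ^ α := by field_simp
  rw [h4] at h3
  nlinarith

theorem integral_rpow_mul_log_pos [IsProbabilityMeasure μ] (hA0 : ∀ ω, 0 ≤ A ω) (hα : 0 < α)
    (hint : Integrable (fun ω => A ω ^ α) μ) (hone : ∫ ω, A ω ^ α ∂μ = 1)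
    (hlog : Integrable (fun ω => A ω ^ α * Real.log (A ω)) μ)
    (hA1 : ¬ ∀ᵐ ω ∂μ, A ω = 1) : 0 < ∫ ω, A ω ^ α * Real.log (A ω) ∂μ := by
  have hlt : ∀ ω, A ω ≠ 1 → (A ω ^ α - 1) / α < A ω ^ α * Real.log (A ω) := fun ω h =>
    rpow_sub_one_div_lt_rpow_mul_log (hA0 ω) h hα
  have := integral_lt_integral_of_lt_of_ne_one (A := A)
    ((hint.sub (integrable_const 1)).div_const α) hlog
    (fun ω => by
      by_cases h : A ω = 1
      · simp [h]
      · exact (hlt ω h).le) hlt hA1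
  refine lt_of_eq_of_lt ?_ this
  simp only [Pi.sub_apply]
  rw [integral_div, integral_sub hint (integrable_const 1), hone]
  simp

/-- The law of `log A` under the probability with density `A ^ α`. -/
def tiltedLogLaw (μ : Measure Ω) (A : Ω → ℝ) (α : ℝ) : Measure ℝ :=
  (μ.withDensity fun ω => ENNReal.ofReal (A ω ^ α)).map fun ω => Real.log (A ω)

theorem integral_tiltedLogLaw (hA : Measurable A) (hA0 : ∀ ω, 0 ≤ A ω) {g : ℝ → ℝ}
    (hg : Measurable g) :
    ∫ z, g z ∂(tiltedLogLaw μ A α) = ∫ ω, A ω ^ α * g (Real.log (A ω)) ∂μ := by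
  rw [tiltedLogLaw, integral_map (by fun_prop) hg.aestronglyMeasurable,
    integral_withDensity_eq_integral_toReal_smul (by fun_prop) (by simp)]
  simp [ENNReal.toReal_ofReal (Real.rpow_nonneg (hA0 _) _)]

theorem integrable_tiltedLogLaw (hA : Measurable A) (hA0 : ∀ ω, 0 ≤ A ω) {g : ℝ → ℝ}
    (hg : Measurable g) :
    Integrable g (tiltedLogLaw μ A α) ↔ Integrable (fun ω => A ω ^ α * g (Real.log (A ω))) μ := by
  rw [tiltedLogLaw, integrable_map_measure hg.aestronglyMeasurable (by fun_prop),
    integrable_withDensity_iff_integrable_smul' (by fun_prop) (by simp)]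
  simp [ENNReal.toReal_ofReal (Real.rpow_nonneg (hA0 _) _)]

theorem isProbabilityMeasure_tiltedLogLaw (hA : Measurable A) (hA0 : ∀ ω, 0 ≤ A ω)
    (hint : Integrable (fun ω => A ω ^ α) μ) (hone : ∫ ω, A ω ^ α ∂μ = 1) :
    IsProbabilityMeasure (tiltedLogLaw μ A α) := by
  constructor
  rw [tiltedLogLaw, Measure.map_apply (by fun_prop) MeasurableSet.univ, preimage_univ,
    withDensity_apply _ MeasurableSet.univ, Measure.restrict_univ,
    ← ofReal_integral_eq_lintegral_ofReal hint (ae_of_all _ fun ω => Real.rpow_nonneg (hA0 ω) _),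
    hone, ENNReal.ofReal_one]

theorem ae_of_ae_tiltedLogLaw (hA : Measurable A) {p : ℝ → Prop}
    (h : ∀ᵐ z ∂(tiltedLogLaw μ A α), p z) : ∀ᵐ ω ∂μ, 0 < A ω → p (Real.log (A ω)) := by
  rw [tiltedLogLaw] at h
  have h1 := ae_of_ae_map (by fun_prop) h
  rw [ae_withDensity_iff (by fun_prop)] at h1
  filter_upwards [h1] with ω hω hpos
  refine hω ?_
  simpa using Real.rpow_pos_of_pos hpos α

theorem exp_neg_mul_log_mul_rpow {a c : ℝ} (ha : 0 ≤ a) (hα : 0 < α) (hc : c < α) :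
    a ^ α * Real.exp (-(c * Real.log a)) = a ^ (α - c) := by
  rcases ha.eq_or_lt with rfl | h
  · rw [Real.zero_rpow hα.ne', Real.zero_rpow (by linarith), zero_mul]
  · rw [Real.rpow_sub h, div_eq_mul_inv, ← Real.rpow_neg ha, Real.rpow_def_of_pos h (-c)]
    congr 2; ring

theorem tiltedLogLaw_dense [IsProbabilityMeasure μ] (hA : Measurable A) (hA0 : ∀ ω, 0 ≤ A ω)
    (hα : 0 < α) (hint : Integrable (fun ω => A ω ^ α) μ) (hone : ∫ ω, A ω ^ α ∂μ = 1)
    (hlogneg : ∫ ω, Real.log (A ω) ∂μ < 0)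
    (hna : ¬ ∃ d : ℝ, ∀ᵐ ω ∂μ, 0 < A ω → ∃ k : ℤ, Real.log (A ω) = d * k)
    (hA1 : ¬ ∀ᵐ ω ∂μ, A ω = 1) (S : Set ℝ) (hS : IsClosed S) (h0 : 0 ∈ S)
    (hsub : ∀ s ∈ S, ∀ z ∈ (tiltedLogLaw μ A α).support, s - z ∈ S) : S = univ := by
  have hsupp := ae_of_ae_tiltedLogLaw (μ := μ) (α := α) hA
    (p := fun z => z ∈ (tiltedLogLaw μ A α).support) Measure.support_mem_ae
  refine eq_univ_of_isClosed_of_sub_mem hS h0 hsub ?_ ?_ ?_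
  · by_contra! hcon
    have hle : ∀ᵐ ω ∂μ, A ω ≤ 1 := by
      filter_upwards [hsupp] with ω hω
      rcases (hA0 ω).eq_or_lt with h | h
      · rw [← h]; exact zero_le_one
      · exact (Real.log_nonpos_iff (hA0 ω)).1 (hcon _ (hω h))
    refine hA1 ?_
    have h2 : ∫ ω, (1 - A ω ^ α) ∂μ = 0 := by
      rw [integral_sub (integrable_const 1) hint, hone]; simp
    have hsub : Integrable (fun ω => 1 - A ω ^ α) μ := (integrable_const 1).sub hint
    rw [integral_eq_zero_iff_of_nonneg_ae ?_ hsub] at h2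
    · filter_upwards [h2] with ω hω
      simp only [Pi.zero_apply] at hω
      exact eq_one_of_rpow_eq_one (hA0 ω) hα.ne' (by linarith)
    · filter_upwards [hle] with ω hω
      simpa using Real.rpow_le_one (hA0 ω) hω hα.le
  · by_contra! hcon
    refine hlogneg.not_ge (integral_nonneg_of_ae ?_)
    filter_upwards [hsupp] with ω hω
    rcases (hA0 ω).eq_or_lt with h | h
    · simp [← h]
    · exact hcon _ (hω h)
  · rintro ⟨d, hd⟩
    refine hna ⟨d, ?_⟩
    filter_upwards [hsupp] with ω hω hpos
    exact hd _ (hω hpos)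

end Tilt

/-- The power `u₊ ^ α` truncated at level `x`. -/
def truncPow (α x u : ℝ) : ℝ := min (max u 0) x ^ α

section TruncPow

variable {α x y u v c : ℝ}

theorem truncPow_nonneg (hx : 0 ≤ x) : 0 ≤ truncPow α x u :=
  Real.rpow_nonneg (le_min (le_max_right _ _) hx) _

theorem truncPow_mono (hα : 0 ≤ α) (hx : 0 ≤ x) (hxy : x ≤ y) (huv : u ≤ v) :
    truncPow α x u ≤ truncPow α y v :=
  Real.rpow_le_rpow (le_min (le_max_right _ _) hx) (min_le_min (max_le_max_right _ huv) hxy) hα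

theorem truncPow_le (hα : 0 ≤ α) (hx : 0 ≤ x) : truncPow α x u ≤ x ^ α :=
  Real.rpow_le_rpow (le_min (le_max_right _ _) hx) (min_le_right _ _) hα

theorem truncPow_le_rpow (hα : 0 ≤ α) (hx : 0 ≤ x) : truncPow α x u ≤ max u 0 ^ α :=
  Real.rpow_le_rpow (le_min (le_max_right _ _) hx) (min_le_left _ _) hα

theorem truncPow_of_nonpos (hα : 0 < α) (hx : 0 ≤ x) (hu : u ≤ 0) : truncPow α x u = 0 := by
  rw [truncPow, max_eq_right hu, min_eq_left hx, Real.zero_rpow hα.ne']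

theorem truncPow_of_le (hu : 0 ≤ u) (hux : u ≤ x) : truncPow α x u = u ^ α := by
  rw [truncPow, max_eq_left hu, min_eq_left hux]

theorem truncPow_of_ge (hx : 0 ≤ x) (hxu : x ≤ u) : truncPow α x u = x ^ α := by
  rw [truncPow, max_eq_left (hx.trans hxu), min_eq_right hxu]

@[fun_prop]
theorem measurable_truncPow : Measurable (truncPow α x) := by
  unfold truncPow; fun_prop

theorem truncPow_mul (hc : 0 ≤ c) (hx : 0 ≤ x) :
    truncPow α (c * x) (c * u) = c ^ α * truncPow α x u := by
  rw [truncPow, truncPow, ← Real.mul_rpow hc (le_min (le_max_right _ _) hx),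
    mul_min_of_nonneg _ _ hc, mul_max_of_nonneg _ _ hc, mul_zero]

theorem truncPow_sub_le (hα : 0 < α) (hx : 0 ≤ x) (hxy : x ≤ y) :
    truncPow α y u - truncPow α x u ≤ (y ^ α - x ^ α) * (Ioi x).indicator 1 u := by
  by_cases hu : x < u
  · rw [indicator_of_mem (mem_Ioi.2 hu), truncPow_of_ge hx hu.le, Pi.one_apply, mul_one]
    linarith [truncPow_le (u := u) hα.le (hx.trans hxy)]
  · rw [indicator_of_notMem (by simpa using hu), mul_zero]
    push Not at hu
    rcases le_total u 0 with h | h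
    · rw [truncPow_of_nonpos hα hx h, truncPow_of_nonpos hα (hx.trans hxy) h, sub_zero]
    · rw [truncPow_of_le h hu, truncPow_of_le h (hu.trans hxy), sub_self]

theorem le_truncPow_sub (hα : 0 < α) (hx : 0 ≤ x) (hxy : x ≤ y) :
    (y ^ α - x ^ α) * (Ioi y).indicator 1 u ≤ truncPow α y u - truncPow α x u := by
  by_cases hu : y < u
  · rw [indicator_of_mem (mem_Ioi.2 hu), truncPow_of_ge (hx.trans hxy) hu.le,
      truncPow_of_ge hx (hxy.trans hu.le), Pi.one_apply, mul_one]
  · rw [indicator_of_notMem (by simpa using hu), mul_zero]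
    exact sub_nonneg.2 (truncPow_mono hα.le hx hxy le_rfl)

theorem truncPow_sub_mono (hα : 0 < α) (hx : 0 ≤ x) (hxy : x ≤ y) (huv : u ≤ v) :
    truncPow α y u - truncPow α x u ≤ truncPow α y v - truncPow α x v := by
  rcases le_total u x with hu | hu
  · have h1 := truncPow_sub_le (u := u) hα hx hxy
    rw [indicator_of_notMem (by simpa using hu), mul_zero] at h1
    exact h1.trans (sub_nonneg.2 (truncPow_mono hα.le hx hxy le_rfl))
  · rw [truncPow_of_ge hx hu, truncPow_of_ge hx (hu.trans huv)]
    exact sub_le_sub_right (truncPow_mono hα.le (hx.trans hxy) le_rfl huv) _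

theorem truncPow_sub_scale (hα : 0 < α) (hx : 0 ≤ x) (hxy : x ≤ y) (hc : 1 ≤ c) :
    truncPow α (c * y) u - truncPow α (c * x) u ≤
      c ^ α * (truncPow α y u - truncPow α x u) := by
  have hc0 : 0 ≤ c := zero_le_one.trans hc
  rw [mul_sub, ← truncPow_mul hc0 hx, ← truncPow_mul hc0 (hx.trans hxy)]
  rcases le_total u 0 with h | h
  · rw [truncPow_of_nonpos hα (mul_nonneg hc0 (hx.trans hxy)) h,
      truncPow_of_nonpos hα (mul_nonneg hc0 hx) h,
      truncPow_of_nonpos hα (mul_nonneg hc0 (hx.trans hxy)) (mul_nonpos_of_nonneg_of_nonpos hc0 h),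
      truncPow_of_nonpos hα (mul_nonneg hc0 hx) (mul_nonpos_of_nonneg_of_nonpos hc0 h)]
  · exact truncPow_sub_mono hα (mul_nonneg hc0 hx) (mul_le_mul_of_nonneg_left hxy hc0)
      (le_mul_of_one_le_left h hc)

end TruncPow

section TruncMoment

variable {Ω : Type*} [MeasurableSpace Ω] {μ : Measure Ω} {X : Ω → ℝ}
  {α x y c : ℝ}

/-- The truncated moment `E[min (X₊, x) ^ α]`. -/
def truncMoment (μ : Measure Ω) (X : Ω → ℝ) (α x : ℝ) : ℝ :=
  ∫ ω, truncPow α x (X ω) ∂μ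

theorem truncMoment_nonneg (hx : 0 ≤ x) : 0 ≤ truncMoment μ X α x :=
  integral_nonneg fun _ => truncPow_nonneg hx

theorem integral_const_mul_indicator_Ioi (hX : Measurable X) (a : ℝ) :
    ∫ ω, a * (Ioi x).indicator (1 : ℝ → ℝ) (X ω) ∂μ = a * (μ {ω | x < X ω}).toReal := by
  have hm : MeasurableSet {ω | x < X ω} := measurableSet_lt measurable_const hX
  rw [integral_const_mul, ← Measure.real_def, ← integral_indicator_one hm]
  rfl

variable [IsProbabilityMeasure μ]

theorem integrable_truncPow (hX : Measurable X) (hα : 0 ≤ α) (hx : 0 ≤ x) :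
    Integrable (fun ω => truncPow α x (X ω)) μ := by
  refine Integrable.mono' (integrable_const (x ^ α))
    (measurable_truncPow.comp hX).aestronglyMeasurable (ae_of_all _ fun ω => ?_)
  rw [Real.norm_of_nonneg (truncPow_nonneg hx)]
  exact truncPow_le hα hx

theorem truncMoment_mono (hX : Measurable X) (hα : 0 ≤ α) (hx : 0 ≤ x) (hxy : x ≤ y) :
    truncMoment μ X α x ≤ truncMoment μ X α y :=
  integral_mono (integrable_truncPow hX hα hx) (integrable_truncPow hX hα (hx.trans hxy))
    fun _ => truncPow_mono hα hx hxy le_rfl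

theorem truncMoment_le (hX : Measurable X) (hα : 0 ≤ α) (hx : 0 ≤ x) :
    truncMoment μ X α x ≤ x ^ α := by
  refine (integral_mono (integrable_truncPow hX hα hx) (integrable_const (x ^ α))
    fun _ => truncPow_le hα hx).trans_eq (by simp)

theorem integrable_const_mul_indicator_Ioi (hX : Measurable X) (a : ℝ) :
    Integrable (fun ω => a * (Ioi x).indicator (1 : ℝ → ℝ) (X ω)) μ := by
  have hm : MeasurableSet {ω | x < X ω} := measurableSet_lt measurable_const hX
  exact ((integrable_const (1 : ℝ)).indicator hm).const_mul a

theorem truncMoment_sub_le (hX : Measurable X) (hα : 0 < α) (hx : 0 ≤ x) (hxy : x ≤ y) :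
    truncMoment μ X α y - truncMoment μ X α x ≤ (y ^ α - x ^ α) * (μ {ω | x < X ω}).toReal := by
  have hi := integrable_truncPow (μ := μ) hX hα.le hx
  have hi' := integrable_truncPow (μ := μ) hX hα.le (hx.trans hxy)
  rw [truncMoment, truncMoment, ← integral_sub hi' hi, ← integral_const_mul_indicator_Ioi hX]
  exact integral_mono (hi'.sub hi) (integrable_const_mul_indicator_Ioi hX _)
    fun ω => truncPow_sub_le hα hx hxy

theorem le_truncMoment_sub (hX : Measurable X) (hα : 0 < α) (hx : 0 ≤ x) (hxy : x ≤ y) :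
    (y ^ α - x ^ α) * (μ {ω | y < X ω}).toReal ≤ truncMoment μ X α y - truncMoment μ X α x := by
  have hi := integrable_truncPow (μ := μ) hX hα.le hx
  have hi' := integrable_truncPow (μ := μ) hX hα.le (hx.trans hxy)
  rw [truncMoment, truncMoment, ← integral_sub hi' hi, ← integral_const_mul_indicator_Ioi hX]
  exact integral_mono (integrable_const_mul_indicator_Ioi hX _) (hi'.sub hi)
    fun ω => le_truncPow_sub hα hx hxy

theorem truncMoment_sub_scale (hX : Measurable X) (hα : 0 < α) (hx : 0 ≤ x) (hxy : x ≤ y)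
    (hc : 1 ≤ c) : truncMoment μ X α (c * y) - truncMoment μ X α (c * x) ≤
      c ^ α * (truncMoment μ X α y - truncMoment μ X α x) := by
  have hc0 : 0 ≤ c := zero_le_one.trans hc
  have hi := integrable_truncPow (μ := μ) hX hα.le hx
  have hi' := integrable_truncPow (μ := μ) hX hα.le (hx.trans hxy)
  have hj := integrable_truncPow (μ := μ) hX hα.le (mul_nonneg hc0 hx)
  have hj' := integrable_truncPow (μ := μ) hX hα.le (mul_nonneg hc0 (hx.trans hxy))
  unfold truncMoment
  rw [← integral_sub hi' hi, ← integral_sub hj' hj, ← integral_const_mul]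
  exact integral_mono (hj'.sub hj) ((hi'.sub hi).const_mul _)
    fun ω => truncPow_sub_scale hα hx hxy hc

/-- Boundedness of the truncated moments along a sequence of levels tending to infinity gives
integrability of the untruncated power. -/
theorem integrable_rpow_of_truncMoment_le (hX : Measurable X) (hα : 0 ≤ α) {a : ℕ → ℝ} {M : ℝ}
    (ha0 : ∀ n, 0 ≤ a n) (ha : Tendsto a atTop atTop) (hM : ∀ n, truncMoment μ X α (a n) ≤ M) :
    Integrable (fun ω => max (X ω) 0 ^ α) μ := by
  refine ⟨by fun_prop, ?_⟩
  rw [hasFiniteIntegral_iff_ofReal (ae_of_all _ fun ω => Real.rpow_nonneg (le_max_right _ _) _)]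
  have hlim : ∀ ω, ENNReal.ofReal (max (X ω) 0 ^ α) =
      liminf (fun n => ENNReal.ofReal (truncPow α (a n) (X ω))) atTop := by
    intro ω
    refine (Tendsto.liminf_eq (tendsto_const_nhds.congr' ?_)).symm
    filter_upwards [ha.eventually_ge_atTop (max (X ω) 0)] with n hn
    rw [truncPow, min_eq_left hn]
  simp_rw [hlim]
  refine (lintegral_liminf_le fun n => by fun_prop).trans_lt
    (lt_of_le_of_lt (b := ENNReal.ofReal M) ?_ ENNReal.ofReal_lt_top)
  refine liminf_le_of_le (by isBoundedDefault) fun b hb => ?_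
  obtain ⟨n, hn⟩ := hb.exists
  refine hn.trans ?_
  rw [← ofReal_integral_eq_lintegral_ofReal (integrable_truncPow hX hα (ha0 n))
    (ae_of_all _ fun ω => truncPow_nonneg (ha0 n))]
  exact ENNReal.ofReal_le_ofReal (hM n)

theorem integral_Ioc_eq_truncMoment (hX : Measurable X) (hα : 0 < α) (hx : 0 ≤ x) :
    ∫ t in Ioc 0 x, t ^ α * (μ {ω | t < X ω}).toReal / t = truncMoment μ X α x / α := by
  have hlc := lintegral_rpow_eq_lintegral_meas_lt_mul μ (f := fun ω => min (max (X ω) 0) x)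
    (ae_of_all _ fun ω => le_min (le_max_right _ _) hx) (by fun_prop) hα
  have hmeas : Measurable fun t : ℝ => (μ {ω | t < X ω}).toReal := by
    refine Antitone.measurable fun s t hst => ?_
    exact ENNReal.toReal_mono (measure_ne_top _ _) (measure_mono fun ω hω => lt_of_le_of_lt hst hω)
  have hset : ∫⁻ t in Ioi 0, μ {ω | t < min (max (X ω) 0) x} * ENNReal.ofReal (t ^ (α - 1)) =
      ∫⁻ t in Ioc 0 x, ENNReal.ofReal (t ^ α * (μ {ω | t < X ω}).toReal / t) := by
    rw [← Ioc_union_Ioi_eq_Ioi hx, lintegral_union measurableSet_Ioi Ioc_disjoint_Ioi_same]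
    have h2 : ∫⁻ t in Ioi x, μ {ω | t < min (max (X ω) 0) x} * ENNReal.ofReal (t ^ (α - 1)) =
        0 := by
      refine setLIntegral_eq_zero measurableSet_Ioi fun t ht => ?_
      have : {ω | t < min (max (X ω) 0) x} = ∅ := by
        ext ω
        simp only [mem_ofPred_eq, mem_empty_iff_false, iff_false, not_lt]
        exact (min_le_right _ _).trans (le_of_lt ht)
      simp only [this, measure_empty, zero_mul, Pi.zero_apply]
    rw [h2, add_zero, setLIntegral_congr Ioo_ae_eq_Ioc.symm, setLIntegral_congr Ioo_ae_eq_Ioc.symm]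
    refine setLIntegral_congr_fun measurableSet_Ioo fun t ht => ?_
    have : {ω | t < min (max (X ω) 0) x} = {ω | t < X ω} := by
      ext ω
      simp [ht.1.not_gt, ht.2]
    rw [this, mul_div_right_comm, ← Real.rpow_sub_one ht.1.ne',
      ENNReal.ofReal_mul (Real.rpow_nonneg ht.1.le _), mul_comm,
      ENNReal.ofReal_toReal (measure_ne_top _ _)]
  rw [integral_eq_lintegral_of_nonneg_ae, ← hset]
  · rw [truncMoment, integral_eq_lintegral_of_nonneg_ae (ae_of_all _ fun ω => truncPow_nonneg hx)
      (measurable_truncPow.comp hX).aestronglyMeasurable]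
    unfold truncPow
    rw [hlc, ENNReal.toReal_mul, ENNReal.toReal_ofReal hα.le]
    field_simp
  · filter_upwards [ae_restrict_mem measurableSet_Ioc] with t ht
    have := ht.1
    simp only [Pi.zero_apply]
    positivity
  · exact (((measurable_id.pow_const α).mul hmeas).div measurable_id).aestronglyMeasurable

end TruncMoment

section RegularlyVaryingTail

variable {Ω : Type*} [MeasurableSpace Ω] {μ : Measure Ω} {X : Ω → ℝ}
  {α β x : ℝ}

/-- The normalized tail `x ^ α * P(X > x)`. -/
def normalizedTail (μ : Measure Ω) (X : Ω → ℝ) (α x : ℝ) : ℝ :=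
  x ^ α * (μ {ω | x < X ω}).toReal

theorem normalizedTail_nonneg (hx : 0 ≤ x) : 0 ≤ normalizedTail μ X α x :=
  mul_nonneg (Real.rpow_nonneg hx _) ENNReal.toReal_nonneg

variable [IsProbabilityMeasure μ]

theorem tendsto_truncMoment_atTop (hX : Measurable X) (hα : 0 ≤ α)
    (hinf : ¬ Integrable (fun ω => max (X ω) 0 ^ α) μ) :
    Tendsto (truncMoment μ X α) atTop atTop := by
  rw [tendsto_atTop]
  intro b
  by_contra hcon
  refine hinf (integrable_rpow_of_truncMoment_le hX hα (a := fun n : ℕ => (n : ℝ)) (M := b)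
    (fun n => n.cast_nonneg) tendsto_natCast_atTop_atTop fun n => ?_)
  by_contra! h
  refine hcon ?_
  filter_upwards [eventually_ge_atTop (n : ℝ)] with x hx
  exact h.le.trans (truncMoment_mono hX hα n.cast_nonneg hx)

theorem sum_normalizedTail_le (hX : Measurable X) (hα : 0 < α) (hx : 0 < x) (n : ℕ) :
    (1 - Real.exp (-α)) * ∑ j ∈ Finset.range n, normalizedTail μ X α (Real.exp (-j) * x) ≤
      truncMoment μ X α x - truncMoment μ X α (Real.exp (-n) * x) := by
  induction n with
  | zero => simp
  | succ n ih =>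
    rw [Finset.sum_range_succ, mul_add]
    have hle : Real.exp (-(n + 1 : ℕ)) * x ≤ Real.exp (-n) * x := by
      gcongr; linarith [(Nat.cast_le (α := ℝ)).2 n.le_succ]
    have h := le_truncMoment_sub (μ := μ) hX hα (by positivity) hle
    have he : (Real.exp (-(n + 1 : ℕ)) * x) ^ α = Real.exp (-α) * (Real.exp (-n) * x) ^ α := by
      rw [Real.mul_rpow (by positivity) hx.le, Real.mul_rpow (by positivity) hx.le,
        ← Real.exp_mul, ← Real.exp_mul, ← mul_assoc, ← Real.exp_add]
      congr 2
      push_cast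
      ring
    rw [he] at h
    have : (1 - Real.exp (-α)) * normalizedTail μ X α (Real.exp (-n) * x) =
        ((Real.exp (-n) * x) ^ α - Real.exp (-α) * (Real.exp (-n) * x) ^ α) *
          (μ {ω | Real.exp (-n) * x < X ω}).toReal := by
      rw [normalizedTail]; ring
    linarith

theorem tendsto_normalizedTail_div_truncMoment (hX : Measurable X) (hα : 0 < α)
    (hpos : ∀ x > 0, 0 < normalizedTail μ X α x)
    (hslow : ∀ l : ℝ, 0 < l →
      Tendsto (fun x => normalizedTail μ X α (l * x) / normalizedTail μ X α x) atTop (𝓝 1)) :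
    Tendsto (fun x => normalizedTail μ X α x / truncMoment μ X α x) atTop (𝓝 0) := by
  have hc : 0 < 1 - Real.exp (-α) := by
    have := Real.exp_lt_one_iff.2 (neg_lt_zero.2 hα)
    linarith
  set c := 1 - Real.exp (-α)
  rw [Metric.tendsto_atTop']
  intro η hη
  obtain ⟨n, hn⟩ := exists_nat_gt (2 / (c * η))
  have hn0 : 0 < (n : ℝ) := lt_trans (by positivity) hn
  have hlim : Tendsto (fun x => ∑ j ∈ Finset.range n,
      normalizedTail μ X α (Real.exp (-j) * x) / normalizedTail μ X α x) atTop (𝓝 n) := by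
    have := tendsto_finsetSum (Finset.range n) fun (j : ℕ) _ =>
      hslow (Real.exp (-j)) (Real.exp_pos _)
    simpa using this
  have hev := hlim.eventually (lt_mem_nhds (show (n : ℝ) / 2 < n by linarith))
  obtain ⟨x₀, hx₀⟩ := eventually_atTop.1 (hev.and (eventually_gt_atTop 0))
  refine ⟨x₀, fun x hx => ?_⟩
  obtain ⟨h1, hx0⟩ := hx₀ x hx.le
  have hL := hpos x hx0
  rw [← Finset.sum_div, lt_div_iff₀ hL] at h1
  have h2 := sum_normalizedTail_le (μ := μ) hX hα hx0 n
  have h3 := truncMoment_nonneg (μ := μ) (X := X) (α := α) (x := Real.exp (-n) * x) (by positivity)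
  have h4 : c * (n / 2 * normalizedTail μ X α x) < truncMoment μ X α x := by
    have := mul_lt_mul_of_pos_left h1 hc
    linarith
  have hV : 0 < truncMoment μ X α x := lt_trans (by positivity) h4
  rw [Real.dist_eq, sub_zero, abs_of_pos (by positivity), div_lt_iff₀ hV]
  have h5 : 2 < n * (c * η) := by rwa [div_lt_iff₀ (by positivity)] at hn
  have h6 := mul_lt_mul_of_pos_left h4 hη
  nlinarith

/-- The truncated moment, in logarithmic scale and shifted by one, is slowly varying. -/
theorem tendsto_one_add_truncMoment_div (hX : Measurable X) (hα : 0 < α)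
    (hpos : ∀ x > 0, 0 < normalizedTail μ X α x)
    (hslow : ∀ l : ℝ, 0 < l →
      Tendsto (fun x => normalizedTail μ X α (l * x) / normalizedTail μ X α x) atTop (𝓝 1))
    (s : ℝ) :
    Tendsto (fun t => (1 + truncMoment μ X α (Real.exp (t + s)) / α) /
      (1 + truncMoment μ X α (Real.exp t) / α)) atTop (𝓝 1) := by
  have hone : ∀ t, 0 < 1 + truncMoment μ X α (Real.exp t) / α := fun t =>
    add_pos_of_pos_of_nonneg one_pos
      (div_nonneg (truncMoment_nonneg (Real.exp_pos t).le) hα.le)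
  have hVpos : ∀ x > 0, 0 < truncMoment μ X α x := by
    intro x hx
    have h := sum_normalizedTail_le (μ := μ) hX hα hx 1
    have hc : 0 < 1 - Real.exp (-α) := by
      have := Real.exp_lt_one_iff.2 (neg_lt_zero.2 hα)
      linarith
    have h3 := truncMoment_nonneg (μ := μ) (X := X) (α := α) (x := Real.exp (-(1 : ℕ)) * x)
      (by positivity)
    simp only [Finset.sum_range_one, Nat.cast_zero, neg_zero, Real.exp_zero, one_mul] at h
    have := mul_pos hc (hpos x hx)
    linarith
  have key : ∀ s, 0 ≤ s → Tendsto (fun t => (1 + truncMoment μ X α (Real.exp (t + s)) / α) /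
      (1 + truncMoment μ X α (Real.exp t) / α)) atTop (𝓝 1) := by
    intro s hs
    have h0 := ((tendsto_normalizedTail_div_truncMoment hX hα hpos hslow).comp
      Real.tendsto_exp_atTop).const_mul (Real.exp (α * s) - 1) |>.const_add 1
    simp only [mul_zero, add_zero] at h0
    refine tendsto_of_tendsto_of_tendsto_of_le_of_le tendsto_const_nhds h0 (fun t => ?_)
      fun t => ?_
    · rw [one_le_div (hone t)]
      have := truncMoment_mono (μ := μ) hX hα.le (Real.exp_pos t).le
        (Real.exp_le_exp.2 (show t ≤ t + s by linarith))
      gcongr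
    · have h1 := truncMoment_sub_le (μ := μ) hX hα (Real.exp_pos t).le
        (Real.exp_le_exp.2 (show t ≤ t + s by linarith))
      have he : (Real.exp (t + s) ^ α - Real.exp t ^ α) * (μ {ω | Real.exp t < X ω}).toReal =
          (Real.exp (α * s) - 1) * normalizedTail μ X α (Real.exp t) := by
        rw [normalizedTail, ← Real.exp_mul, ← Real.exp_mul, add_mul, Real.exp_add, mul_comm s α]
        ring
      rw [he] at h1
      have hV := hVpos _ (Real.exp_pos t)
      simp only [Function.comp_apply]
      rw [div_le_iff₀ (hone t)]
      have hE : 0 ≤ (Real.exp (α * s) - 1) * (normalizedTail μ X α (Real.exp t) /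
          truncMoment μ X α (Real.exp t)) :=
        mul_nonneg (by linarith [Real.one_le_exp (mul_nonneg hα.le hs)])
          (div_nonneg (normalizedTail_nonneg (Real.exp_pos t).le) hV.le)
      have h2 : (Real.exp (α * s) - 1) * (normalizedTail μ X α (Real.exp t) /
          truncMoment μ X α (Real.exp t)) * (truncMoment μ X α (Real.exp t) / α) =
          (Real.exp (α * s) - 1) * normalizedTail μ X α (Real.exp t) / α := by
        field_simp
      have h3 := div_le_div_of_nonneg_right h1 hα.le
      rw [sub_div] at h3
      rw [add_mul, one_mul, mul_add, h2, mul_one]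
      linarith
  rcases le_total 0 s with hs | hs
  · exact key s hs
  · have h1 := ((key (-s) (by linarith)).comp
      (tendsto_atTop_add_const_right atTop s tendsto_id)).inv₀
      one_ne_zero
    rw [inv_one] at h1
    refine h1.congr fun t => ?_
    simp [inv_div]

/-- A regularly varying tail of index `-α` has finite moments of every order `β < α`. -/
theorem integrable_rpow_of_slow_tail (hX : Measurable X) (hβ : 0 < β) (hβα : β < α)
    (hpos : ∀ x > 0, 0 < normalizedTail μ X α x)
    (hslow : Tendsto (fun x => normalizedTail μ X α (2 * x) / normalizedTail μ X α x) atTop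
      (𝓝 1)) :
    Integrable (fun ω => max (X ω) 0 ^ β) μ := by
  have hshift : ∀ x > 0, normalizedTail μ X β x = x ^ (β - α) * normalizedTail μ X α x := by
    intro x hx
    rw [normalizedTail, normalizedTail, ← mul_assoc, ← Real.rpow_add hx, sub_add_cancel]
  have hr1 : (2 : ℝ) ^ (β - α) < 1 := Real.rpow_lt_one_of_one_lt_of_neg one_lt_two (by linarith)
  have hlim : Tendsto (fun x => normalizedTail μ X β (2 * x) / normalizedTail μ X β x) atTop
      (𝓝 (2 ^ (β - α))) := by
    have := hslow.const_mul ((2 : ℝ) ^ (β - α))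
    rw [mul_one] at this
    refine this.congr' ?_
    filter_upwards [eventually_gt_atTop 0] with x hx
    have h1 := (hpos x hx).ne'
    have h2 := (Real.rpow_pos_of_pos hx (β - α)).ne'
    rw [hshift x hx, hshift (2 * x) (by positivity), Real.mul_rpow two_pos.le hx.le]
    field_simp
  obtain ⟨r, hr, hr1⟩ := exists_between hr1
  have hr0 : 0 < r := lt_trans (by positivity) hr
  obtain ⟨x₀, hx₀⟩ := eventually_atTop.1
    ((hlim.eventually (gt_mem_nhds hr)).and (eventually_gt_atTop 0))
  have hx0 : 0 < x₀ := (hx₀ x₀ le_rfl).2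
  have hge : ∀ n : ℕ, x₀ ≤ 2 ^ n * x₀ := fun n =>
    le_mul_of_one_le_left hx0.le (one_le_pow₀ one_le_two)
  have hposβ : ∀ x > 0, 0 < normalizedTail μ X β x := fun x hx => by
    rw [hshift x hx]; exact mul_pos (Real.rpow_pos_of_pos hx _) (hpos x hx)
  have hgeo : ∀ n : ℕ, normalizedTail μ X β (2 ^ n * x₀) ≤ r ^ n * normalizedTail μ X β x₀ := by
    intro n
    induction n with
    | zero => simp
    | succ n ih =>
      have h := (hx₀ _ (hge n)).1
      rw [div_lt_iff₀ (hposβ _ (by positivity))] at h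
      rw [pow_succ', pow_succ', mul_assoc, mul_assoc]
      exact h.le.trans (mul_le_mul_of_nonneg_left ih hr0.le)
  set T := normalizedTail μ X β x₀
  have hT : 0 < T := hposβ x₀ hx0
  have hd : 0 < (2 : ℝ) ^ β - 1 := by linarith [Real.one_lt_rpow one_lt_two hβ]
  refine integrable_rpow_of_truncMoment_le hX hβ.le (a := fun n : ℕ => 2 ^ n * x₀)
    (M := truncMoment μ X β x₀ + (2 ^ β - 1) * T * (1 - r)⁻¹) (fun n => by positivity)
    ((tendsto_pow_atTop_atTop_of_one_lt one_lt_two).atTop_mul_const hx0) fun n => ?_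
  have hsum : truncMoment μ X β (2 ^ n * x₀) ≤
      truncMoment μ X β x₀ + (2 ^ β - 1) * T * ∑ j ∈ Finset.range n, r ^ j := by
    induction n with
    | zero => simp
    | succ n ih =>
      have h := truncMoment_sub_le (μ := μ) (x := 2 ^ n * x₀) (y := 2 ^ (n + 1) * x₀) hX hβ
        (by positivity) (by gcongr <;> norm_num)
      have he : (((2 : ℝ) ^ (n + 1) * x₀) ^ β - (2 ^ n * x₀) ^ β) *
          (μ {ω | 2 ^ n * x₀ < X ω}).toReal =
          (2 ^ β - 1) * normalizedTail μ X β (2 ^ n * x₀) := by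
        rw [normalizedTail, pow_succ', mul_assoc, Real.mul_rpow two_pos.le (by positivity)]
        ring
      rw [he] at h
      have := mul_le_mul_of_nonneg_left (hgeo n) hd.le
      rw [Finset.sum_range_succ]
      nlinarith
  refine hsum.trans ?_
  gcongr
  rw [← tsum_geometric_of_lt_one hr0.le hr1]
  exact (summable_geometric_of_lt_one hr0.le hr1).sum_le_tsum _ fun j _ => by positivity

end RegularlyVaryingTail

section FixedPoint

variable {Ω : Type*} [MeasurableSpace Ω] {μ : Measure Ω}

theorem truncMoment_eq_of_map_eq {X Y : Ω → ℝ} {β x : ℝ} (hX : Measurable X) (hY : Measurable Y)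
    (h : μ.map X = μ.map Y) : truncMoment μ X β x = truncMoment μ Y β x := by
  rw [truncMoment, truncMoment,
    ← integral_map hX.aemeasurable measurable_truncPow.aestronglyMeasurable, h,
    integral_map hY.aemeasurable measurable_truncPow.aestronglyMeasurable]

variable [IsProbabilityMeasure μ]

theorem integral_comp_of_indepFun {E F : Type*} [MeasurableSpace E] [MeasurableSpace F]
    {X : Ω → E} {Y : Ω → F} (hX : Measurable X) (hY : Measurable Y) (hXY : IndepFun X Y μ)
    {g : E × F → ℝ} (hg : Measurable g) (hint : Integrable (fun ω => g (X ω, Y ω)) μ) :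
    ∫ ω, g (X ω, Y ω) ∂μ = ∫ ω, ∫ ω', g (X ω, Y ω') ∂μ ∂μ := by
  have hprod := (indepFun_iff_map_prod_eq_prod_map_map hX.aemeasurable hY.aemeasurable).1 hXY
  have : IsProbabilityMeasure (μ.map X) := Measure.isProbabilityMeasure_map hX.aemeasurable
  have : IsProbabilityMeasure (μ.map Y) := Measure.isProbabilityMeasure_map hY.aemeasurable
  have hint' : Integrable g ((μ.map X).prod (μ.map Y)) := by
    rw [← hprod]
    exact (integrable_map_measure hg.aestronglyMeasurable (hX.prodMk hY).aemeasurable).2 hint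
  calc ∫ ω, g (X ω, Y ω) ∂μ = ∫ p, g p ∂(μ.map fun ω => (X ω, Y ω)) :=
        (integral_map (hX.prodMk hY).aemeasurable hg.aestronglyMeasurable).symm
    _ = ∫ a, ∫ b, g (a, b) ∂(μ.map Y) ∂(μ.map X) := by rw [hprod, integral_prod _ hint']
    _ = ∫ ω, ∫ b, g (X ω, b) ∂(μ.map Y) ∂μ :=
        integral_map hX.aemeasurable
          (StronglyMeasurable.integral_prod_right' (ν := μ.map Y)
            hg.stronglyMeasurable).aestronglyMeasurable
    _ = ∫ ω, ∫ ω', g (X ω, Y ω') ∂μ ∂μ := by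
        refine integral_congr_ae (ae_of_all _ fun ω => ?_)
        exact integral_map hY.aemeasurable (hg.comp measurable_prodMk_left).aestronglyMeasurable

theorem tendsto_measure_natCast_lt {X : Ω → ℝ} (hX : Measurable X) :
    Tendsto (fun n : ℕ => (μ {ω | (n : ℝ) < X ω}).toReal) atTop (𝓝 0) := by
  have h := tendsto_measure_iInter_atTop (μ := μ) (s := fun n : ℕ => {ω | (n : ℝ) < X ω})
    (fun n => (measurableSet_lt measurable_const hX).nullMeasurableSet)
    (fun m n hmn ω (hω : (n : ℝ) < X ω) =>
      show (m : ℝ) < X ω from lt_of_le_of_lt (Nat.cast_le.2 hmn) hω) ⟨0, measure_ne_top _ _⟩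
  have he : ⋂ n : ℕ, {ω | (n : ℝ) < X ω} = ∅ := by
    ext ω
    obtain ⟨n, hn⟩ := exists_nat_ge (X ω)
    simp only [mem_iInter, mem_ofPred_eq, mem_empty_iff_false, iff_false, not_forall, not_lt]
    exact ⟨n, hn⟩
  rw [he, measure_empty] at h
  simpa [Function.comp_def] using (ENNReal.tendsto_toReal ENNReal.zero_ne_top).comp h

theorem rpow_mul_tail_le {X : Ω → ℝ} {β x : ℝ} (hX : Measurable X) (hβ : 0 < β) (hx : 0 ≤ x)
    (hint : Integrable (fun ω => max (X ω) 0 ^ β) μ) :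
    x ^ β * (μ {ω | x < X ω}).toReal ≤ ∫ ω, max (X ω) 0 ^ β ∂μ := by
  rw [← integral_const_mul_indicator_Ioi hX]
  refine integral_mono (integrable_const_mul_indicator_Ioi hX _) hint fun ω => ?_
  by_cases h : x < X ω
  · simp only [indicator_of_mem (mem_Ioi.2 h), Pi.one_apply, mul_one]
    exact Real.rpow_le_rpow hx (h.le.trans (le_max_left _ _)) hβ.le
  · simp only [indicator_of_notMem (show X ω ∉ Ioi x from h), mul_zero]
    exact Real.rpow_nonneg (le_max_right _ _) _

variable {A B R : Ω → ℝ} {α β γ q x : ℝ}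

theorem integral_truncPow_mul (hA : Measurable A) (hR : Measurable R) (hA0 : ∀ ω, 0 ≤ A ω)
    (hAR : IndepFun A R μ) (hβ : 0 < β) (hx : 0 ≤ x) :
    ∫ ω, truncPow β x (A ω * R ω) ∂μ = ∫ ω, A ω ^ β * truncMoment μ R β (x / A ω) ∂μ := by
  rw [integral_comp_of_indepFun hA hR hAR (g := fun p => truncPow β x (p.1 * p.2))
    (measurable_truncPow.comp (measurable_fst.mul measurable_snd))
    (integrable_truncPow (hA.mul hR) hβ.le hx)]
  refine integral_congr_ae (ae_of_all _ fun ω => ?_)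
  simp only
  rw [truncMoment, ← integral_const_mul]
  refine integral_congr_ae (ae_of_all _ fun ω' => ?_)
  simp only
  rcases (hA0 ω).eq_or_lt with h | h
  · rw [← h, zero_mul, truncPow_of_nonpos hβ hx le_rfl, Real.zero_rpow hβ.ne', zero_mul]
  · rw [← truncPow_mul h.le (div_nonneg hx h.le), mul_div_cancel₀ _ h.ne']

theorem rpow_mul_truncMoment_le (hR : Measurable R) (hA0 : ∀ ω, 0 ≤ A ω) (hβ : 0 < β)
    (hx : 0 ≤ x) (ω : Ω) : A ω ^ β * truncMoment μ R β (x / A ω) ≤ x ^ β := by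
  rcases (hA0 ω).eq_or_lt with h | h
  · rw [← h, Real.zero_rpow hβ.ne', zero_mul]
    exact Real.rpow_nonneg hx _
  · refine (mul_le_mul_of_nonneg_left (truncMoment_le hR hβ.le (div_nonneg hx h.le))
      (Real.rpow_nonneg h.le _)).trans_eq ?_
    rw [← Real.mul_rpow h.le (div_nonneg hx h.le), mul_div_cancel₀ _ h.ne']

theorem integrable_rpow_mul_truncMoment (hA : Measurable A) (hR : Measurable R)
    (hA0 : ∀ ω, 0 ≤ A ω) (hβ : 0 < β) (hx : 0 ≤ x) :
    Integrable (fun ω => A ω ^ β * truncMoment μ R β (x / A ω)) μ := by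
  have hm : Measurable fun p : ℝ × Ω => truncPow β p.1 (R p.2) := by
    unfold truncPow
    exact (((hR.comp measurable_snd).max measurable_const).min measurable_fst).pow_const β
  have hm' : Measurable (truncMoment μ R β) :=
    (hm.stronglyMeasurable.integral_prod_right (ν := μ)).measurable
  refine Integrable.mono' (integrable_const (x ^ β))
    ((hA.pow_const β).mul (hm'.comp (measurable_const.div hA))).aestronglyMeasurable
    (ae_of_all _ fun ω => ?_)
  rw [Real.norm_of_nonneg (mul_nonneg (Real.rpow_nonneg (hA0 ω) _)
    (truncMoment_nonneg (div_nonneg hx (hA0 ω))))]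
  exact rpow_mul_truncMoment_le hR hA0 hβ hx ω

/-- Iterating a subsolution inequality of renewal type improves an a priori bound. -/
theorem truncMoment_le_of_subsolution (hA : Measurable A) (hR : Measurable R)
    (hA0 : ∀ ω, 0 ≤ A ω) (hγ : 0 < γ) (hγβ : γ ≤ β) (hAγ : Integrable (fun ω => A ω ^ γ) μ)
    (hAβ : Integrable (fun ω => A ω ^ β) μ) {a p b : ℝ} (hq : 0 < q) (ha : 0 ≤ a) (hp : 0 ≤ p)
    (hb : 0 ≤ b) (hqγ : q * ∫ ω, A ω ^ γ ∂μ < 1) (hqβ : q * ∫ ω, A ω ^ β ∂μ < 1)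
    (hqp : q * p ≤ p)
    (hsub : ∀ x > 0, truncMoment μ R β x ≤
      q * ∫ ω, A ω ^ β * truncMoment μ R β (x / A ω) ∂μ + b)
    (hstart : ∀ x > 0, truncMoment μ R β x ≤ a * x ^ (β - γ) + p * x ^ β) (hx : 0 < x) :
    truncMoment μ R β x ≤ p * x ^ β + b / (1 - q * ∫ ω, A ω ^ β ∂μ) := by
  have hβ := hγ.trans_le hγβ
  set κγ := ∫ ω, A ω ^ γ ∂μ with hκγ
  set κβ := ∫ ω, A ω ^ β ∂μ with hκβ
  have hκγ0 : 0 ≤ κγ := integral_nonneg fun ω => Real.rpow_nonneg (hA0 ω) _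
  set D := b / (1 - q * κβ) with hD
  have hD0 : 0 ≤ D := div_nonneg hb (by linarith)
  have hDeq : q * κβ * D + b = D := by
    rw [hD]; field_simp [show 1 - q * κβ ≠ 0 by linarith]; ring
  have key : ∀ n : ℕ, ∀ x > 0,
      truncMoment μ R β x ≤ (q * κγ) ^ n * a * x ^ (β - γ) + p * x ^ β + D := by
    intro n
    induction n with
    | zero =>
      intro x hx
      have := hstart x hx
      simp only [pow_zero, one_mul]
      linarith
    | succ n ih =>
      intro x hx
      set a' := (q * κγ) ^ n * a with ha'
      have ha'0 : 0 ≤ a' := by positivity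
      have hpt : ∀ ω, A ω ^ β * truncMoment μ R β (x / A ω) ≤
          a' * x ^ (β - γ) * A ω ^ γ + p * x ^ β + D * A ω ^ β := by
        intro ω
        rcases (hA0 ω).eq_or_lt with h | h
        · rw [← h, Real.zero_rpow hβ.ne', Real.zero_rpow hγ.ne']
          have : 0 ≤ p * x ^ β := by positivity
          linarith
        · refine (mul_le_mul_of_nonneg_left (ih (x / A ω) (div_pos hx h))
            (Real.rpow_nonneg h.le _)).trans_eq ?_
          have h1 := (Real.rpow_pos_of_pos h β).ne'
          have h2 := (Real.rpow_pos_of_pos h γ).ne'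
          rw [Real.div_rpow hx.le h.le, Real.div_rpow hx.le h.le, Real.rpow_sub h]
          field_simp
      have hi1 : Integrable (fun ω => a' * x ^ (β - γ) * A ω ^ γ + p * x ^ β) μ :=
        (hAγ.const_mul _).add (integrable_const _)
      have hmono := integral_mono (integrable_rpow_mul_truncMoment hA hR hA0 hβ hx.le)
        (hi1.add (hAβ.const_mul D)) hpt
      simp only [Pi.add_apply] at hmono
      rw [integral_add hi1 (hAβ.const_mul D), integral_add (hAγ.const_mul _) (integrable_const _),
        integral_const_mul, integral_const_mul D, integral_const, ← hκγ, ← hκβ] at hmono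
      simp only [probReal_univ, one_smul] at hmono
      have h3 := mul_le_mul_of_nonneg_left hmono hq.le
      have h4 := mul_le_mul_of_nonneg_right hqp (Real.rpow_nonneg hx.le β)
      have h5 := hsub x hx
      have h6 : q * (a' * x ^ (β - γ) * κγ + p * x ^ β + D * κβ) =
          (q * κγ) ^ (n + 1) * a * x ^ (β - γ) + q * p * x ^ β + q * κβ * D := by
        rw [ha']; ring
      rw [h6] at h3
      linarith
  have hlim : Tendsto (fun n : ℕ => (q * κγ) ^ n * a * x ^ (β - γ) + p * x ^ β + D) atTop
      (𝓝 (0 * a * x ^ (β - γ) + p * x ^ β + D)) :=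
    ((((tendsto_pow_atTop_nhds_zero_of_lt_one (by positivity) hqγ).mul_const a).mul_const
      _).add_const _).add_const _
  have := ge_of_tendsto' hlim fun n => key n x hx
  simpa using this

theorem add_rpow_le_mul_add_mul (hβ : 1 < β) (hq : 1 < q) :
    ∃ C, 0 ≤ C ∧ ∀ a b : ℝ, 0 ≤ a → 0 ≤ b → (a + b) ^ β ≤ q * a ^ β + C * b ^ β := by
  have hq0 : 0 < q := one_pos.trans hq
  set θ := q ^ (-(1 / (β - 1))) with hθ
  have hβ1 : 0 < β - 1 := by linarith
  have hθ0 : 0 < θ := Real.rpow_pos_of_pos hq0 _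
  have hθ1 : θ < 1 := Real.rpow_lt_one_of_one_lt_of_neg hq (by rw [neg_lt_zero]; positivity)
  have hθq : θ * θ⁻¹ ^ β = q := by
    rw [Real.inv_rpow hθ0.le, ← Real.rpow_neg hθ0.le]
    nth_rewrite 1 [← Real.rpow_one θ]
    rw [← Real.rpow_add hθ0, hθ, ← Real.rpow_mul hq0.le]
    have : -(1 / (β - 1)) * (1 + -β) = 1 := by field_simp; ring
    rw [this, Real.rpow_one]
  refine ⟨(1 - θ) * (1 - θ)⁻¹ ^ β, ?_, fun a b ha hb => ?_⟩
  · have : 0 < 1 - θ := by linarith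
    positivity
  have hθ' : 0 < 1 - θ := by linarith
  have h := (convexOn_rpow hβ.le).2 (show θ⁻¹ * a ∈ Ici 0 by simp; positivity)
    (show (1 - θ)⁻¹ * b ∈ Ici 0 by simp; positivity) hθ0.le hθ'.le (by ring)
  simp only [smul_eq_mul] at h
  rw [mul_inv_cancel_left₀ hθ0.ne', mul_inv_cancel_left₀ hθ'.ne',
    Real.mul_rpow (by positivity) ha, Real.mul_rpow (by positivity) hb, ← mul_assoc, ← mul_assoc,
    hθq] at h
  exact h

theorem truncPow_add_le {u v C : ℝ} (hβ : 0 ≤ β) (hx : 0 ≤ x)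
    (hC : ∀ a b : ℝ, 0 ≤ a → 0 ≤ b → (a + b) ^ β ≤ q * a ^ β + C * b ^ β) :
    truncPow β x (u + v) ≤ q * truncPow β x u + C * max v 0 ^ β := by
  refine le_trans ?_ (hC (min (max u 0) x) (max v 0) (le_min (le_max_right _ _) hx)
    (le_max_right _ _))
  refine Real.rpow_le_rpow (le_min (le_max_right _ _) hx) ?_ hβ
  rcases le_total (max u 0) x with h | h
  · rw [min_eq_left h]
    refine (min_le_left _ _).trans (max_le ?_ ?_)
    · exact add_le_add (le_max_left _ _) (le_max_left _ _)
    · exact add_nonneg (le_max_right _ _) (le_max_right _ _)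
  · rw [min_eq_right h]
    exact (min_le_right _ _).trans (le_add_of_nonneg_right (le_max_right _ _))

theorem truncMoment_subsolution (hA : Measurable A) (hB : Measurable B) (hR : Measurable R)
    (hA0 : ∀ ω, 0 ≤ A ω) (hAR : IndepFun A R μ)
    (hfix : μ.map R = μ.map fun ω => A ω * R ω + B ω) (hβ : 0 < β)
    (hBβ : Integrable (fun ω => max (B ω) 0 ^ β) μ) {C : ℝ}
    (hC : ∀ a b : ℝ, 0 ≤ a → 0 ≤ b → (a + b) ^ β ≤ q * a ^ β + C * b ^ β) (hx : 0 ≤ x) :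
    truncMoment μ R β x ≤ q * ∫ ω, A ω ^ β * truncMoment μ R β (x / A ω) ∂μ +
      C * ∫ ω, max (B ω) 0 ^ β ∂μ := by
  have hi : Integrable (fun ω => truncPow β x (A ω * R ω)) μ :=
    integrable_truncPow (hA.mul hR) hβ.le hx
  rw [truncMoment_eq_of_map_eq hR ((hA.mul hR).add hB) hfix,
    ← integral_truncPow_mul hA hR hA0 hAR hβ hx, ← integral_const_mul, ← integral_const_mul,
    ← integral_add (hi.const_mul q) (hBβ.const_mul C)]
  exact integral_mono (integrable_truncPow ((hA.mul hR).add hB) hβ.le hx)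
    ((hi.const_mul q).add (hBβ.const_mul C))
    fun ω => truncPow_add_le hβ.le hx hC

end FixedPoint

section Moments

variable {Ω : Type*} [MeasurableSpace Ω] {μ : Measure Ω} [IsProbabilityMeasure μ]
  {A B R : Ω → ℝ} {α β γ q x : ℝ}

theorem truncMoment_le_rpow_mul_add (hR : Measurable R) {K : ℝ} (hK : 0 ≤ K)
    (hγ : 0 < γ) (hγβ : γ ≤ β) (hx : 0 < x) :
    truncMoment μ R β x ≤ K ^ γ * x ^ (β - γ) + (μ {ω | K < R ω}).toReal * x ^ β := by
  have hβ := hγ.trans_le hγβ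
  have hpt : ∀ ω, truncPow β x (R ω) ≤
      K ^ γ * x ^ (β - γ) + x ^ β * (Ioi K).indicator 1 (R ω) := by
    intro ω
    by_cases h : K < R ω
    · rw [indicator_of_mem (mem_Ioi.2 h), Pi.one_apply, mul_one]
      have : 0 ≤ K ^ γ * x ^ (β - γ) := by positivity
      linarith [truncPow_le (u := R ω) hβ.le hx.le]
    · rw [indicator_of_notMem (by simpa using h), mul_zero, add_zero, truncPow]
      push Not at h
      have h0 : 0 ≤ min (max (R ω) 0) x := le_min (le_max_right _ _) hx.le
      rcases h0.eq_or_lt with h1 | h1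
      · rw [← h1, Real.zero_rpow hβ.ne']; positivity
      · rw [show β = γ + (β - γ) by ring, Real.rpow_add h1, add_sub_cancel]
        exact mul_le_mul (Real.rpow_le_rpow h0 ((min_le_left _ _).trans (max_le h hK)) hγ.le)
          (Real.rpow_le_rpow h0 (min_le_right _ _) (by linarith)) (by positivity) (by positivity)
  refine (integral_mono (integrable_truncPow hR hβ.le hx.le) ((integrable_const _).add
    (integrable_const_mul_indicator_Ioi hR _)) hpt).trans_eq ?_
  simp only [Pi.add_apply]
  rw [integral_add (integrable_const _) (integrable_const_mul_indicator_Ioi hR _),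
    integral_const_mul_indicator_Ioi hR, integral_const, mul_comm (x ^ β)]
  simp

theorem truncMoment_le_mul_integral (hR : Measurable R) (hγ : 0 < γ) (hγβ : γ ≤ β)
    (hint : Integrable (fun ω => max (R ω) 0 ^ γ) μ) (hx : 0 < x) :
    truncMoment μ R β x ≤ (∫ ω, max (R ω) 0 ^ γ ∂μ) * x ^ (β - γ) := by
  have hβ := hγ.trans_le hγβ
  rw [← integral_mul_const]
  refine integral_mono (integrable_truncPow hR hβ.le hx.le) (hint.mul_const _) fun ω => ?_
  have h0 : 0 ≤ min (max (R ω) 0) x := le_min (le_max_right _ _) hx.le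
  have hr : 0 ≤ max (R ω) 0 := le_max_right _ _
  rw [truncPow]
  rcases h0.eq_or_lt with h1 | h1
  · rw [← h1, Real.zero_rpow hβ.ne']; positivity
  · simp only
    rw [show β = γ + (β - γ) by ring, Real.rpow_add h1, add_sub_cancel]
    exact mul_le_mul (Real.rpow_le_rpow h0 (min_le_left _ _) hγ.le)
      (Real.rpow_le_rpow h0 (min_le_right _ _) (by linarith)) (by positivity) (by positivity)

/-- Moments of order at most one of the positive part of the solution. -/
theorem integrable_rpow_solution_of_le_one (hA : Measurable A) (hB : Measurable B)
    (hR : Measurable R) (hA0 : ∀ ω, 0 ≤ A ω) (hAR : IndepFun A R μ)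
    (hfix : μ.map R = μ.map fun ω => A ω * R ω + B ω) (hβ : 0 < β) (hβ1 : β ≤ 1)
    (hBβ : Integrable (fun ω => max (B ω) 0 ^ β) μ)
    (hAint : ∀ γ, 0 < γ → γ ≤ β → Integrable (fun ω => A ω ^ γ) μ)
    (hAlt : ∀ γ, 0 < γ → γ ≤ β → ∫ ω, A ω ^ γ ∂μ < 1) :
    Integrable (fun ω => max (R ω) 0 ^ β) μ := by
  set b := ∫ ω, max (B ω) 0 ^ β ∂μ with hb
  have hb0 : 0 ≤ b := integral_nonneg fun ω => Real.rpow_nonneg (le_max_right _ _) _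
  have hβ2 : 0 < β / 2 := by positivity
  have hle : ∀ x > 0, truncMoment μ R β x ≤ b / (1 - 1 * ∫ ω, A ω ^ β ∂μ) := by
    intro x hx
    have hK : ∀ K : ℕ, truncMoment μ R β x ≤
        (μ {ω | (K : ℝ) < R ω}).toReal * x ^ β + b / (1 - 1 * ∫ ω, A ω ^ β ∂μ) := by
      intro K
      refine truncMoment_le_of_subsolution (a := (K : ℝ) ^ (β / 2)) (γ := β / 2) (q := 1) hA hR hA0
        hβ2 (by linarith) (hAint _ hβ2 (by linarith)) (hAint β hβ le_rfl) one_pos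
        (by positivity) ENNReal.toReal_nonneg hb0 (by rw [one_mul]; exact hAlt _ hβ2 (by linarith))
        (by rw [one_mul]; exact hAlt β hβ le_rfl) (by rw [one_mul]) (fun y hy => ?_)
        (fun y hy => ?_) hx
      · have := truncMoment_subsolution (q := 1) (C := 1) (x := y) hA hB hR hA0 hAR hfix hβ hBβ
          (fun a b ha hb => by
            rw [one_mul, one_mul]; exact Real.rpow_add_le_add_rpow ha hb hβ.le hβ1) hy.le
        rwa [one_mul (∫ ω, max (B ω) 0 ^ β ∂μ)] at this
      · exact truncMoment_le_rpow_mul_add hR K.cast_nonneg hβ2 (by linarith) hy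
    have hlim := ((tendsto_measure_natCast_lt (μ := μ) hR).mul_const (x ^ β)).add_const
      (b / (1 - 1 * ∫ ω, A ω ^ β ∂μ))
    rw [zero_mul, zero_add] at hlim
    exact ge_of_tendsto' hlim hK
  exact integrable_rpow_of_truncMoment_le hR hβ.le (a := fun n : ℕ => (n : ℝ) + 1)
    (fun n => by positivity) (tendsto_atTop_add_const_right _ _ tendsto_natCast_atTop_atTop)
    fun n => hle _ (by positivity)

/-- Moments of the positive part of the solution of `R =_d A R + B`. -/
theorem integrable_rpow_solution (hA : Measurable A) (hB : Measurable B)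
    (hR : Measurable R) (hA0 : ∀ ω, 0 ≤ A ω) (hAR : IndepFun A R μ)
    (hfix : μ.map R = μ.map fun ω => A ω * R ω + B ω) (hβ : 0 < β)
    (hBβ : Integrable (fun ω => max (B ω) 0 ^ β) μ)
    (hAint : ∀ γ, 0 < γ → γ ≤ β → Integrable (fun ω => A ω ^ γ) μ)
    (hAlt : ∀ γ, 0 < γ → γ ≤ β → ∫ ω, A ω ^ γ ∂μ < 1) :
    Integrable (fun ω => max (R ω) 0 ^ β) μ := by
  rcases le_or_gt β 1 with hβ1 | hβ1
  · exact integrable_rpow_solution_of_le_one hA hB hR hA0 hAR hfix hβ hβ1 hBβ hAint hAlt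
  have hR1 : Integrable (fun ω => max (R ω) 0 ^ (1 : ℝ)) μ :=
    integrable_rpow_solution_of_le_one hA hB hR hA0 hAR hfix one_pos le_rfl
      (integrable_rpow_of_le (by fun_prop) (fun ω => le_max_right _ _) hBβ zero_le_one hβ1.le)
      (fun γ h h' => hAint γ h (h'.trans hβ1.le)) (fun γ h h' => hAlt γ h (h'.trans hβ1.le))
  obtain ⟨q, hq, hq1, hqβ⟩ : ∃ q : ℝ, 1 < q ∧ q * ∫ ω, A ω ^ (1 : ℝ) ∂μ < 1 ∧
      q * ∫ ω, A ω ^ β ∂μ < 1 := by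
    have hev : ∀ c : ℝ, c < 1 → ∀ᶠ q in 𝓝[>] (1 : ℝ), q * c < 1 := fun c hc => by
      have : Tendsto (fun q : ℝ => q * c) (𝓝[>] 1) (𝓝 (1 * c)) :=
        (tendsto_id.mono_left nhdsWithin_le_nhds).mul_const c
      exact this.eventually (gt_mem_nhds (by simpa using hc))
    obtain ⟨q, ⟨h1, h2⟩, h3⟩ := (((hev _ (hAlt 1 one_pos hβ1.le)).and
      (hev _ (hAlt β hβ le_rfl))).and self_mem_nhdsWithin).exists
    exact ⟨q, h3, h1, h2⟩
  obtain ⟨C, hC0, hC⟩ := add_rpow_le_mul_add_mul hβ1 hq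
  have hb0 : 0 ≤ C * ∫ ω, max (B ω) 0 ^ β ∂μ :=
    mul_nonneg hC0 (integral_nonneg fun ω => Real.rpow_nonneg (le_max_right _ _) _)
  refine integrable_rpow_of_truncMoment_le hR hβ.le (a := fun n : ℕ => (n : ℝ) + 1)
    (fun n => by positivity) (tendsto_atTop_add_const_right _ _ tendsto_natCast_atTop_atTop)
    fun n => (truncMoment_le_of_subsolution (γ := 1) (q := q) (p := 0) hA hR hA0 one_pos hβ1.le
      (hAint 1 one_pos hβ1.le) (hAint β hβ le_rfl) (one_pos.trans hq)
      (a := ∫ ω, max (R ω) 0 ^ (1 : ℝ) ∂μ)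
      (integral_nonneg fun ω => Real.rpow_nonneg (le_max_right _ _) _) le_rfl hb0 hq1 hqβ
      (by rw [mul_zero]) (fun y hy => truncMoment_subsolution hA hB hR hA0 hAR hfix hβ hBβ hC hy.le)
      (fun y hy => ?_) (by positivity)).trans_eq (by rw [zero_mul, zero_add])
  rw [zero_mul, add_zero]
  exact truncMoment_le_mul_integral hR one_pos hβ1.le hR1 hy

end Moments

section Increments

variable {α ε x u v a b d : ℝ}

theorem truncPow_sub_le_rpow_sub (hα : 0 ≤ α) (hx : 0 ≤ x) (hv : 0 ≤ v) (hvu : v ≤ u) :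
    truncPow α x u - truncPow α x v ≤ u ^ α - v ^ α := by
  rcases le_total u x with h | h
  · rw [truncPow_of_le (hv.trans hvu) h, truncPow_of_le hv (hvu.trans h)]
  · rw [truncPow_of_ge hx h]
    rcases le_total v x with h' | h'
    · rw [truncPow_of_le hv h']
      linarith [Real.rpow_le_rpow hx h hα]
    · rw [truncPow_of_ge hx h']
      linarith [Real.rpow_le_rpow hv hvu hα]

theorem abs_truncPow_sub_le (hα : 0 ≤ α) (hx : 0 ≤ x) (hv : 0 ≤ v) (hvu : v ≤ u) :
    |truncPow α x u - truncPow α x v| ≤ u ^ α - v ^ α := by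
  rw [abs_of_nonneg (sub_nonneg.2 (truncPow_mono hα hx le_rfl hvu))]
  exact truncPow_sub_le_rpow_sub hα hx hv hvu

theorem one_add_rpow_sub_one_le (hα : 0 < α) {y : ℝ} (hy : 0 ≤ y) (hy1 : y ≤ 1) :
    (1 + y) ^ α - 1 ≤ 2 ^ α * y := by
  rcases le_total α 1 with h | h
  · have h1 := Real.rpow_le_rpow_of_exponent_le (show 1 ≤ 1 + y by linarith) h
    rw [Real.rpow_one] at h1
    have h2 : 1 * y ≤ (2 : ℝ) ^ α * y :=
      mul_le_mul_of_nonneg_right (Real.one_le_rpow one_le_two hα.le) hy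
    linarith
  · have h1 := (convexOn_rpow h).2 (show (1 : ℝ) ∈ Ici 0 by simp) (show (2 : ℝ) ∈ Ici 0 by simp)
      (sub_nonneg.2 hy1) hy (by ring)
    simp only [smul_eq_mul, Real.one_rpow] at h1
    rw [show (1 - y) * 1 + y * 2 = 1 + y by ring] at h1
    linarith

theorem one_sub_one_sub_rpow_le (hα : 0 < α) {y : ℝ} (hy : 0 ≤ y) (hy1 : y ≤ 1) :
    1 - (1 - y) ^ α ≤ (1 + α) * y := by
  rcases le_total α 1 with h | h
  · have h1 := Real.rpow_le_rpow_of_exponent_ge' (sub_nonneg.2 hy1) (by linarith) hα.le h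
    rw [Real.rpow_one] at h1
    have := mul_nonneg hα.le hy
    linarith
  · have h1 := one_add_mul_self_le_rpow_one_add (s := -y) (by linarith) h
    rw [← sub_eq_add_neg] at h1
    linarith

theorem rpow_mul_div_rpow (ha : 0 < a) (hb : 0 ≤ b) :
    a ^ α * (b / a) ^ ε = a ^ (α - ε) * b ^ ε := by
  rw [Real.div_rpow hb ha.le, Real.rpow_sub ha]
  ring

theorem add_rpow_sub_rpow_le (hα : 0 < α) (hε : 0 < ε) (hε1 : ε ≤ 1) (ha : 0 < a) (hb : 0 ≤ b)
    (hba : b ≤ a) : (a + b) ^ α - a ^ α ≤ 2 ^ α * (a ^ (α - ε) * b ^ ε) := by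
  have hy : 0 ≤ b / a := by positivity
  have hy1 : b / a ≤ 1 := (div_le_one ha).2 hba
  have h1 := one_add_rpow_sub_one_le hα hy hy1
  have h2 : b / a ≤ (b / a) ^ ε := by
    simpa using Real.rpow_le_rpow_of_exponent_ge' hy hy1 hε.le hε1
  have h3 : (a + b) ^ α = a ^ α * (1 + b / a) ^ α := by
    rw [← Real.mul_rpow ha.le (by positivity)]; congr 1; field_simp
  rw [h3, ← rpow_mul_div_rpow ha hb]
  have h4 : (1 + b / a) ^ α - 1 ≤ 2 ^ α * (b / a) ^ ε :=
    h1.trans (mul_le_mul_of_nonneg_left h2 (by positivity))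
  have := mul_le_mul_of_nonneg_left h4 (Real.rpow_nonneg ha.le α)
  linarith

theorem rpow_sub_max_sub_rpow_le (hα : 0 < α) (hε : 0 < ε) (hε1 : ε ≤ 1)
    (ha : 0 < a) (hd : 0 ≤ d) :
    a ^ α - max (a - d) 0 ^ α ≤ (1 + α) * (a ^ (α - ε) * d ^ ε) := by
  have hy : 0 ≤ d / a := by positivity
  rw [← rpow_mul_div_rpow ha hd]
  rcases le_total d a with h | h
  · have hy1 : d / a ≤ 1 := (div_le_one ha).2 h
    have h1 := one_sub_one_sub_rpow_le hα hy hy1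
    have h2 : d / a ≤ (d / a) ^ ε := by
      simpa using Real.rpow_le_rpow_of_exponent_ge' hy hy1 hε.le hε1
    have h3 : (a - d) ^ α = a ^ α * (1 - d / a) ^ α := by
      rw [← Real.mul_rpow ha.le (by linarith)]; congr 1; field_simp
    rw [max_eq_left (by linarith), h3]
    have h4 : 1 - (1 - d / a) ^ α ≤ (1 + α) * (d / a) ^ ε :=
      h1.trans (mul_le_mul_of_nonneg_left h2 (by positivity))
    have := mul_le_mul_of_nonneg_left h4 (Real.rpow_nonneg ha.le α)
    linarith
  · rw [max_eq_right (by linarith), Real.zero_rpow hα.ne', sub_zero]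
    have h1 : 1 ≤ (d / a) ^ ε := Real.one_le_rpow ((one_le_div ha).2 h) hε.le
    have h2 := Real.rpow_pos_of_pos ha α
    have h3 : a ^ α * 1 ≤ a ^ α * (d / a) ^ ε := mul_le_mul_of_nonneg_left h1 h2.le
    nlinarith

theorem truncPow_max_zero : truncPow α x (max u 0) = truncPow α x u := by
  rw [truncPow, truncPow, max_eq_left (le_max_right u 0)]

theorem abs_truncPow_sub_sub_le (hα : 0 < α) (hε : 0 < ε) (hε1 : ε ≤ 1) (hx : 0 ≤ x)
    (ha : 0 < a) (hd : 0 ≤ d) :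
    |truncPow α x (a - d) - truncPow α x a| ≤ (1 + α) * (a ^ (α - ε) * d ^ ε) := by
  rw [abs_sub_comm, ← truncPow_max_zero (u := a - d)]
  exact (abs_truncPow_sub_le hα.le hx (le_max_right _ _) (max_le (by linarith) ha.le)).trans
    (rpow_sub_max_sub_rpow_le hα hε hε1 ha hd)

theorem abs_truncPow_add_sub_le_of_le (hα : 0 < α) (hε : 0 < ε) (hε1 : ε ≤ 1) (hεα : ε ≤ α)
    (hx : 0 ≤ x) (ha : 0 < a) (hb : 0 < b) (hba : b ≤ a) :
    |truncPow α x (a + b) - truncPow α x a - truncPow α x b| ≤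
      (2 ^ α + 1) * (a ^ (α - ε) * b ^ ε) := by
  have h1 := (abs_truncPow_sub_le hα.le hx ha.le (show a ≤ a + b by linarith)).trans
    (add_rpow_sub_rpow_le hα hε hε1 ha hb.le hba)
  have h2 : truncPow α x b ≤ a ^ (α - ε) * b ^ ε := by
    refine (truncPow_le_rpow hα.le hx).trans ?_
    rw [max_eq_left hb.le]
    calc b ^ α = b ^ (α - ε) * b ^ ε := by rw [← Real.rpow_add hb, sub_add_cancel]
      _ ≤ _ := mul_le_mul_of_nonneg_right (Real.rpow_le_rpow hb.le hba (by linarith))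
        (by positivity)
  have h3 := truncPow_nonneg (α := α) (u := b) hx
  rw [abs_le] at h1 ⊢
  have h4 : 0 ≤ a ^ (α - ε) * b ^ ε := by positivity
  constructor <;> linarith [h1.1, h1.2]

/-- Approximate additivity of the truncated power. -/
theorem abs_truncPow_add_sub_sub_le {A B R K : ℝ} (hα : 0 < α) (hε : 0 < ε) (hε1 : ε ≤ 1)
    (hεα : ε ≤ α) (hx : 0 ≤ x) (hA : 0 ≤ A) (hK : 0 ≤ K) :
    |truncPow α x (A * R + B) - truncPow α x (A * R) - truncPow α x B| ≤
      (2 ^ α + 1 + α) * (A ^ (α - ε) * |B| ^ ε * max R 0 ^ (α - ε) +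
        |B| ^ (α - ε) * A ^ ε * max R 0 ^ ε + |B| ^ (α - ε) * A ^ ε * K ^ ε) +
      truncPow α x B * (Ioi K).indicator 1 (-R) := by
  have h2 : 0 < (2 : ℝ) ^ α := by positivity
  have hR0 : 0 ≤ max R 0 := le_max_right _ _
  have hT0 : 0 ≤ truncPow α x B := truncPow_nonneg hx
  have hI0 : 0 ≤ (Ioi K).indicator (1 : ℝ → ℝ) (-R) := indicator_nonneg (by simp) _
  have t1 : 0 ≤ A ^ (α - ε) * |B| ^ ε * max R 0 ^ (α - ε) := by positivity
  have t2 : 0 ≤ |B| ^ (α - ε) * A ^ ε * max R 0 ^ ε := by positivity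
  have t3 : 0 ≤ |B| ^ (α - ε) * A ^ ε * K ^ ε := by positivity
  have t4 : 0 ≤ truncPow α x B * (Ioi K).indicator (1 : ℝ → ℝ) (-R) := mul_nonneg hT0 hI0
  set C := (2 : ℝ) ^ α + 1 + α with hC
  have hC1 : 2 ^ α + 1 ≤ C := by linarith
  have hC2 : 1 + α ≤ C := by linarith
  have hC0 : 0 ≤ C := by linarith
  have key : ∀ s c : ℝ, 0 ≤ s → c ≤ C →
      |truncPow α x (A * R + B) - truncPow α x (A * R) - truncPow α x B| ≤ c * s →
      s ≤ A ^ (α - ε) * |B| ^ ε * max R 0 ^ (α - ε) +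
        |B| ^ (α - ε) * A ^ ε * max R 0 ^ ε + |B| ^ (α - ε) * A ^ ε * K ^ ε →
      |truncPow α x (A * R + B) - truncPow α x (A * R) - truncPow α x B| ≤
      C * (A ^ (α - ε) * |B| ^ ε * max R 0 ^ (α - ε) +
        |B| ^ (α - ε) * A ^ ε * max R 0 ^ ε + |B| ^ (α - ε) * A ^ ε * K ^ ε) +
      truncPow α x B * (Ioi K).indicator 1 (-R) := by
    intro s c hs hc h h'
    have h5 := mul_le_mul hc h' hs hC0
    linarith
  rcases hA.eq_or_lt with hA' | hA'
  · rw [← hA'] at *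
    rw [zero_mul, zero_add, truncPow_of_nonpos hα hx le_rfl, sub_zero, sub_self, abs_zero]
    positivity
  rcases lt_or_ge 0 R with hR | hR
  · have ha : 0 < A * R := mul_pos hA' hR
    have e1 : (A * R) ^ (α - ε) * |B| ^ ε = A ^ (α - ε) * |B| ^ ε * max R 0 ^ (α - ε) := by
      rw [Real.mul_rpow hA hR.le, max_eq_left hR.le]; ring
    have e2 : |B| ^ (α - ε) * (A * R) ^ ε = |B| ^ (α - ε) * A ^ ε * max R 0 ^ ε := by
      rw [Real.mul_rpow hA hR.le, max_eq_left hR.le]; ring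
    rcases lt_or_ge 0 B with hB | hB
    · rcases le_total B (A * R) with h | h
      · have h6 := abs_truncPow_add_sub_le_of_le hα hε hε1 hεα hx ha hB h
        refine key _ _ t1 hC1 (h6.trans_eq ?_) (by linarith)
        rw [← e1, abs_of_pos hB]
      · have h6 := abs_truncPow_add_sub_le_of_le hα hε hε1 hεα hx hB ha h
        rw [add_comm B, sub_right_comm] at h6
        refine key _ _ t2 hC1 (h6.trans_eq ?_) (by linarith)
        rw [← e2, abs_of_pos hB]
    · have h6 := abs_truncPow_sub_sub_le hα hε hε1 hx ha (neg_nonneg.2 hB)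
      rw [sub_neg_eq_add] at h6
      refine key _ _ t1 hC2 ?_ (by linarith)
      rw [truncPow_of_nonpos hα hx hB, sub_zero, ← e1, abs_of_nonpos hB]
      exact h6
  · have ha : A * R ≤ 0 := mul_nonpos_of_nonneg_of_nonpos hA hR
    rw [truncPow_of_nonpos hα hx ha, sub_zero] at *
    rcases lt_or_ge 0 B with hB | hB
    · rcases lt_or_ge K (-R) with h | h
      · rw [indicator_of_mem (mem_Ioi.2 h), Pi.one_apply, mul_one]
        have h7 : truncPow α x (A * R + B) ≤ truncPow α x B :=
          truncPow_mono hα.le hx le_rfl (by linarith)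
        have h8 : 0 ≤ truncPow α x (A * R + B) := truncPow_nonneg hx
        rw [abs_of_nonpos (by linarith)]
        have : 0 ≤ C * (A ^ (α - ε) * |B| ^ ε * max R 0 ^ (α - ε) +
          |B| ^ (α - ε) * A ^ ε * max R 0 ^ ε + |B| ^ (α - ε) * A ^ ε * K ^ ε) := by positivity
        linarith
      · have h6 := abs_truncPow_sub_sub_le hα hε hε1 hx hB (neg_nonneg.2 ha)
        rw [sub_neg_eq_add, add_comm B] at h6
        refine key _ _ t3 hC2 (h6.trans ?_) (by linarith)
        refine mul_le_mul_of_nonneg_left ?_ (by linarith)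
        rw [abs_of_pos hB, mul_assoc, ← Real.mul_rpow hA hK]
        refine mul_le_mul_of_nonneg_left (Real.rpow_le_rpow (neg_nonneg.2 ha) ?_ hε.le)
          (by positivity)
        nlinarith
    · rw [truncPow_of_nonpos hα hx hB, truncPow_of_nonpos hα hx (by linarith), sub_zero, abs_zero]
      rw [truncPow_of_nonpos hα hx hB] at t4
      positivity

theorem rpow_mul_rpow_le_add {A B : ℝ} (hε : 0 < ε) (hεα : ε < α / 2) (hA : 0 ≤ A) (hB : 0 ≤ B) :
    A ^ (α - ε) * B ^ ε ≤ A ^ α + B ^ (α - ε) * A ^ ε := by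
  rcases hA.eq_or_lt with h | h
  · rw [← h, Real.zero_rpow (by linarith : α - ε ≠ 0), zero_mul]; positivity
  rcases le_total B A with h1 | h1
  · have : A ^ (α - ε) * B ^ ε ≤ A ^ (α - ε) * A ^ ε := by gcongr
    rw [← Real.rpow_add h, sub_add_cancel] at this
    have : 0 ≤ B ^ (α - ε) * A ^ ε := by positivity
    linarith
  · have hB' : 0 < B := h.trans_le h1
    have : A ^ (α - ε) * B ^ ε ≤ B ^ (α - ε) * A ^ ε := by
      calc A ^ (α - ε) * B ^ ε = A ^ (α - 2 * ε) * (A ^ ε * B ^ ε) := by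
            rw [← mul_assoc, ← Real.rpow_add h]; ring_nf
        _ ≤ B ^ (α - 2 * ε) * (A ^ ε * B ^ ε) := by
            gcongr; linarith
        _ = B ^ (α - ε) * A ^ ε := by
            rw [mul_comm (A ^ ε), ← mul_assoc, ← Real.rpow_add hB']; ring_nf
    have : 0 ≤ A ^ α := by positivity
    linarith

end Increments

section Inhomogeneity

variable {Ω : Type*} [MeasurableSpace Ω] {μ : Measure Ω} [IsProbabilityMeasure μ]
  {A B R : Ω → ℝ} {α ε : ℝ}

theorem abs_integral_truncPow_sub_sub_le (hA : Measurable A) (hB : Measurable B)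
    (hR : Measurable R) (hA0 : ∀ ω, 0 ≤ A ω)
    (hindep : IndepFun (fun ω => (A ω, B ω)) R μ) (hε : 0 < ε) (hε1 : ε ≤ 1 / 2)
    (hεα : ε < α / 2) (hAα : Integrable (fun ω => A ω ^ α) μ)
    (hAB : Integrable (fun ω => |B ω| ^ (α - ε) * A ω ^ ε) μ)
    (hRβ : Integrable (fun ω => max (R ω) 0 ^ (α - ε)) μ) {K : ℝ} (hK : 0 ≤ K) :
    ∃ M, ∀ x > 0, |truncMoment μ (fun ω => A ω * R ω + B ω) α x -
        truncMoment μ (fun ω => A ω * R ω) α x - truncMoment μ B α x| ≤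
      M + truncMoment μ B α x * (μ {ω | K < -R ω}).toReal := by
  have hα : 0 < α := by linarith
  have hRε : Integrable (fun ω => max (R ω) 0 ^ ε) μ :=
    integrable_rpow_of_le (by fun_prop) (fun ω => le_max_right _ _) hRβ hε.le (by linarith)
  have hAB' : Integrable (fun ω => A ω ^ (α - ε) * |B ω| ^ ε) μ := by
    refine Integrable.mono' (hAα.add hAB) (by fun_prop) (ae_of_all _ fun ω => ?_)
    rw [Real.norm_of_nonneg (mul_nonneg (Real.rpow_nonneg (hA0 ω) _) (by positivity))]
    exact rpow_mul_rpow_le_add hε hεα (hA0 ω) (abs_nonneg _)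
  have hi1 : Integrable (fun ω => A ω ^ (α - ε) * |B ω| ^ ε * max (R ω) 0 ^ (α - ε)) μ := by
    have hind := hindep.comp (φ := fun p : ℝ × ℝ => p.1 ^ (α - ε) * |p.2| ^ ε)
      (ψ := fun r : ℝ => max r 0 ^ (α - ε)) (by fun_prop) (by fun_prop)
    exact hind.integrable_mul hAB' hRβ
  have hi2 : Integrable (fun ω => |B ω| ^ (α - ε) * A ω ^ ε * max (R ω) 0 ^ ε) μ := by
    have hind := hindep.comp (φ := fun p : ℝ × ℝ => |p.2| ^ (α - ε) * p.1 ^ ε)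
      (ψ := fun r : ℝ => max r 0 ^ ε) (by fun_prop) (by fun_prop)
    exact hind.integrable_mul hAB hRε
  have hi3 : Integrable (fun ω => |B ω| ^ (α - ε) * A ω ^ ε * K ^ ε) μ := hAB.mul_const _
  set g : Ω → ℝ := fun ω => (2 ^ α + 1 + α) * (A ω ^ (α - ε) * |B ω| ^ ε * max (R ω) 0 ^ (α - ε) +
    |B ω| ^ (α - ε) * A ω ^ ε * max (R ω) 0 ^ ε + |B ω| ^ (α - ε) * A ω ^ ε * K ^ ε) with hg
  have hgi : Integrable g μ := ((hi1.add hi2).add hi3).const_mul _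
  refine ⟨∫ ω, g ω ∂μ, fun x hx => ?_⟩
  have hm : Measurable fun r : ℝ => (Ioi K).indicator (1 : ℝ → ℝ) (-r) :=
    (measurable_one.indicator measurableSet_Ioi).comp measurable_neg
  have hBR : IndepFun (fun ω => truncPow α x (B ω))
      (fun ω => (Ioi K).indicator (1 : ℝ → ℝ) (-R ω)) μ :=
    hindep.comp (φ := fun p : ℝ × ℝ => truncPow α x p.2)
      (ψ := fun r : ℝ => (Ioi K).indicator (1 : ℝ → ℝ) (-r))
      (measurable_truncPow.comp measurable_snd) hm
  have hBi := integrable_truncPow (μ := μ) hB hα.le hx.le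
  have hIi : Integrable (fun ω => (Ioi K).indicator (1 : ℝ → ℝ) (-R ω)) μ := by
    simpa using integrable_const_mul_indicator_Ioi (μ := μ) (x := K) hR.neg 1
  have hI : ∫ ω, (Ioi K).indicator (1 : ℝ → ℝ) (-R ω) ∂μ = (μ {ω | K < -R ω}).toReal := by
    simpa using integral_const_mul_indicator_Ioi (μ := μ) (x := K) hR.neg 1
  have hprod : ∫ ω, truncPow α x (B ω) * (Ioi K).indicator (1 : ℝ → ℝ) (-R ω) ∂μ =
      truncMoment μ B α x * (μ {ω | K < -R ω}).toReal := by
    rw [← hI, truncMoment]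
    exact hBR.integral_mul_eq_mul_integral hBi.1 hIi.1
  have hprodi : Integrable
      (fun ω => truncPow α x (B ω) * (Ioi K).indicator (1 : ℝ → ℝ) (-R ω)) μ :=
    hBR.integrable_mul hBi hIi
  have hARi : Integrable (fun ω => truncPow α x (A ω * R ω)) μ :=
    integrable_truncPow (hA.mul hR) hα.le hx.le
  have hARBi : Integrable (fun ω => truncPow α x (A ω * R ω + B ω)) μ :=
    integrable_truncPow ((hA.mul hR).add hB) hα.le hx.le
  have hd : Integrable (fun ω => truncPow α x (A ω * R ω + B ω) - truncPow α x (A ω * R ω)) μ :=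
    hARBi.sub hARi
  unfold truncMoment at hprod ⊢
  rw [← integral_sub hARBi hARi, ← integral_sub hd hBi, ← hprod, ← integral_add hgi hprodi]
  refine abs_integral_le_integral_abs.trans (integral_mono (hd.sub hBi).abs (hgi.add hprodi)
    fun ω => ?_)
  exact abs_truncPow_add_sub_sub_le hα hε (by linarith) (by linarith) hx.le (hA0 ω) hK

theorem tendsto_inhomogeneity_div (hA : Measurable A) (hB : Measurable B)
    (hR : Measurable R) (hA0 : ∀ ω, 0 ≤ A ω)
    (hindep : IndepFun (fun ω => (A ω, B ω)) R μ) (hε : 0 < ε) (hε1 : ε ≤ 1 / 2)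
    (hεα : ε < α / 2) (hAα : Integrable (fun ω => A ω ^ α) μ)
    (hAB : Integrable (fun ω => |B ω| ^ (α - ε) * A ω ^ ε) μ)
    (hRβ : Integrable (fun ω => max (R ω) 0 ^ (α - ε)) μ)
    (hBinf : ¬ Integrable (fun ω => max (B ω) 0 ^ α) μ) :
    Tendsto (fun x => (truncMoment μ (fun ω => A ω * R ω + B ω) α x / α -
      truncMoment μ (fun ω => A ω * R ω) α x / α) / (1 + truncMoment μ B α x / α))
      atTop (𝓝 1) := by
  have hα : 0 < α := by linarith
  have hV := tendsto_truncMoment_atTop (μ := μ) hB hα.le hBinf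
  rw [Metric.tendsto_nhds]
  intro η hη
  obtain ⟨K, hKlt⟩ := ((tendsto_measure_natCast_lt (μ := μ) hR.neg).eventually
    (gt_mem_nhds (half_pos hη))).exists
  obtain ⟨M, hM⟩ := abs_integral_truncPow_sub_sub_le hA hB hR hA0 hindep hε hε1 hεα hAα hAB hRβ
    (K := K) K.cast_nonneg
  filter_upwards [eventually_gt_atTop 0, hV.eventually_gt_atTop ((M + α) / (η / 2))]
    with x hx hVx
  have hV0 : 0 ≤ truncMoment μ B α x := truncMoment_nonneg hx.le
  have hD : 0 < α + truncMoment μ B α x := by linarith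
  have h1 := hM x hx
  rw [div_lt_iff₀ (half_pos hη)] at hVx
  have h2 : truncMoment μ B α x * (μ {ω | (K : ℝ) < -R ω}).toReal ≤
      truncMoment μ B α x * (η / 2) := mul_le_mul_of_nonneg_left hKlt.le hV0
  have e : (truncMoment μ (fun ω => A ω * R ω + B ω) α x / α -
      truncMoment μ (fun ω => A ω * R ω) α x / α) / (1 + truncMoment μ B α x / α) - 1 =
      ((truncMoment μ (fun ω => A ω * R ω + B ω) α x -
        truncMoment μ (fun ω => A ω * R ω) α x - truncMoment μ B α x) - α) /
        (α + truncMoment μ B α x) := by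
    have : 1 + truncMoment μ B α x / α ≠ 0 := by positivity
    field_simp
    ring
  rw [Real.dist_eq, e, abs_div, abs_of_pos hD, div_lt_iff₀ hD]
  have h3 := abs_sub (truncMoment μ (fun ω => A ω * R ω + B ω) α x -
        truncMoment μ (fun ω => A ω * R ω) α x - truncMoment μ B α x) α
  rw [abs_of_pos hα] at h3
  nlinarith

/-- The truncated moments of a solution of `R =_d A R + B` fit the renewal setting. -/
theorem renewalSetting (hA : Measurable A) (hB : Measurable B)
    (hR : Measurable R) (hA0 : ∀ ω, 0 ≤ A ω)
    (hindep : IndepFun (fun ω => (A ω, B ω)) R μ)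
    (hfix : μ.map R = μ.map fun ω => A ω * R ω + B ω)
    (hlogneg : ∫ ω, Real.log (A ω) ∂μ < 0)
    (hone : ∫ ω, A ω ^ α ∂μ = 1)
    (hlog : Integrable (fun ω => A ω ^ α * Real.log (A ω)) μ)
    (hna : ¬ ∃ d : ℝ, ∀ᵐ ω ∂μ, 0 < A ω → ∃ k : ℤ, Real.log (A ω) = d * k)
    (hpos : ∀ x > 0, 0 < normalizedTail μ B α x)
    (hslow : ∀ l : ℝ, 0 < l →
      Tendsto (fun x => normalizedTail μ B α (l * x) / normalizedTail μ B α x) atTop (𝓝 1))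
    (hBinf : ¬ Integrable (fun ω => max (B ω) 0 ^ α) μ)
    (hε : 0 < ε) (hε1 : ε ≤ 1 / 2) (hεα : ε < α / 2)
    (hAB : Integrable (fun ω => |B ω| ^ (α - ε) * A ω ^ ε) μ) :
    RenewalSetting (tiltedLogLaw μ A α) α ε (fun t => normalizedTail μ R α (Real.exp t))
      (fun t => truncMoment μ R α (Real.exp t) / α)
      (fun t => truncMoment μ (fun ω => A ω * R ω + B ω) α (Real.exp t) / α -
        truncMoment μ (fun ω => A ω * R ω) α (Real.exp t) / α)
      (fun t => 1 + truncMoment μ B α (Real.exp t) / α) := by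
  have hα : 0 < α := by linarith
  have hβ : 0 < α - ε := by linarith
  have hAα : Integrable (fun ω => A ω ^ α) μ := by
    by_contra h
    rw [integral_undef h] at hone
    exact zero_ne_one hone
  have hA1 : ¬ ∀ᵐ ω ∂μ, A ω = 1 := fun h => hna ⟨0, by
    filter_upwards [h] with ω hω _
    exact ⟨0, by simp [hω]⟩⟩
  have hAR : IndepFun A R μ := hindep.comp measurable_fst measurable_id
  have hAint : ∀ γ, 0 < γ → γ ≤ α - ε → Integrable (fun ω => A ω ^ γ) μ := fun γ h h' =>
    integrable_rpow_of_le hA hA0 hAα h.le (by linarith)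
  have hAlt : ∀ γ, 0 < γ → γ ≤ α - ε → ∫ ω, A ω ^ γ ∂μ < 1 := fun γ h h' =>
    integral_rpow_lt_one hA hA0 hAα hone hA1 h (by linarith)
  have hRβ : Integrable (fun ω => max (R ω) 0 ^ (α - ε)) μ :=
    integrable_rpow_solution hA hB hR hA0 hAR hfix hβ
      (integrable_rpow_of_slow_tail hB hβ (by linarith) hpos (hslow 2 two_pos)) hAint hAlt
  have hexp : ∀ t h : ℝ, Real.exp (t + h) ^ α = Real.exp (α * h) * Real.exp t ^ α := fun t h => by
    rw [← Real.exp_mul, ← Real.exp_mul, ← Real.exp_add]; congr 1; ring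
  have hJm : Measurable fun t => truncMoment μ R α (Real.exp t) / α := by
    refine Monotone.measurable fun s t hst => ?_
    exact div_le_div_of_nonneg_right
      (truncMoment_mono hR hα.le (Real.exp_pos s).le (Real.exp_le_exp.2 hst)) hα.le
  have hJtilt : ∀ t ω, A ω ^ α * (truncMoment μ R α (Real.exp (t - Real.log (A ω))) / α) =
      A ω ^ α * truncMoment μ R α (Real.exp t / A ω) / α := by
    intro t ω
    rcases (hA0 ω).eq_or_lt with h | h
    · rw [← h, Real.zero_rpow hα.ne', zero_mul, zero_mul, zero_div]
    · rw [Real.exp_sub, Real.exp_log h, mul_div_assoc]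
  have hprob := isProbabilityMeasure_tiltedLogLaw hA hA0 hAα hone
  exact
  { prob := hprob
    α_pos := hα
    δ_pos := hε
    mean_int := (integrable_tiltedLogLaw hA hA0 measurable_id).2 hlog
    mean_pos := by
      rw [integral_tiltedLogLaw (g := fun z => z) hA hA0 measurable_id]
      exact integral_rpow_mul_log_pos hA0 hα hAα hone hlog hA1
    exp_α_int := by
      rw [integrable_tiltedLogLaw hA hA0 (by fun_prop)]
      refine Integrable.mono' (integrable_const 1) (by fun_prop) (ae_of_all _ fun ω => ?_)
      rw [Real.norm_of_nonneg (mul_nonneg (Real.rpow_nonneg (hA0 ω) _) (Real.exp_pos _).le)]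
      rcases (hA0 ω).eq_or_lt with h | h
      · rw [← h, Real.zero_rpow hα.ne', zero_mul]; exact zero_le_one
      · rw [Real.rpow_def_of_pos h, ← Real.exp_add]
        exact le_of_eq (by rw [mul_comm, add_neg_cancel, Real.exp_zero])
    exp_δ_int := by
      rw [integrable_tiltedLogLaw hA hA0 (by fun_prop)]
      simp_rw [exp_neg_mul_log_mul_rpow (hA0 _) hα (show ε < α by linarith)]
      exact hAint _ hβ le_rfl
    exp_δ_lt := by
      rw [integral_tiltedLogLaw hA hA0 (by fun_prop)]
      simp_rw [exp_neg_mul_log_mul_rpow (hA0 _) hα (show ε < α by linarith)]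
      exact hAlt _ hβ le_rfl
    dense := tiltedLogLaw_dense hA hA0 hα hAα hone hlogneg hna hA1
    f_nonneg := fun t => normalizedTail_nonneg (Real.exp_pos t).le
    f_le := by
      refine ⟨max 1 (∫ ω, max (R ω) 0 ^ (α - ε) ∂μ), fun t => ?_⟩
      have hP1 : (μ {ω | Real.exp t < R ω}).toReal ≤ 1 := measureReal_le_one
      rcases le_total t 0 with h | h
      · rw [max_eq_right h, mul_zero, Real.exp_zero, mul_one]
        refine le_trans ?_ (le_max_left _ _)
        exact mul_le_one₀ (Real.rpow_le_one (Real.exp_pos t).le (Real.exp_le_one_iff.2 h) hα.le)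
          ENNReal.toReal_nonneg hP1
      · rw [max_eq_left h]
        have hm := rpow_mul_tail_le (μ := μ) hR hβ (Real.exp_pos t).le hRβ
        have e : normalizedTail μ R α (Real.exp t) =
            Real.exp t ^ (α - ε) * (μ {ω | Real.exp t < R ω}).toReal * Real.exp (ε * t) := by
          rw [normalizedTail, ← Real.exp_mul, ← Real.exp_mul, mul_right_comm, ← Real.exp_add]
          congr 2; ring
        rw [e]
        exact mul_le_mul_of_nonneg_right (hm.trans (le_max_right _ _)) (Real.exp_pos _).le
    J_nonneg := fun t => div_nonneg (truncMoment_nonneg (Real.exp_pos t).le) hα.le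
    J_mono := fun s t hst => div_le_div_of_nonneg_right
      (truncMoment_mono hR hα.le (Real.exp_pos s).le (Real.exp_le_exp.2 hst)) hα.le
    J_upper := fun t h hh => by
      have h1 := truncMoment_sub_le (μ := μ) hR hα (Real.exp_pos t).le
        (Real.exp_le_exp.2 (show t ≤ t + h by linarith))
      rw [hexp] at h1
      rw [← sub_div, div_mul_eq_mul_div]
      refine div_le_div_of_nonneg_right (h1.trans_eq ?_) hα.le
      rw [normalizedTail]; ring
    J_lower := fun t h hh => by
      have h1 := le_truncMoment_sub (μ := μ) hR hα (Real.exp_pos t).le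
        (Real.exp_le_exp.2 (show t ≤ t + h by linarith))
      rw [hexp] at h1
      rw [← sub_div, div_mul_eq_mul_div, div_mul_eq_mul_div]
      refine div_le_div_of_nonneg_right (le_trans (le_of_eq ?_) h1) hα.le
      rw [normalizedTail, hexp, Real.exp_neg]
      have := (Real.exp_pos (α * h)).ne'
      field_simp
    J_scale := fun t h s hh hs => by
      have h1 := truncMoment_sub_scale (μ := μ) hR hα (Real.exp_pos t).le
        (Real.exp_le_exp.2 (show t ≤ t + h by linarith)) (Real.one_le_exp hs)
      rw [← Real.exp_add, ← Real.exp_add, ← Real.exp_mul] at h1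
      rw [← sub_div, ← sub_div, ← mul_div_assoc]
      refine div_le_div_of_nonneg_right (le_trans (le_of_eq ?_) (h1.trans_eq ?_)) hα.le
      · congr 3 <;> ring
      · rw [mul_comm s]
    J_int := fun t => by
      rw [integrable_tiltedLogLaw (g := fun z => truncMoment μ R α (Real.exp (t - z)) / α) hA hA0
        (hJm.comp (measurable_const.sub measurable_id))]
      simp_rw [hJtilt]
      exact (integrable_rpow_mul_truncMoment hA hR hA0 hα (Real.exp_pos t).le).div_const α
    J_eq := fun t => by
      rw [integral_tiltedLogLaw (g := fun z => truncMoment μ R α (Real.exp (t - z)) / α) hA hA0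
        (hJm.comp (measurable_const.sub measurable_id))]
      simp_rw [hJtilt]
      rw [integral_div, ← integral_truncPow_mul hA hR hA0 hAR hα (Real.exp_pos t).le,
        truncMoment_eq_of_map_eq hR ((hA.mul hR).add hB) hfix]
      exact (add_sub_cancel _ _).symm
    Λ_one := fun t => le_add_of_nonneg_right
      (div_nonneg (truncMoment_nonneg (Real.exp_pos t).le) hα.le)
    Λ_mono := fun s t hst => add_le_add_right (div_le_div_of_nonneg_right
      (truncMoment_mono hB hα.le (Real.exp_pos s).le (Real.exp_le_exp.2 hst)) hα.le) 1
    Λ_slow := tendsto_one_add_truncMoment_div hB hα hpos hslow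
    G_equiv := (tendsto_inhomogeneity_div hA hB hR hA0 hindep hε hε1 hεα hAα hAB hRβ hBinf).comp
      Real.tendsto_exp_atTop }

end Inhomogeneity

/-- The tail asymptotics when `A` is non-negative everywhere. -/
theorem tendsto_normalizedTail_div {Ω : Type*} [MeasurableSpace Ω] {μ : Measure Ω}
    [IsProbabilityMeasure μ] {A B R : Ω → ℝ} {α ε : ℝ} (hA : Measurable A) (hB : Measurable B)
    (hR : Measurable R) (hA0 : ∀ ω, 0 ≤ A ω)
    (hindep : IndepFun (fun ω => (A ω, B ω)) R μ)
    (hfix : μ.map R = μ.map fun ω => A ω * R ω + B ω)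
    (hlogneg : ∫ ω, Real.log (A ω) ∂μ < 0)
    (hone : ∫ ω, A ω ^ α ∂μ = 1)
    (hlog : Integrable (fun ω => A ω ^ α * Real.log (A ω)) μ)
    (hna : ¬ ∃ d : ℝ, ∀ᵐ ω ∂μ, 0 < A ω → ∃ k : ℤ, Real.log (A ω) = d * k)
    (hpos : ∀ x > 0, 0 < normalizedTail μ B α x)
    (hslow : ∀ l : ℝ, 0 < l →
      Tendsto (fun x => normalizedTail μ B α (l * x) / normalizedTail μ B α x) atTop (𝓝 1))
    (hBinf : ¬ Integrable (fun ω => max (B ω) 0 ^ α) μ)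
    (hε : 0 < ε) (hε1 : ε ≤ 1 / 2) (hεα : ε < α / 2)
    (hAB : Integrable (fun ω => |B ω| ^ (α - ε) * A ω ^ ε) μ) :
    Tendsto (fun x => normalizedTail μ R α x /
      ((∫ t in Ioc 0 x, normalizedTail μ B α t / t) / ∫ ω, A ω ^ α * Real.log (A ω) ∂μ))
      atTop (𝓝 1) := by
  have hα : 0 < α := by linarith
  have S := renewalSetting hA hB hR hA0 hindep hfix hlogneg hone hlog hna hpos hslow hBinf hε hε1
    hεα hAB
  have hlim := S.tendsto_f_div
  have hρ := S.mean_pos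
  rw [integral_tiltedLogLaw (g := fun z => z) hA hA0 measurable_id] at hlim hρ
  set ρ := ∫ ω, A ω ^ α * Real.log (A ω) ∂μ
  have hW : Tendsto (fun x => truncMoment μ B α x / α) atTop atTop :=
    (tendsto_truncMoment_atTop hB hα.le hBinf).atTop_div_const hα
  have hratio : Tendsto (fun x => (truncMoment μ B α x / α)⁻¹ + 1) atTop (𝓝 1) := by
    simpa using hW.inv_tendsto_atTop.add_const 1
  have hprod := ((hlim.comp Real.tendsto_log_atTop).mul_const ρ).mul hratio
  rw [one_div, inv_mul_cancel₀ hρ.ne', one_mul] at hprod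
  refine hprod.congr' ?_
  filter_upwards [eventually_gt_atTop 0, hW.eventually_gt_atTop 0] with x hx hWx
  have hint : ∫ t in Ioc 0 x, normalizedTail μ B α t / t = truncMoment μ B α x / α :=
    integral_Ioc_eq_truncMoment hB hα hx.le
  simp only [Function.comp_apply, Real.exp_log hx, hint]
  generalize truncMoment μ B α x / α = W at hWx
  field_simp

/-- First order tail asymptotics of the perpetuity: if `R =_d AR + B` with
`R` independent of `(A,B)`, under (A-1)–(A-3), (B-1)–(B-2) and
`E[|B|^{α−ε} A^ε] < ∞` for some `0 < ε ≤ 1/2`, `ε < α/2`, then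
`x^α P(R > x) ∼ L̃(x)/ρ` as `x → ∞`, where `ρ = E[A^α log A]`. -/
theorem perpetuity_tail_first_order
    {Ω : Type*} [MeasurableSpace Ω] (μ : Measure Ω) [IsProbabilityMeasure μ]
    (A B R : Ω → ℝ)
    (hAmeas : Measurable A) (hBmeas : Measurable B) (hRmeas : Measurable R)
    -- R is independent of (A,B) and solves R =_d A·R + B
    (hindep : IndepFun (fun ω => (A ω, B ω)) R μ)
    (hfix : Measure.map R μ = Measure.map (fun ω => A ω * R ω + B ω) μ)
    -- (A-1)
    (hApos : ∀ᵐ ω ∂μ, 0 ≤ A ω)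
    (hlogAint : Integrable (fun ω => Real.log (A ω)) μ)
    (hlogAneg : (∫ ω, Real.log (A ω) ∂μ) < 0)
    -- (A-2)
    (α : ℝ) (hα : 0 < α)
    (hAα : (∫ ω, A ω ^ α ∂μ) = 1)
    (hρint : Integrable (fun ω => A ω ^ α * Real.log (A ω)) μ)
    -- (A-3): the law of log A given A > 0 is non-arithmetic
    (hna : ¬ ∃ d : ℝ, ∀ᵐ ω ∂μ, 0 < A ω → ∃ k : ℤ, Real.log (A ω) = d * k)
    -- (B-1)
    (L : ℝ → ℝ) (hLdef : ∀ x, L x = x ^ α * (μ {ω | x < B ω}).toReal)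
    (hL : SlowlyVarying L)
    -- (B-2)
    (hBinf : ¬ Integrable (fun ω => max (B ω) 0 ^ α) μ)
    -- moment condition
    (ε : ℝ) (hε0 : 0 < ε) (hε1 : ε ≤ 1/2) (hε2 : ε < α/2)
    (hAB : Integrable (fun ω => |B ω| ^ (α - ε) * A ω ^ ε) μ) :
    Filter.Tendsto
      (fun x => (x ^ α * (μ {ω | x < R ω}).toReal) /
        ((∫ t in Set.Ioc (0:ℝ) x, L t / t) / (∫ ω, A ω ^ α * Real.log (A ω) ∂μ)))
      atTop (nhds 1) := by
  obtain rfl : L = normalizedTail μ B α := funext hLdef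
  have hae : A =ᵐ[μ] fun ω => max (A ω) 0 := hApos.mono fun ω hω => (max_eq_left hω).symm
  have hρ : (fun ω => A ω ^ α * Real.log (A ω)) =ᵐ[μ]
      fun ω => max (A ω) 0 ^ α * Real.log (max (A ω) 0) :=
    hae.fun_comp fun a => a ^ α * Real.log a
  rw [integral_congr_ae hρ]
  refine tendsto_normalizedTail_div (hAmeas.max measurable_const) hBmeas hRmeas
    (fun ω => le_max_right _ _) (hindep.congr ?_ .rfl) ?_ ?_ ?_ (hρint.congr hρ) ?_ hL.1 hL.2 hBinf
    hε0 hε1 hε2 (hAB.congr ?_)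
  · filter_upwards [hae] with ω hω
    rw [← hω]
  · rw [hfix]
    refine Measure.map_congr ?_
    filter_upwards [hae] with ω hω
    rw [← hω]
  · exact (integral_congr_ae (hae.fun_comp Real.log)).symm.trans_lt hlogAneg
  · exact (integral_congr_ae (hae.fun_comp fun a => a ^ α)).symm.trans hAα
  · rintro ⟨d, hd⟩
    refine hna ⟨d, ?_⟩
    filter_upwards [hd, hae] with ω hdω hω
    rwa [← hω] at hdω
  · filter_upwards [hae] with ω hω
    rw [← hω]
end
end

section
/- Let A, B, R be real random variables with (A,B) independent of R. Suppose 0 < ε < α/2, ε ≤ 1/2, E[|A|^α] < ∞, E[|B|^{α−ε} |A|^{ε}] < ∞, and E[|R|^β] < ∞ for every β < α. Then for every g ∈ H^ε with 0 ∉ supp g, the function ψ₀(x) = e^{αx} E[g(e^{-x}(AR+B)) − g(e^{-x}AR) − g(e^{-x}B)] is directly Riemann integrable on ℝ. -/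
open MeasureTheory ProbabilityTheory Filter Set

noncomputable section

/-- `g` belongs to the Hölder class `H^ε`: `g` is bounded and
`sup_{x≠y} |g(x) − g(y)|/|x−y|^{2ε} < ∞`. -/
def MemHolderClass (ε : ℝ) (g : ℝ → ℝ) : Prop :=
  (∃ M, ∀ x, |g x| ≤ M) ∧ ∃ K, ∀ x y : ℝ, |g x - g y| ≤ K * |x - y| ^ (2 * ε)

/-- Direct Riemann integrability of a (signed) function `f : ℝ → ℝ`: for every `h > 0` the
sums `Σ_{n∈ℤ} sup_{(n−1)h ≤ y < nh} |f(y)|` converge, and the Riemann-type upper and lower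
sums of `f` on the mesh of size `h` differ by `o(1/h)` as `h → 0⁺`. -/
def DirectlyRiemannIntegrable (f : ℝ → ℝ) : Prop :=
  (∀ h > (0:ℝ), Summable fun n : ℤ =>
      sSup ((fun y => |f y|) '' Set.Ico (((n : ℝ) - 1) * h) ((n : ℝ) * h))) ∧
  Filter.Tendsto
    (fun h : ℝ => h *
      ((∑' n : ℤ, sSup (f '' Set.Ico (((n : ℝ) - 1) * h) ((n : ℝ) * h))) -
        ∑' n : ℤ, sInf (f '' Set.Ico (((n : ℝ) - 1) * h) ((n : ℝ) * h))))
    (nhdsWithin 0 (Set.Ioi 0)) (nhds 0)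

/-- If a step function with constant mesh `h` is integrable, its integral is the corresponding
Riemann sum. -/
theorem hasSum_of_integrable_floor_div {p : ℤ → ℝ} {h : ℝ} (hh : 0 < h)
    (hp : Integrable fun x : ℝ => p (⌊x / h⌋ + 1)) :
    HasSum (fun n => h * p n) (∫ x : ℝ, p (⌊x / h⌋ + 1)) := by
  have hp' : Integrable fun x : ℝ => p (⌊x⌋ + 1) :=
    (integrable_comp_div_iff (fun x : ℝ => p (⌊x⌋ + 1)) hh.ne').1 hp
  have hsum := hp'.hasSum_intervalIntegral_comp_add_int
  have hcell (n : ℤ) : ∫ x in (0 : ℝ)..1, p (⌊x + n⌋ + 1) = p (n + 1) := by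
    rw [intervalIntegral.integral_congr_Ioo_of_le (g := fun _ => p (n + 1)) zero_le_one]
    · simp
    · intro x hx
      have hfloor : ⌊x⌋ = 0 := Int.floor_eq_zero_iff.2 ⟨hx.1.le, hx.2⟩
      simp [hfloor]
  simp only [hcell] at hsum
  have hscale : ∫ x : ℝ, p (⌊x / h⌋ + 1) = h * ∫ x : ℝ, p (⌊x⌋ + 1) := by
    rw [Measure.integral_comp_div (fun x : ℝ => p (⌊x⌋ + 1)) h, abs_of_pos hh, smul_eq_mul]
  rw [hscale]
  exact ((Equiv.addRight (1 : ℤ)).hasSum_iff (f := p)).1 hsum |>.mul_left h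

/-- A continuous function dominated by an integrable function of controlled growth is directly
Riemann integrable. -/
theorem DirectlyRiemannIntegrable.of_continuous_of_le {f b : ℝ → ℝ} {c : ℝ} (hc : 0 ≤ c)
    (hf : Continuous f) (hb : Integrable b) (hfb : ∀ x, |f x| ≤ b x)
    (hgrowth : ∀ x y, x ≤ y → b y ≤ Real.exp (c * (y - x)) * b x) :
    DirectlyRiemannIntegrable f := by
  have hb0 (x : ℝ) : 0 ≤ b x := (abs_nonneg _).trans (hfb x)
  let cell (h : ℝ) (n : ℤ) : Set ℝ := Ico (((n : ℝ) - 1) * h) ((n : ℝ) * h)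
  have hmem {h : ℝ} (hh : 0 < h) (x : ℝ) : x ∈ cell h (⌊x / h⌋ + 1) := by
    have h₁ := (le_div_iff₀ hh).1 (Int.floor_le (x / h))
    have h₂ := (div_lt_iff₀ hh).1 (Int.lt_floor_add_one (x / h))
    simpa [cell] using And.intro h₁ h₂
  have hdist {h x y : ℝ} {n : ℤ} (hx : x ∈ cell h n) (hy : y ∈ cell h n) : |y - x| ≤ h := by
    simp only [cell, mem_Ico, sub_mul] at hx hy
    rw [abs_le]
    constructor <;> linarith [hx.1, hx.2, hy.1, hy.2]
  have hbound {h H x y : ℝ} {n : ℤ} (hH : h ≤ H) (hx : x ∈ cell h n) (hy : y ∈ cell h n) :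
      |f y| ≤ Real.exp (c * (2 * H)) * b (x - H) := by
    have hxy := abs_le.1 (hdist hx hy)
    refine (hfb y).trans ((hgrowth (x - H) y (by linarith)).trans ?_)
    gcongr
    · exact hb0 _
    · linarith
  have hstep (q : Set ℝ → ℝ)
      (hq : ∀ h > 0, ∀ x, ∀ C, (∀ y ∈ cell h (⌊x / h⌋ + 1), |f y| ≤ C) →
        |q (cell h (⌊x / h⌋ + 1))| ≤ C) {h : ℝ} (hh : 0 < h) :
      Integrable fun x : ℝ => q (cell h (⌊x / h⌋ + 1)) := by
    refine ((hb.comp_sub_right h).const_mul (Real.exp (c * (2 * h)))).mono'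
      (Measurable.aestronglyMeasurable ?_) (ae_of_all _ fun x => ?_)
    · exact (measurable_from_top (f := fun n : ℤ => q (cell h (n + 1)))).comp
        (Int.measurable_floor.comp (measurable_id.div_const h))
    · exact hq h hh x _ fun y hy => hbound le_rfl (hmem hh x) hy
  have habs : ∀ h > 0, ∀ x, ∀ C, (∀ y ∈ cell h (⌊x / h⌋ + 1), |f y| ≤ C) →
      |sSup ((fun y => |f y|) '' cell h (⌊x / h⌋ + 1))| ≤ C := by
    intro h hh x C hC
    have hne : ((fun y => |f y|) '' cell h (⌊x / h⌋ + 1)).Nonempty :=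
      ⟨_, mem_image_of_mem _ (hmem hh x)⟩
    rw [abs_of_nonneg]
    · exact csSup_le hne (forall_mem_image.2 hC)
    · exact Real.sSup_nonneg (forall_mem_image.2 fun y _ => abs_nonneg _)
  have hsup : ∀ h > 0, ∀ x, ∀ l u, (∀ y ∈ cell h (⌊x / h⌋ + 1), l ≤ f y ∧ f y ≤ u) →
      l ≤ sInf (f '' cell h (⌊x / h⌋ + 1)) ∧
      sInf (f '' cell h (⌊x / h⌋ + 1)) ≤ sSup (f '' cell h (⌊x / h⌋ + 1)) ∧
      sSup (f '' cell h (⌊x / h⌋ + 1)) ≤ u := by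
    intro h hh x l u hC
    have hne : (f '' cell h (⌊x / h⌋ + 1)).Nonempty := ⟨_, mem_image_of_mem _ (hmem hh x)⟩
    refine ⟨le_csInf hne (forall_mem_image.2 fun y hy => (hC y hy).1), ?_,
      csSup_le hne (forall_mem_image.2 fun y hy => (hC y hy).2)⟩
    exact Real.sInf_le_sSup _ ⟨l, forall_mem_image.2 fun y hy => (hC y hy).1⟩
      ⟨u, forall_mem_image.2 fun y hy => (hC y hy).2⟩
  have hintSup {h : ℝ} (hh : 0 < h) := hstep (fun s => sSup (f '' s)) (fun h hh x C hC => by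
    have := hsup h hh x (-C) C fun y hy => abs_le.1 (hC y hy)
    exact abs_le.2 ⟨by linarith, by linarith⟩) hh
  have hintInf {h : ℝ} (hh : 0 < h) := hstep (fun s => sInf (f '' s)) (fun h hh x C hC => by
    have := hsup h hh x (-C) C fun y hy => abs_le.1 (hC y hy)
    exact abs_le.2 ⟨by linarith, by linarith⟩) hh
  refine ⟨fun h hh => ?_, ?_⟩
  · exact (summable_mul_left_iff hh.ne').1 (hasSum_of_integrable_floor_div
      (p := fun n => sSup ((fun y => |f y|) '' cell h n)) hh
      (hstep (fun s => sSup ((fun y => |f y|) '' s)) habs hh)).summable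
  · have hlim : Tendsto (fun h : ℝ => ∫ x : ℝ, (sSup (f '' cell h (⌊x / h⌋ + 1)) -
        sInf (f '' cell h (⌊x / h⌋ + 1)))) (nhdsWithin 0 (Ioi 0)) (nhds (∫ _ : ℝ, (0 : ℝ))) := by
      refine tendsto_integral_filter_of_dominated_convergence
        (fun x => 2 * (Real.exp (c * (2 * 1)) * b (x - 1))) ?_ ?_ ?_ ?_
      · filter_upwards [self_mem_nhdsWithin] with h hh
        exact ((hintSup hh).sub (hintInf hh)).aestronglyMeasurable
      · filter_upwards [Ioo_mem_nhdsGT (zero_lt_one' ℝ)] with h hh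
        refine ae_of_all _ fun x => ?_
        have := hsup h hh.1 x _ _ fun y hy => abs_le.1 (hbound hh.2.le (hmem hh.1 x) hy)
        rw [Real.norm_eq_abs, abs_le]
        constructor <;> linarith
      · exact ((hb.comp_sub_right 1).const_mul _).const_mul 2
      · refine ae_of_all _ fun x => ?_
        rw [Metric.tendsto_nhds]
        intro η hη
        obtain ⟨d, hd, hfd⟩ := Metric.continuousAt_iff.1 hf.continuousAt (η / 3) (by positivity)
        filter_upwards [Ioo_mem_nhdsGT hd] with h hh
        have := hsup h hh.1 x (f x - η / 3) (f x + η / 3) fun y hy => by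
          have h₁ : dist (f y) (f x) < η / 3 := hfd <| by
            rw [Real.dist_eq]
            exact (hdist (hmem hh.1 x) hy).trans_lt hh.2
          rw [Real.dist_eq, abs_lt] at h₁
          constructor <;> linarith
        rw [Real.dist_eq, abs_lt]
        constructor <;> linarith
    rw [integral_zero] at hlim
    refine hlim.congr' ?_
    filter_upwards [self_mem_nhdsWithin] with h hh
    have hS := hasSum_of_integrable_floor_div (p := fun n => sSup (f '' cell h n)) hh (hintSup hh)
    have hI := hasSum_of_integrable_floor_div (p := fun n => sInf (f '' cell h n)) hh (hintInf hh)
    rw [integral_sub (hintSup hh) (hintInf hh), ← hS.tsum_eq, ← hI.tsum_eq, tsum_mul_left,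
      tsum_mul_left, ← mul_sub]

/-- A Hölder function vanishing near the origin is additive up to a product error term, which is
only present away from the origin. -/
theorem abs_add_sub_sub_le_of_holder {g : ℝ → ℝ} {K δ ε : ℝ} (hK : 0 ≤ K) (hε : 0 < ε)
    (hg : ∀ x y : ℝ, |g x - g y| ≤ K * |x - y| ^ (2 * ε)) (hδ : 0 < δ)
    (hzero : ∀ x, |x| < δ → g x = 0) (u v : ℝ) :
    |g (u + v) - g u - g v| ≤
      if δ / 2 ≤ max |u| |v| then 2 * K * (|u| ^ ε * |v| ^ ε) else 0 := by
  split_ifs with hmax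
  · have hg0 : g 0 = 0 := hzero 0 (by simpa using hδ)
    wlog huv : |v| ≤ |u| generalizing u v with hsymm
    · have := hsymm v u (by rwa [max_comm]) (le_of_not_ge huv)
      rwa [add_comm, sub_right_comm, mul_comm (|u| ^ ε)]
    have hpow : |v| ^ (2 * ε) ≤ |u| ^ ε * |v| ^ ε := by
      rw [two_mul, Real.rpow_add_of_nonneg (abs_nonneg v) hε.le hε.le]
      gcongr
    have h₁ := hg (u + v) u
    have h₂ := hg v 0
    rw [add_sub_cancel_left] at h₁
    rw [hg0, sub_zero, sub_zero] at h₂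
    have h₃ := abs_sub (g (u + v) - g u) (g v)
    have h₄ := mul_le_mul_of_nonneg_left hpow hK
    linarith
  · rw [not_le, max_lt_iff] at hmax
    have huv := abs_add_le u v
    rw [hzero (u + v) (by linarith), hzero u (by linarith), hzero v (by linarith)]
    simp

theorem integral_ite_exp_le {c m : ℝ} (hc : 0 < c) (hm : 0 ≤ m) (w : ℝ) :
    Integrable (fun x => if Real.exp x ≤ m then Real.exp (c * x) * w else 0) ∧
      ∫ x, (if Real.exp x ≤ m then Real.exp (c * x) * w else 0) = m ^ c / c * w := by
  rcases hm.eq_or_lt with rfl | hm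
  · simp [(Real.exp_pos _).not_ge, Real.zero_rpow hc.ne']
  have hfun : (fun x => if Real.exp x ≤ m then Real.exp (c * x) * w else 0) =
      (Iic (Real.log m)).indicator fun x => Real.exp (c * x) * w := by
    ext x
    simp [indicator_apply, Real.le_log_iff_exp_le hm]
  rw [hfun, integrable_indicator_iff measurableSet_Iic, integral_indicator measurableSet_Iic,
    integral_mul_const, integral_exp_mul_Iic hc, mul_comm c, ← Real.rpow_def_of_pos hm]
  exact ⟨(integrableOn_exp_mul_Iic hc _).mul_const w, rfl⟩

theorem integrable_integral_ite_exp_le {Ω : Type*} [MeasurableSpace Ω] {μ : Measure Ω}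
    [SFinite μ] {W m : Ω → ℝ} {c : ℝ} (hc : 0 < c) (hW : Measurable W) (hm : Measurable m)
    (hW0 : ∀ ω, 0 ≤ W ω) (hm0 : ∀ ω, 0 ≤ m ω) (hint : Integrable (fun ω => m ω ^ c * W ω) μ) :
    Integrable fun x => ∫ ω, (if Real.exp x ≤ m ω then Real.exp (c * x) * W ω else 0) ∂μ := by
  have hmeas : Measurable fun z : ℝ × Ω =>
      if Real.exp z.1 ≤ m z.2 then Real.exp (c * z.1) * W z.2 else 0 :=
    Measurable.ite (measurableSet_le (by fun_prop) (by fun_prop)) (by fun_prop) measurable_const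
  refine Integrable.integral_prod_left (ν := μ) (f := fun z : ℝ × Ω =>
      if Real.exp z.1 ≤ m z.2 then Real.exp (c * z.1) * W z.2 else 0)
    ((integrable_prod_iff' hmeas.aestronglyMeasurable).2 ⟨?_, ?_⟩)
  · exact ae_of_all _ fun ω => (integral_ite_exp_le hc (hm0 ω) (W ω)).1
  · have hnorm (ω : Ω) (x : ℝ) : ‖if Real.exp x ≤ m ω then Real.exp (c * x) * W ω else 0‖ =
        if Real.exp x ≤ m ω then Real.exp (c * x) * W ω else 0 := by
      refine Real.norm_of_nonneg ?_
      have := hW0 ω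
      split_ifs <;> positivity
    simp only [hnorm, (integral_ite_exp_le hc (hm0 _) _).2]
    simpa [div_mul_eq_mul_div] using hint.div_const c

theorem integrable_ite_exp_le {Ω : Type*} [MeasurableSpace Ω] {μ : Measure Ω}
    {W m : Ω → ℝ} {c : ℝ} (hc : 0 < c) (hW : Measurable W) (hm : Measurable m)
    (hW0 : ∀ ω, 0 ≤ W ω) (hm0 : ∀ ω, 0 ≤ m ω) (hint : Integrable (fun ω => m ω ^ c * W ω) μ)
    (x : ℝ) :
    Integrable (fun ω => if Real.exp x ≤ m ω then Real.exp (c * x) * W ω else 0) μ := by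
  refine hint.mono' (Measurable.aestronglyMeasurable ?_) (ae_of_all _ fun ω => ?_)
  · exact Measurable.ite (measurableSet_le measurable_const hm) (by fun_prop) measurable_const
  · have hW0 := hW0 ω
    have hm0 := hm0 ω
    split_ifs with h
    · rw [Real.norm_of_nonneg (by positivity), mul_comm c, Real.exp_mul]
      gcongr
    · rw [norm_zero]
      positivity

theorem integral_ite_exp_le_growth {Ω : Type*} [MeasurableSpace Ω] {μ : Measure Ω}
    {W m : Ω → ℝ} {c : ℝ} (hc : 0 < c) (hW : Measurable W) (hm : Measurable m)
    (hW0 : ∀ ω, 0 ≤ W ω) (hm0 : ∀ ω, 0 ≤ m ω) (hint : Integrable (fun ω => m ω ^ c * W ω) μ)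
    {x y : ℝ} (hxy : x ≤ y) :
    ∫ ω, (if Real.exp y ≤ m ω then Real.exp (c * y) * W ω else 0) ∂μ ≤
      Real.exp (c * (y - x)) *
        ∫ ω, (if Real.exp x ≤ m ω then Real.exp (c * x) * W ω else 0) ∂μ := by
  rw [← integral_const_mul]
  refine integral_mono (integrable_ite_exp_le hc hW hm hW0 hm0 hint y)
    ((integrable_ite_exp_le hc hW hm hW0 hm0 hint x).const_mul _) fun ω => ?_
  have hW0 := hW0 ω
  dsimp only
  split_ifs with hy hx hx
  · rw [← mul_assoc, ← Real.exp_add]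
    apply le_of_eq
    congr 2
    ring
  · exact absurd ((Real.exp_le_exp.2 hxy).trans hy) hx
  · positivity
  · simp

/-- Interpolation between the moments `|a|^α` and `|b|^(α-ε)|a|^ε`. -/
theorem rpow_sub_mul_rpow_le {a b α ε : ℝ} (ha : 0 ≤ a) (hb : 0 ≤ b) (hε : 0 < ε)
    (hεα : ε < α / 2) : a ^ (α - ε) * b ^ ε ≤ a ^ α + b ^ (α - ε) * a ^ ε := by
  rcases le_total b a with h | h
  · have h₁ : a ^ (α - ε) * b ^ ε ≤ a ^ (α - ε) * a ^ ε := by gcongr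
    rw [← Real.rpow_add_of_nonneg ha (by linarith) hε.le, sub_add_cancel] at h₁
    have : 0 ≤ b ^ (α - ε) * a ^ ε := by positivity
    linarith
  · have hsplit (t : ℝ) (ht : 0 ≤ t) : t ^ (α - ε) = t ^ (α - 2 * ε) * t ^ ε := by
      rw [← Real.rpow_add_of_nonneg ht (by linarith) hε.le]
      congr 1
      ring
    have h₁ : a ^ (α - 2 * ε) ≤ b ^ (α - 2 * ε) := Real.rpow_le_rpow ha h (by linarith)
    have h₂ : a ^ (α - ε) * b ^ ε ≤ b ^ (α - ε) * a ^ ε := by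
      rw [hsplit a ha, hsplit b hb, mul_assoc, mul_assoc, mul_comm (b ^ ε)]
      gcongr
    have : 0 ≤ a ^ α := by positivity
    linarith

theorem max_rpow_mul_rpow_mul_rpow_le {u v α ε : ℝ} (hu : 0 ≤ u) (hv : 0 ≤ v) (hε : 0 < ε)
    (hεα : ε < α / 2) :
    max u v ^ (α - 2 * ε) * (u ^ ε * v ^ ε) ≤ u ^ (α - ε) * v ^ ε + v ^ (α - ε) * u ^ ε := by
  have hsplit (t : ℝ) (ht : 0 ≤ t) : t ^ (α - ε) = t ^ (α - 2 * ε) * t ^ ε := by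
    rw [← Real.rpow_add_of_nonneg ht (by linarith) hε.le]
    congr 1
    ring
  rw [hsplit u hu, hsplit v hv]
  have h₁ : 0 ≤ u ^ (α - 2 * ε) * u ^ ε * v ^ ε := by positivity
  have h₂ : 0 ≤ v ^ (α - 2 * ε) * v ^ ε * u ^ ε := by positivity
  rcases max_choice u v with h | h <;> rw [h] <;> nlinarith

/-- Let `(A,B)` be independent of `R`, `0 < ε < α/2`, `ε ≤ 1/2`,
`E|A|^α < ∞`, `E[|B|^{α−ε}|A|^ε] < ∞`, and `E|R|^β < ∞` for every `β < α`. Then for every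
`g ∈ H^ε` with `0 ∉ supp g`, the function
`ψ₀(x) = e^{αx} E[g(e^{−x}(AR+B)) − g(e^{−x}AR) − g(e^{−x}B)]` is directly Riemann
integrable. -/
theorem psi_zero_directly_Riemann_integrable
    {Ω : Type*} [MeasurableSpace Ω] (μ : Measure Ω) [IsProbabilityMeasure μ]
    (A B R : Ω → ℝ)
    (hAmeas : Measurable A) (hBmeas : Measurable B) (hRmeas : Measurable R)
    (hindep : IndepFun (fun ω => (A ω, B ω)) R μ)
    (α ε : ℝ) (hα : 0 < α) (hε0 : 0 < ε) (hε2 : ε < α/2) (hε1 : ε ≤ 1/2)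
    (hAint : Integrable (fun ω => |A ω| ^ α) μ)
    (hABint : Integrable (fun ω => |B ω| ^ (α - ε) * |A ω| ^ ε) μ)
    (hRmom : ∀ b, 0 ≤ b → b < α → Integrable (fun ω => |R ω| ^ b) μ)
    (g : ℝ → ℝ) (hg : MemHolderClass ε g)
    (hgsupp : (0:ℝ) ∉ closure (Function.support g)) :
    DirectlyRiemannIntegrable (fun x => Real.exp (α * x) *
      ∫ ω, (g (Real.exp (-x) * (A ω * R ω + B ω)) - g (Real.exp (-x) * (A ω * R ω)) -
        g (Real.exp (-x) * B ω)) ∂μ) := by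
  obtain ⟨⟨M, hM⟩, K, hK⟩ := hg
  have hK0 : 0 ≤ K := by simpa using (abs_nonneg _).trans (hK 1 0)
  obtain ⟨δ, hδ, hzero⟩ : ∃ δ > 0, ∀ x, |x| < δ → g x = 0 := by
    obtain ⟨δ, hδ, hball⟩ := Metric.mem_nhds_iff.1 (isClosed_closure.isOpen_compl.mem_nhds hgsupp)
    refine ⟨δ, hδ, fun x hx => ?_⟩
    by_contra hne
    exact hball (by simpa using hx) (subset_closure hne)
  have hgcont : Continuous g := by
    rw [continuous_iff_continuousAt]
    intro x
    have hlim : Tendsto (fun y => K * |y - x| ^ (2 * ε)) (nhds x) (nhds 0) := by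
      have : Continuous fun y => K * |y - x| ^ (2 * ε) :=
        continuous_const.mul (Continuous.rpow_const (by fun_prop) fun _ => Or.inr (by linarith))
      simpa [Real.zero_rpow (by linarith : 2 * ε ≠ 0)] using this.tendsto x
    exact tendsto_iff_dist_tendsto_zero.2
      (squeeze_zero (fun _ => dist_nonneg) (fun y => hK y x) hlim)
  have hc : 0 < α - 2 * ε := by linarith
  let W : Ω → ℝ := fun ω => 2 * K * (|A ω * R ω| ^ ε * |B ω| ^ ε)
  let m : Ω → ℝ := fun ω => 2 / δ * max |A ω * R ω| |B ω|
  have hW : Measurable W := by fun_prop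
  have hm : Measurable m := by fun_prop
  have hW0 (ω : Ω) : 0 ≤ W ω := by positivity
  have hm0 (ω : Ω) : 0 ≤ m ω := by positivity
  have hint : Integrable (fun ω => m ω ^ (α - 2 * ε) * W ω) μ := by
    have hmixed : Integrable (fun ω => |A ω| ^ (α - ε) * |B ω| ^ ε) μ := by
      refine (hAint.add hABint).mono' (by fun_prop) (ae_of_all _ fun ω => ?_)
      rw [Real.norm_of_nonneg (by positivity)]
      exact rpow_sub_mul_rpow_le (abs_nonneg _) (abs_nonneg _) hε0 hε2
    have h₁ : Integrable (fun ω => |A ω| ^ (α - ε) * |B ω| ^ ε * |R ω| ^ (α - ε)) μ :=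
      (hindep.comp (φ := fun z : ℝ × ℝ => |z.1| ^ (α - ε) * |z.2| ^ ε)
        (ψ := fun r : ℝ => |r| ^ (α - ε)) (by fun_prop) (by fun_prop)).integrable_mul
        hmixed (hRmom (α - ε) (by linarith) (by linarith))
    have h₂ : Integrable (fun ω => |B ω| ^ (α - ε) * |A ω| ^ ε * |R ω| ^ ε) μ :=
      (hindep.comp (φ := fun z : ℝ × ℝ => |z.2| ^ (α - ε) * |z.1| ^ ε)
        (ψ := fun r : ℝ => |r| ^ ε) (by fun_prop) (by fun_prop)).integrable_mul
        hABint (hRmom ε hε0.le (by linarith))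
    refine ((h₁.add h₂).const_mul ((2 / δ) ^ (α - 2 * ε) * (2 * K))).mono'
      (by fun_prop) (ae_of_all _ fun ω => ?_)
    have hW0 := hW0 ω
    have hm0 := hm0 ω
    rw [Real.norm_of_nonneg (by positivity)]
    have hle := max_rpow_mul_rpow_mul_rpow_le (abs_nonneg (A ω * R ω)) (abs_nonneg (B ω)) hε0 hε2
    have hsum : |A ω * R ω| ^ (α - ε) * |B ω| ^ ε + |B ω| ^ (α - ε) * |A ω * R ω| ^ ε =
        |A ω| ^ (α - ε) * |B ω| ^ ε * |R ω| ^ (α - ε) +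
          |B ω| ^ (α - ε) * |A ω| ^ ε * |R ω| ^ ε := by
      rw [abs_mul, Real.mul_rpow (abs_nonneg _) (abs_nonneg _),
        Real.mul_rpow (abs_nonneg _) (abs_nonneg _)]
      ring
    rw [hsum] at hle
    calc m ω ^ (α - 2 * ε) * W ω
        = (2 / δ) ^ (α - 2 * ε) * (2 * K) * (max |A ω * R ω| |B ω| ^ (α - 2 * ε) *
            (|A ω * R ω| ^ ε * |B ω| ^ ε)) := by
          simp only [m, W]
          rw [Real.mul_rpow (by positivity) (by positivity)]
          ring
      _ ≤ _ := mul_le_mul_of_nonneg_left hle (by positivity)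
  have hpointwise (x : ℝ) (ω : Ω) : Real.exp (α * x) *
      |g (Real.exp (-x) * (A ω * R ω + B ω)) - g (Real.exp (-x) * (A ω * R ω)) -
        g (Real.exp (-x) * B ω)| ≤
      if Real.exp x ≤ m ω then Real.exp ((α - 2 * ε) * x) * W ω else 0 := by
    have hle := abs_add_sub_sub_le_of_holder hK0 hε0 hK hδ hzero
      (Real.exp (-x) * (A ω * R ω)) (Real.exp (-x) * B ω)
    have hcond : δ / 2 ≤ max |Real.exp (-x) * (A ω * R ω)| |Real.exp (-x) * B ω| ↔
        Real.exp x ≤ m ω := by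
      rw [abs_mul, abs_mul (Real.exp (-x)), Real.abs_exp,
        ← mul_max_of_nonneg _ _ (Real.exp_pos _).le, Real.exp_neg, inv_mul_eq_div,
        le_div_iff₀ (Real.exp_pos x)]
      simp only [m]
      rw [div_mul_eq_mul_div 2 δ, le_div_iff₀ hδ]
      constructor <;> intro h <;> linarith
    simp only [hcond] at hle
    rw [mul_add]
    refine (mul_le_mul_of_nonneg_left hle (Real.exp_pos _).le).trans_eq ?_
    split_ifs
    · have hexp : Real.exp ((α - 2 * ε) * x) =
          Real.exp (α * x) * (Real.exp (-x * ε) * Real.exp (-x * ε)) := by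
        rw [← Real.exp_add, ← Real.exp_add]
        congr 1
        ring
      rw [abs_mul, abs_mul (Real.exp (-x)), Real.abs_exp,
        Real.mul_rpow (Real.exp_pos _).le (abs_nonneg _),
        Real.mul_rpow (Real.exp_pos _).le (abs_nonneg _), ← Real.exp_mul, hexp]
      simp only [W]
      ring
    · simp
  refine DirectlyRiemannIntegrable.of_continuous_of_le hc.le ?_
    (integrable_integral_ite_exp_le (μ := μ) hc hW hm hW0 hm0 hint) (fun x => ?_)
    (fun x y hxy => integral_ite_exp_le_growth hc hW hm hW0 hm0 hint hxy)
  · refine Continuous.mul (by fun_prop) (continuous_of_dominated (bound := fun _ => M + M + M)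
      (fun x => ?_) (fun x => ae_of_all _ fun ω => ?_) (integrable_const _)
      (ae_of_all _ fun ω => by fun_prop))
    · have := hgcont.measurable
      fun_prop
    · refine (norm_sub_le _ _).trans (add_le_add ((norm_sub_le _ _).trans
        (add_le_add (hM _) (hM _))) (hM _))
  · rw [abs_mul, Real.abs_exp]
    refine (mul_le_mul_of_nonneg_left abs_integral_le_integral_abs (Real.exp_pos _).le).trans ?_
    rw [← integral_const_mul]
    exact integral_mono_of_nonneg (ae_of_all _ fun ω => by positivity)
      (integrable_ite_exp_le hc hW hm hW0 hm0 hint x) (ae_of_all _ (hpointwise x))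
end
end
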